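/- Let n = 3. For every 6-element subset {s_1, …, s_6} of {1, 2, 3, 4, 5, 6, 11, 12, 13, 17, 19, 23}, the set of Lagrangian subspaces H ⊆ ℂ^6 (for the alternating form ⟨x,y⟩ = Σ_{i=1}^{3} (x_i y_{7−i} − y_i x_{7−i})) satisfying H ∩ F_3(s_j) ≠ {0} for j = 1, …, 6 has exactly sixteen elements, and none of them is real, i.e., none is stable under coordinatewise complex conjugation. -/

import Mathlib

/-- The `i`-th coordinate function of the curve `γ : ℂ → ℂ^{2n}`,
`γ(s)_i = (−1)^{max(i−n−1,0)} s^{i−1}/(i−1)!` (0-indexed `i`). -/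
noncomputable def gammaLC (n : ℕ) (i : Fin (2 * n)) : ℂ → ℂ :=
  fun s => (-1 : ℂ) ^ ((i : ℕ) - n) * s ^ (i : ℕ) / (Nat.factorial (i : ℕ))

/-- The index pairing `i ↦ 2n+1−i` (1-indexed), i.e. `i ↦ 2n−1−i` (0-indexed),
for `i` among the first `n` indices. -/
def pairLC (n : ℕ) (i : Fin n) : Fin (2 * n) :=
  ⟨2 * n - 1 - (i : ℕ), by have := i.isLt; omega⟩

/-- The inclusion of the first `n` indices into `Fin (2n)`. -/
def inclLC (n : ℕ) (i : Fin n) : Fin (2 * n) :=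
  ⟨(i : ℕ), by have := i.isLt; omega⟩

/-- The alternating form `⟨x,y⟩ = Σ_{i=1}^{n} (x_i y_{2n+1−i} − y_i x_{2n+1−i})` on `ℂ^{2n}`. -/
noncomputable def formLC (n : ℕ) (x y : Fin (2 * n) → ℂ) : ℂ :=
  ∑ i : Fin n, (x (inclLC n i) * y (pairLC n i) - y (inclLC n i) * x (pairLC n i))

/-- The osculating subspace `F_k(s) = span{γ(s), γ'(s), …, γ^{(k-1)}(s)}`,
derivatives taken coordinatewise. -/
noncomputable def oscLC (n k : ℕ) (s : ℂ) : Submodule ℂ (Fin (2 * n) → ℂ) :=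
  Submodule.span ℂ (Set.range fun j : Fin k => fun i => iteratedDeriv (j : ℕ) (gammaLC n i) s)

/-- A subspace of `ℂ^N` is real if it is stable under coordinatewise complex conjugation. -/
def conjStableLC (n : ℕ) (H : Submodule ℂ (Fin (2 * n) → ℂ)) : Prop :=
  ∀ x ∈ H, (fun i => (starRingEnd ℂ) (x i)) ∈ H

namespace Wronski

/-- A row vector in the basis `1, c, c², τ, Y, τ², τY, Y²`. -/
@[ext] structure Row (R : Type*) where
  (x0 x1 x2 x3 x4 x5 x6 x7 : R)

/-- The coefficients `f₀, …, f₃` of a monic quartic, the normalised coordinates `a, b` of a vector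
supported on the last three coordinates, and an element `e` standing for `-1`, which lets the
formulas below be evaluated in the semiring `ℕ`. -/
structure Params (R : Type*) where
  (f0 f1 f2 f3 a b e : R)

variable {R : Type*} [CommSemiring R]

namespace Row

instance : Add (Row R) where
  add u v := ⟨u.x0 + v.x0, u.x1 + v.x1, u.x2 + v.x2, u.x3 + v.x3, u.x4 + v.x4, u.x5 + v.x5,
    u.x6 + v.x6, u.x7 + v.x7⟩

instance : SMul R (Row R) where
  smul r v := ⟨r * v.x0, r * v.x1, r * v.x2, r * v.x3, r * v.x4, r * v.x5, r * v.x6, r * v.x7⟩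

end Row

namespace Params

variable (p : Params R)

def g0 : R := p.f0 ^ 3 * p.a ^ 2
def g1 : R := p.f0 ^ 2 * p.a * (6 * p.b + p.e * p.f1 * p.a)
def g2 : R :=
  p.f0 * (12 * p.b ^ 2 + p.e * (6 * p.f1 * p.a * p.b) +
    (p.f1 ^ 2 + p.e * (p.f0 * p.f2)) * p.a ^ 2)

def rowT : Row R := ⟨0, 0, 0, 180, 0, 0, 0, 0⟩
def rowY : Row R := ⟨0, 0, 0, 0, 180, 0, 0, 0⟩
def rowV : Row R := ⟨p.e * (30 * p.g2), p.e * (300 * p.f0 * p.a), 0, 30 * p.f3, 0, 0, 0, 0⟩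
def rowS : Row R :=
  ⟨p.e * (15 * (p.f3 * p.g2 + p.g1)), p.e * (150 * p.f0 * p.f3 * p.a), 0, 15 * p.f2, p.e * 150,
    0, 0, 0⟩
def rowN : Row R :=
  ⟨p.e * (4 * (p.f2 * p.g2 + p.f3 * p.g1 + p.g0)), p.e * (40 * p.f0 * p.f2 * p.a), 180, 4 * p.f1,
    0, 0, 0, 0⟩
def rowM : Row R :=
  ⟨p.e * (4 * (p.f1 * p.g2 + p.f2 * p.g1 + p.f3 * p.g0)),
    p.f0 * (180 * p.b + p.e * (40 * p.f1 * p.a)), 0, 4 * p.f0, 0, 0, 0, 0⟩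

/-- `2700 c³`. -/
def cub : Row R where
  x0 := p.f0 * ((20 * p.f0 ^ 2 * (p.f1 ^ 2 + p.e * (p.f0 * p.f2))) * p.a ^ 3 +
    (45 * p.f0 ^ 2 * p.f2 * p.f3 + 12 * p.f1 ^ 3 * p.f2 + p.e * (63 * p.f0 ^ 2 * p.f1 +
      57 * p.f0 * p.f1 ^ 2 * p.f3 + 12 * p.f0 * p.f1 * p.f2 ^ 2)) * p.a ^ 2 * p.b +
    (342 * p.f0 * p.f1 * p.f3 + p.e * (30 * p.f0 ^ 2 + 72 * p.f1 ^ 2 * p.f2)) * p.a * p.b ^ 2 +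
    (144 * p.f1 * p.f2 + p.e * (540 * p.f0 * p.f3)) * p.b ^ 3)
  x1 := (260 * p.f0 ^ 3 + 180 * p.f0 * p.f1 ^ 2 * p.f2 + p.e * (120 * p.f0 ^ 2 * p.f1 * p.f3 +
      60 * p.f0 ^ 2 * p.f2 ^ 2 + 60 * p.f1 ^ 4)) * p.a ^ 2 +
    (360 * p.f1 ^ 3 + p.e * (90 * p.f0 ^ 2 * p.f3 + 600 * p.f0 * p.f1 * p.f2)) * p.a * p.b +
    720 * (p.f0 * p.f2 + p.e * p.f1 ^ 2) * p.b ^ 2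
  x2 := 600 * (p.f0 * p.f2 + p.e * p.f1 ^ 2) * p.a + 2160 * p.f1 * p.b
  x3 := p.e * (20 * p.f0 ^ 2 * p.f3 * p.a) + (45 * p.f0 * p.f2 + p.e * (12 * p.f1 ^ 2)) * p.b
  x4 := p.f0 * (120 * p.f1 * p.a + p.e * (450 * p.b))
  x5 := 0
  x6 := 0
  x7 := 0

/-- `2700 cτ`. -/
def cT : Row R where
  x0 := p.f0 * (540 * (p.f0 * p.f1 * p.f3 + p.f0 * p.f2 ^ 2 + p.e * (p.f0 ^ 2 +
        p.f1 ^ 2 * p.f2)) * p.a ^ 2 * p.b +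
    3240 * (p.f1 * p.f2 + p.e * (p.f0 * p.f3)) * p.a * p.b ^ 2 + p.e * (6480 * p.f2 * p.b ^ 3))
  x1 := 2700 * (p.f0 ^ 2 * p.f3 + p.f1 ^ 3 + p.e * (2 * p.f0 * p.f1 * p.f2)) * p.a ^ 2 +
    (10800 * p.f0 * p.f2 + p.e * (16200 * p.f1 ^ 2)) * p.a * p.b + 32400 * p.f1 * p.b ^ 2
  x2 := 27000 * p.f1 * p.a + p.e * (97200 * p.b)
  x3 := 540 * p.f1 * p.b
  x4 := p.e * (5400 * p.f0 * p.a)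
  x5 := 0
  x6 := 0
  x7 := 0

/-- `2700 cY`. -/
def cY : Row R where
  x0 := p.f0 ^ 2 * p.b * (90 * (p.f0 * p.f2 + p.e * p.f1 ^ 2) * p.a ^ 2 +
    540 * p.f1 * p.a * p.b + p.e * (1080 * p.b ^ 2))
  x1 := p.e * (900 * p.f0 ^ 2 * p.a * p.b)
  x2 := 0
  x3 := p.f0 * (90 * p.f3 * p.b + p.e * (120 * p.f0 * p.a))
  x4 := 0
  x5 := 0
  x6 := 0
  x7 := 0

/-- Multiplication by `2700 c` on vectors in the span of `1, c, c², τ, Y`. -/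
def mulC (v : Row R) : Row R :=
  (⟨0, 2700 * v.x0, 2700 * v.x1, 0, 0, 0, 0, 0⟩ : Row R) +
    (v.x2 • p.cub + (v.x3 • p.cT + v.x4 • p.cY))

/-- Multiplication by `2700² τ` on vectors in the span of `1, c, c², τ, Y`. -/
def mulT (v : Row R) : Row R :=
  (⟨0, 0, 0, 2700 ^ 2 * v.x0, 0, 2700 ^ 2 * v.x3, 2700 ^ 2 * v.x4, 0⟩ : Row R) +
    ((2700 * v.x1) • p.cT + v.x2 • p.mulC p.cT)

/-- Multiplication by `2700² Y` on vectors in the span of `1, c, c², τ, Y`. -/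
def mulY (v : Row R) : Row R :=
  (⟨0, 0, 0, 0, 2700 ^ 2 * v.x0, 0, 2700 ^ 2 * v.x3, 2700 ^ 2 * v.x4⟩ : Row R) +
    ((2700 * v.x1) • p.cY + v.x2 • p.mulC p.cY)

/-- `2700²` times the product of two vectors in the span of `1, c, c², τ, Y`. -/
def mul (u v : Row R) : Row R :=
  (2700 ^ 2 * u.x0) • v + ((2700 * u.x1) • p.mulC v + (u.x2 • p.mulC (p.mulC v) +
    (u.x3 • p.mulT v + u.x4 • p.mulY v)))

/-- Multiplication by `2700³ c`. -/
def mulC' (v : Row R) : Row R :=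
  (2700 ^ 2 : R) • p.mulC v + (v.x5 • p.mulT p.cT + (v.x6 • p.mulT p.cY + v.x7 • p.mulY p.cY))

def minorTS : Row R := p.mul rowT p.rowS + p.e • p.mul p.rowV p.rowV
def minorTN : Row R := p.mul rowT p.rowN + p.e • p.mul p.rowV rowY
def minorTM : Row R := p.mul rowT p.rowM + p.e • p.mul rowY rowY
def minorVN : Row R := p.mul p.rowV p.rowN + p.e • p.mul rowY p.rowS
def minorVM : Row R := p.mul p.rowV p.rowM + p.e • p.mul rowY p.rowN
def minorSM : Row R := p.mul p.rowS p.rowM + p.e • p.mul p.rowN p.rowN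

/-- The determinant of a `3 × 3` matrix, with `e` in place of `-1`. -/
def det3 (e a b c a' b' c' a'' b'' c'' : R) : R :=
  a * (b' * c'' + e * (c' * b'')) + b * (c' * a'' + e * (a' * c'')) +
    c * (a' * b'' + e * (b' * a''))

/-- The determinant of the last three coordinates of three rows. -/
def top (u v w : Row R) : R := det3 p.e u.x5 u.x6 u.x7 v.x5 v.x6 v.x7 w.x5 w.x6 w.x7

/-- The combination of `v` with `minorTS`, `minorTN`, `minorTM` whose last three coordinates
vanish. -/
def red (v : Row R) : Row R :=
  p.top p.minorTS p.minorTN p.minorTM • v + p.e • (p.top v p.minorTN p.minorTM • p.minorTS +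
    (p.top p.minorTS v p.minorTM • p.minorTN + p.top p.minorTS p.minorTN v • p.minorTM))

/-- The determinant of the first five coordinates of five rows. -/
def det5 (u v r s t : Row R) : R :=
  (u.x0 * v.x1 + p.e * (u.x1 * v.x0)) * det3 p.e r.x2 r.x3 r.x4 s.x2 s.x3 s.x4 t.x2 t.x3 t.x4 +
  p.e * (u.x0 * v.x2 + p.e * (u.x2 * v.x0)) *
    det3 p.e r.x1 r.x3 r.x4 s.x1 s.x3 s.x4 t.x1 t.x3 t.x4 +
  (u.x0 * v.x3 + p.e * (u.x3 * v.x0)) * det3 p.e r.x1 r.x2 r.x4 s.x1 s.x2 s.x4 t.x1 t.x2 t.x4 +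
  p.e * (u.x0 * v.x4 + p.e * (u.x4 * v.x0)) *
    det3 p.e r.x1 r.x2 r.x3 s.x1 s.x2 s.x3 t.x1 t.x2 t.x3 +
  (u.x1 * v.x2 + p.e * (u.x2 * v.x1)) * det3 p.e r.x0 r.x3 r.x4 s.x0 s.x3 s.x4 t.x0 t.x3 t.x4 +
  p.e * (u.x1 * v.x3 + p.e * (u.x3 * v.x1)) *
    det3 p.e r.x0 r.x2 r.x4 s.x0 s.x2 s.x4 t.x0 t.x2 t.x4 +
  (u.x1 * v.x4 + p.e * (u.x4 * v.x1)) * det3 p.e r.x0 r.x2 r.x3 s.x0 s.x2 s.x3 t.x0 t.x2 t.x3 +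
  (u.x2 * v.x3 + p.e * (u.x3 * v.x2)) * det3 p.e r.x0 r.x1 r.x4 s.x0 s.x1 s.x4 t.x0 t.x1 t.x4 +
  p.e * (u.x2 * v.x4 + p.e * (u.x4 * v.x2)) *
    det3 p.e r.x0 r.x1 r.x3 s.x0 s.x1 s.x3 t.x0 t.x1 t.x3 +
  (u.x3 * v.x4 + p.e * (u.x4 * v.x3)) * det3 p.e r.x0 r.x1 r.x2 s.x0 s.x1 s.x2 t.x0 t.x1 t.x2

/-- The eliminant in `a, b` of the incidence problem. -/
def kdet : R :=
  p.det5 (p.red p.minorVN) (p.red p.minorVM) (p.red p.minorSM) (p.red (p.mulC' p.minorTS))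
    (p.red (p.mulC' (p.mulC' p.minorTS)))

section Map

variable {S : Type*} [CommSemiring S] (φ : R →+* S)

/-- The image of a parameter under a ring homomorphism. -/
def map : Params S := ⟨φ p.f0, φ p.f1, φ p.f2, φ p.f3, φ p.a, φ p.b, φ p.e⟩

/-- The image of a row under a ring homomorphism. -/
def _root_.Wronski.Row.map (v : Row R) : Row S :=
  ⟨φ v.x0, φ v.x1, φ v.x2, φ v.x3, φ v.x4, φ v.x5, φ v.x6, φ v.x7⟩

theorem _root_.Wronski.Row.map_add (u v : Row R) : (u + v).map φ = u.map φ + v.map φ := by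
  ext <;> exact _root_.map_add φ _ _

theorem _root_.Wronski.Row.map_smul (r : R) (v : Row R) : (r • v).map φ = φ r • v.map φ := by
  ext <;> exact _root_.map_mul φ _ _

theorem map_cub : p.cub.map φ = (p.map φ).cub := by
  simp [map_ofNat, cub, Row.map, map]

theorem map_cT : p.cT.map φ = (p.map φ).cT := by
  simp [map_ofNat, cT, Row.map, map]

theorem map_cY : p.cY.map φ = (p.map φ).cY := by
  simp [map_ofNat, cY, Row.map, map]

theorem map_mulC (v : Row R) : (p.mulC v).map φ = (p.map φ).mulC (v.map φ) := by
  simp only [mulC, Row.map_add, Row.map_smul, map_cub, map_cT, map_cY]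
  simp [map_ofNat, Row.map]

theorem map_mulT (v : Row R) : (p.mulT v).map φ = (p.map φ).mulT (v.map φ) := by
  simp only [mulT, Row.map_add, Row.map_smul, map_mulC, map_cT]
  simp [map_ofNat, Row.map]

theorem map_mulY (v : Row R) : (p.mulY v).map φ = (p.map φ).mulY (v.map φ) := by
  simp only [mulY, Row.map_add, Row.map_smul, map_mulC, map_cY]
  simp [map_ofNat, Row.map]

theorem map_mul (u v : Row R) : (p.mul u v).map φ = (p.map φ).mul (u.map φ) (v.map φ) := by
  simp only [mul, Row.map_add, Row.map_smul, map_mulC, map_mulT, map_mulY]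
  simp [map_ofNat, Row.map]

theorem map_mulC' (v : Row R) : (p.mulC' v).map φ = (p.map φ).mulC' (v.map φ) := by
  simp only [mulC', Row.map_add, Row.map_smul, map_mulC, map_mulT, map_mulY, map_cT, map_cY]
  simp [map_ofNat, Row.map]

theorem map_rowT : (rowT : Row R).map φ = rowT := by simp [map_ofNat, rowT, Row.map]

theorem map_rowY : (rowY : Row R).map φ = rowY := by simp [map_ofNat, rowY, Row.map]

theorem map_rowV : p.rowV.map φ = (p.map φ).rowV := by simp [map_ofNat, rowV, g2, Row.map, map]

theorem map_rowS : p.rowS.map φ = (p.map φ).rowS := by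
  simp [map_ofNat, rowS, g1, g2, Row.map, map]

theorem map_rowN : p.rowN.map φ = (p.map φ).rowN := by
  simp [map_ofNat, rowN, g0, g1, g2, Row.map, map]

theorem map_rowM : p.rowM.map φ = (p.map φ).rowM := by
  simp [map_ofNat, rowM, g0, g1, g2, Row.map, map]

theorem map_minorTS : p.minorTS.map φ = (p.map φ).minorTS := by
  simp [minorTS, Row.map_add, Row.map_smul, map_mul, map_rowT, map_rowS, map_rowV, map]

theorem map_minorTN : p.minorTN.map φ = (p.map φ).minorTN := by
  simp [minorTN, Row.map_add, Row.map_smul, map_mul, map_rowT, map_rowN, map_rowV, map_rowY, map]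

theorem map_minorTM : p.minorTM.map φ = (p.map φ).minorTM := by
  simp [minorTM, Row.map_add, Row.map_smul, map_mul, map_rowT, map_rowM, map_rowY, map]

theorem map_minorVN : p.minorVN.map φ = (p.map φ).minorVN := by
  simp [minorVN, Row.map_add, Row.map_smul, map_mul, map_rowV, map_rowN, map_rowY, map_rowS, map]

theorem map_minorVM : p.minorVM.map φ = (p.map φ).minorVM := by
  simp [minorVM, Row.map_add, Row.map_smul, map_mul, map_rowV, map_rowM, map_rowY, map_rowN, map]

theorem map_minorSM : p.minorSM.map φ = (p.map φ).minorSM := by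
  simp [minorSM, Row.map_add, Row.map_smul, map_mul, map_rowS, map_rowM, map_rowN, map]

theorem map_det3 (e a b c a' b' c' a'' b'' c'' : R) :
    φ (det3 e a b c a' b' c' a'' b'' c'') =
      det3 (φ e) (φ a) (φ b) (φ c) (φ a') (φ b') (φ c') (φ a'') (φ b'') (φ c'') := by
  simp [det3]

theorem map_top (u v w : Row R) :
    φ (p.top u v w) = (p.map φ).top (u.map φ) (v.map φ) (w.map φ) := by
  simp [top, map_det3, Row.map, map]

theorem map_red (v : Row R) : (p.red v).map φ = (p.map φ).red (v.map φ) := by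
  simp only [red, Row.map_add, Row.map_smul, map_top, map_minorTS, map_minorTN, map_minorTM]
  rfl

theorem map_det5 (u v r s t : Row R) :
    φ (p.det5 u v r s t) =
      (p.map φ).det5 (u.map φ) (v.map φ) (r.map φ) (s.map φ) (t.map φ) := by
  simp [det5, map_det3, Row.map, map]

theorem map_kdet : φ p.kdet = (p.map φ).kdet := by
  simp only [kdet, map_det5, map_red, map_mulC', map_minorTS, map_minorVN, map_minorVM,
    map_minorSM]

end Map

end Params

namespace Row

variable {R : Type*} [CommRing R]

/-- The pairing of a row vector with a column vector. -/
def dot (u k : Row R) : R :=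
  u.x0 * k.x0 + u.x1 * k.x1 + u.x2 * k.x2 + u.x3 * k.x3 + u.x4 * k.x4 + u.x5 * k.x5 +
    u.x6 * k.x6 + u.x7 * k.x7

theorem dot_add (u v k : Row R) : (u + v).dot k = u.dot k + v.dot k := by
  change (u.x0 + v.x0) * _ + (u.x1 + v.x1) * _ + (u.x2 + v.x2) * _ + (u.x3 + v.x3) * _ +
    (u.x4 + v.x4) * _ + (u.x5 + v.x5) * _ + (u.x6 + v.x6) * _ + (u.x7 + v.x7) * _ = _
  simp only [dot]
  ring

theorem smul_dot (r : R) (u k : Row R) : (r • u).dot k = r * u.dot k := by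
  change (r * u.x0) * _ + (r * u.x1) * _ + (r * u.x2) * _ + (r * u.x3) * _ + (r * u.x4) * _ +
    (r * u.x5) * _ + (r * u.x6) * _ + (r * u.x7) * _ = _
  simp only [dot]
  ring

/-- The values of the monomials `1, c, c², τ, Y, τ², τY, Y²`. -/
def monomials (c t y : R) : Row R := ⟨1, c, c ^ 2, t, y, t ^ 2, t * y, y ^ 2⟩

/-- The last three coordinates of a row vanish. -/
def IsLow (v : Row R) : Prop := v.x5 = 0 ∧ v.x6 = 0 ∧ v.x7 = 0

end Row

namespace Params

variable {R : Type*} [CommRing R] (p : Params R)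

/-- The products `c³`, `cτ`, `cY` are the linear combinations of `1, c, c², τ, Y` prescribed by
the parameters. -/
structure Relations (c t y : R) : Prop where
  cub : p.cub.dot (Row.monomials c t y) = 2700 * c ^ 3
  cT : p.cT.dot (Row.monomials c t y) = 2700 * (c * t)
  cY : p.cY.dot (Row.monomials c t y) = 2700 * (c * y)

theorem isLow_mulC (v : Row R) : (p.mulC v).IsLow := by
  refine ⟨?_, ?_, ?_⟩
  · change 0 + (v.x2 * 0 + (v.x3 * 0 + v.x4 * 0)) = (0 : R)
    ring
  · change 0 + (v.x2 * 0 + (v.x3 * 0 + v.x4 * 0)) = (0 : R)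
    ring
  · change 0 + (v.x2 * 0 + (v.x3 * 0 + v.x4 * 0)) = (0 : R)
    ring

theorem isLow_cT : p.cT.IsLow := ⟨rfl, rfl, rfl⟩

theorem isLow_cY : p.cY.IsLow := ⟨rfl, rfl, rfl⟩

section Products

variable {p} {c t y : R} (h : p.Relations c t y)

include h

theorem dot_mulC {v : Row R} (hv : v.IsLow) :
    (p.mulC v).dot (Row.monomials c t y) = 2700 * c * v.dot (Row.monomials c t y) := by
  obtain ⟨h5, h6, h7⟩ := hv
  simp only [mulC, Row.dot_add, Row.smul_dot, h.cub, h.cT, h.cY]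
  simp only [Row.dot, Row.monomials, h5, h6, h7]
  ring

theorem dot_mulT {v : Row R} (hv : v.IsLow) :
    (p.mulT v).dot (Row.monomials c t y) = 2700 ^ 2 * t * v.dot (Row.monomials c t y) := by
  obtain ⟨h5, h6, h7⟩ := hv
  simp only [mulT, Row.dot_add, Row.smul_dot, dot_mulC h p.isLow_cT, h.cT]
  simp only [Row.dot, Row.monomials, h5, h6, h7]
  ring

theorem dot_mulY {v : Row R} (hv : v.IsLow) :
    (p.mulY v).dot (Row.monomials c t y) = 2700 ^ 2 * y * v.dot (Row.monomials c t y) := by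
  obtain ⟨h5, h6, h7⟩ := hv
  simp only [mulY, Row.dot_add, Row.smul_dot, dot_mulC h p.isLow_cY, h.cY]
  simp only [Row.dot, Row.monomials, h5, h6, h7]
  ring

theorem dot_mul {u v : Row R} (hu : u.IsLow) (hv : v.IsLow) :
    (p.mul u v).dot (Row.monomials c t y) =
      2700 ^ 2 * (u.dot (Row.monomials c t y) * v.dot (Row.monomials c t y)) := by
  obtain ⟨h5, h6, h7⟩ := hu
  simp only [mul, Row.dot_add, Row.smul_dot, dot_mulC h (p.isLow_mulC v), dot_mulC h hv,
    dot_mulT h hv, dot_mulY h hv]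
  have hu' : u.dot (Row.monomials c t y) =
      u.x0 + u.x1 * c + u.x2 * c ^ 2 + u.x3 * t + u.x4 * y := by
    simp only [Row.dot, Row.monomials, h5, h6, h7]
    ring
  rw [hu']
  ring

theorem dot_mulC' (v : Row R) :
    (p.mulC' v).dot (Row.monomials c t y) = 2700 ^ 3 * c * v.dot (Row.monomials c t y) := by
  have hC : (p.mulC v).dot (Row.monomials c t y) =
      2700 * c * (v.x0 + v.x1 * c + v.x2 * c ^ 2 + v.x3 * t + v.x4 * y) := by
    simp only [mulC, Row.dot_add, Row.smul_dot, h.cub, h.cT, h.cY]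
    simp only [Row.dot, Row.monomials]
    ring
  simp only [mulC', Row.dot_add, Row.smul_dot, hC, dot_mulT h p.isLow_cT,
    dot_mulT h p.isLow_cY, dot_mulY h p.isLow_cY, h.cT, h.cY]
  simp only [Row.dot, Row.monomials]
  ring

end Products

/-- The vector `(A, B, C)` and the coordinate `c` solve the incidence equations: the symmetric
matrix of products of `A, B, C` is the one prescribed by the parameters, and `(A, B, C)` is
orthogonal to the line determined by `(a, b, c)`. -/
structure Sol (c A B C : R) : Prop where
  rowV : p.rowV.dot (Row.monomials c (A ^ 2) (A * C)) = 180 * (A * B)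
  rowS : p.rowS.dot (Row.monomials c (A ^ 2) (A * C)) = 180 * B ^ 2
  rowN : p.rowN.dot (Row.monomials c (A ^ 2) (A * C)) = 180 * (B * C)
  rowM : p.rowM.dot (Row.monomials c (A ^ 2) (A * C)) = 180 * C ^ 2
  orth : 2 * p.f0 ^ 2 * p.a * A - 9 * p.f0 * p.b * B + 45 * c * C = 0

theorem isLow_rowT : (rowT : Row R).IsLow := ⟨rfl, rfl, rfl⟩
theorem isLow_rowY : (rowY : Row R).IsLow := ⟨rfl, rfl, rfl⟩
theorem isLow_rowV : p.rowV.IsLow := ⟨rfl, rfl, rfl⟩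
theorem isLow_rowS : p.rowS.IsLow := ⟨rfl, rfl, rfl⟩
theorem isLow_rowN : p.rowN.IsLow := ⟨rfl, rfl, rfl⟩
theorem isLow_rowM : p.rowM.IsLow := ⟨rfl, rfl, rfl⟩

theorem dot_rowT (c t y : R) : (rowT : Row R).dot (Row.monomials c t y) = 180 * t := by
  simp [rowT, Row.dot, Row.monomials]

theorem dot_rowY (c t y : R) : (rowY : Row R).dot (Row.monomials c t y) = 180 * y := by
  simp [rowY, Row.dot, Row.monomials]

end Params

namespace Params

variable {p : Params ℂ}

theorem Sol.relations {c A B C : ℂ} (h : p.Sol c A B C) (he : p.e = -1) (h0 : p.f0 ≠ 0) :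
    p.Relations c (A ^ 2) (A * C) := by
  have hY : p.cY.dot (Row.monomials c (A ^ 2) (A * C)) = 2700 * (c * (A * C)) := by
    have hV := h.rowV
    have hl := h.orth
    simp only [Params.rowV, g2, Row.dot, Row.monomials, Params.cY, he] at *
    linear_combination (-60 * A) * hl + (3 * p.f0 * p.b) * hV
  have hT : p.cT.dot (Row.monomials c (A ^ 2) (A * C)) = 2700 * (c * A ^ 2) := by
    have hN := h.rowN
    have hM := h.rowM
    have hl := h.orth
    refine mul_left_cancel₀ h0 ?_
    simp only [Params.rowN, Params.rowM, g0, g1, g2, Row.dot, Row.monomials, Params.cT, he] at *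
    linear_combination (-2700 * C) * hl - 675 * c * hM + 135 * p.f0 * p.b * hN
  refine ⟨?_, hT, hY⟩
  have hV := h.rowV
  have hN := h.rowN
  have hS := h.rowS
  have hl := h.orth
  simp only [Params.rowV, Params.rowS, Params.rowN, g0, g1, g2, Row.dot, Row.monomials,
    Params.cub, Params.cT, he] at *
  linear_combination (-60 * B) * hl - (1 / 3) * (2 * p.f0 ^ 2 * p.a * hV -
    9 * p.f0 * p.b * hS + 45 * c * hN) - p.f1 / 45 * hT

end Params

namespace Row

variable {R : Type*} [CommRing R]

/-- The first five coordinates of a row. -/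
def low (v : Row R) : Fin 5 → R := ![v.x0, v.x1, v.x2, v.x3, v.x4]

end Row

namespace Params

section Elimination

variable {R : Type*} [CommRing R] (p : Params R)

/-- The matrix whose determinant is `kdet`. -/
def kMat : Matrix (Fin 5) (Fin 5) R :=
  Matrix.of ![(p.red p.minorVN).low, (p.red p.minorVM).low, (p.red p.minorSM).low,
    (p.red (p.mulC' p.minorTS)).low, (p.red (p.mulC' (p.mulC' p.minorTS))).low]

variable {p}

theorem det_of_low (he : p.e = -1) (u v r s t : Row R) :
    (Matrix.of ![u.low, v.low, r.low, s.low, t.low]).det = p.det5 u v r s t := by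
  simp [Matrix.det_succ_row_zero, Fin.sum_univ_succ, det5, det3, he, Row.low, Fin.succAbove]
  ring

theorem det_kMat (he : p.e = -1) : p.kMat.det = p.kdet := det_of_low he _ _ _ _ _

theorem isLow_red (he : p.e = -1) (v : Row R) : (p.red v).IsLow := by
  have key (u : Row R) : u.x5 = 0 ∧ u.x6 = 0 ∧ u.x7 = 0 → u.IsLow := id
  apply key
  generalize hr : p.minorTS = r
  generalize hs : p.minorTN = s
  generalize hu : p.minorTM = u
  refine ⟨?_, ?_, ?_⟩
  · rw [red, hr, hs, hu, he]
    change p.top r s u * v.x5 + -1 * (p.top v s u * r.x5 + (p.top r v u * s.x5 +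
      p.top r s v * u.x5)) = 0
    simp only [top, det3, he]
    ring
  · rw [red, hr, hs, hu, he]
    change p.top r s u * v.x6 + -1 * (p.top v s u * r.x6 + (p.top r v u * s.x6 +
      p.top r s v * u.x6)) = 0
    simp only [top, det3, he]
    ring
  · rw [red, hr, hs, hu, he]
    change p.top r s u * v.x7 + -1 * (p.top v s u * r.x7 + (p.top r v u * s.x7 +
      p.top r s v * u.x7)) = 0
    simp only [top, det3, he]
    ring

theorem _root_.Wronski.Row.IsLow.dot_eq {v : Row R} (hv : v.IsLow) (k : Row R) :
    v.dot k = v.low ⬝ᵥ k.low := by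
  obtain ⟨h5, h6, h7⟩ := hv
  simp [Row.dot, Row.low, h5, h6, h7, dotProduct, Fin.sum_univ_succ]
  ring

theorem red_dot (he : p.e = -1) {k : Row R} (hS : p.minorTS.dot k = 0)
    (hN : p.minorTN.dot k = 0) (hM : p.minorTM.dot k = 0) (v : Row R) :
    (p.red v).dot k = p.top p.minorTS p.minorTN p.minorTM * v.dot k := by
  simp only [red, Row.dot_add, Row.smul_dot, hS, hN, hM, he]
  ring

/-- The column vector `k` is annihilated by the rows defining `kdet`. -/
structure IsKer (p : Params R) (k : Row R) : Prop where
  ts : p.minorTS.dot k = 0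
  tn : p.minorTN.dot k = 0
  tm : p.minorTM.dot k = 0
  vn : p.minorVN.dot k = 0
  vm : p.minorVM.dot k = 0
  sm : p.minorSM.dot k = 0
  cts : (p.mulC' p.minorTS).dot k = 0
  ccts : (p.mulC' (p.mulC' p.minorTS)).dot k = 0

theorem IsKer.kMat_mulVec {k : Row R} (he : p.e = -1) (h : p.IsKer k) :
    p.kMat.mulVec k.low = 0 := by
  have key (v : Row R) (hv : v.dot k = 0) : (p.red v).low ⬝ᵥ k.low = 0 := by
    rw [← (isLow_red he v).dot_eq, red_dot he h.ts h.tn h.tm, hv, mul_zero]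
  funext i
  fin_cases i
  · exact key _ h.vn
  · exact key _ h.vm
  · exact key _ h.sm
  · exact key _ h.cts
  · exact key _ h.ccts

theorem Relations.minors {c t y : R} (h : p.Relations c t y) (he : p.e = -1) {V S N M : R}
    (hV : p.rowV.dot (Row.monomials c t y) = 180 * V)
    (hS : p.rowS.dot (Row.monomials c t y) = 180 * S)
    (hN : p.rowN.dot (Row.monomials c t y) = 180 * N)
    (hM : p.rowM.dot (Row.monomials c t y) = 180 * M) :
    p.minorTS.dot (Row.monomials c t y) = 486000 ^ 2 * (t * S - V ^ 2) ∧
    p.minorTN.dot (Row.monomials c t y) = 486000 ^ 2 * (t * N - V * y) ∧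
    p.minorTM.dot (Row.monomials c t y) = 486000 ^ 2 * (t * M - y ^ 2) ∧
    p.minorVN.dot (Row.monomials c t y) = 486000 ^ 2 * (V * N - y * S) ∧
    p.minorVM.dot (Row.monomials c t y) = 486000 ^ 2 * (V * M - y * N) ∧
    p.minorSM.dot (Row.monomials c t y) = 486000 ^ 2 * (S * M - N ^ 2) := by
  refine ⟨?_, ?_, ?_, ?_, ?_, ?_⟩
  · rw [minorTS, Row.dot_add, Row.smul_dot, dot_mul h isLow_rowT p.isLow_rowS,
      dot_mul h p.isLow_rowV p.isLow_rowV, dot_rowT, hS, hV, he]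
    ring
  · rw [minorTN, Row.dot_add, Row.smul_dot, dot_mul h isLow_rowT p.isLow_rowN,
      dot_mul h p.isLow_rowV isLow_rowY, dot_rowT, dot_rowY, hN, hV, he]
    ring
  · rw [minorTM, Row.dot_add, Row.smul_dot, dot_mul h isLow_rowT p.isLow_rowM,
      dot_mul h isLow_rowY isLow_rowY, dot_rowT, dot_rowY, hM, he]
    ring
  · rw [minorVN, Row.dot_add, Row.smul_dot, dot_mul h p.isLow_rowV p.isLow_rowN,
      dot_mul h isLow_rowY p.isLow_rowS, dot_rowY, hV, hN, hS, he]
    ring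
  · rw [minorVM, Row.dot_add, Row.smul_dot, dot_mul h p.isLow_rowV p.isLow_rowM,
      dot_mul h isLow_rowY p.isLow_rowN, dot_rowY, hV, hM, hN, he]
    ring
  · rw [minorSM, Row.dot_add, Row.smul_dot, dot_mul h p.isLow_rowS p.isLow_rowM,
      dot_mul h p.isLow_rowN p.isLow_rowN, hS, hM, hN, he]
    ring

end Elimination

variable {p : Params ℂ}

theorem Sol.isKer {c A B C : ℂ} (h : p.Sol c A B C) (he : p.e = -1) (h0 : p.f0 ≠ 0) :
    p.IsKer (Row.monomials c (A ^ 2) (A * C)) := by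
  have hr := h.relations he h0
  obtain ⟨h1, h2, h3, h4, h5, h6⟩ := hr.minors he h.rowV h.rowS h.rowN h.rowM
  have h1' : p.minorTS.dot (Row.monomials c (A ^ 2) (A * C)) = 0 := by rw [h1]; ring
  refine ⟨h1', ?_, ?_, ?_, ?_, ?_, ?_, ?_⟩
  · rw [h2]; ring
  · rw [h3]; ring
  · rw [h4]; ring
  · rw [h5]; ring
  · rw [h6]; ring
  · rw [dot_mulC' hr, h1', mul_zero]
  · rw [dot_mulC' hr, dot_mulC' hr, h1', mul_zero, mul_zero]

/-- A solution gives a zero of the eliminant. -/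
theorem Sol.kdet_eq_zero {c A B C : ℂ} (h : p.Sol c A B C) (he : p.e = -1) (h0 : p.f0 ≠ 0) :
    p.kdet = 0 := by
  rw [← det_kMat he]
  refine Matrix.exists_mulVec_eq_zero_iff.mp
    ⟨_, ?_, (h.isKer he h0).kMat_mulVec he⟩
  exact fun hz => one_ne_zero (congrFun hz 0)

/-- A zero of the eliminant gives a nonzero vector annihilated by all the rows. -/
theorem exists_isKer (he : p.e = -1) (htop : p.top p.minorTS p.minorTN p.minorTM ≠ 0)
    (hk : p.kdet = 0) : ∃ k : Row ℂ, k.low ≠ 0 ∧ p.IsKer k := by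
  rw [← det_kMat he] at hk
  obtain ⟨l, hl, hl0⟩ := Matrix.exists_mulVec_eq_zero_iff.mpr hk
  obtain ⟨x5, x6, x7, h1, h2, h3⟩ : ∃ x5 x6 x7 : ℂ,
      p.minorTS.dot ⟨l 0, l 1, l 2, l 3, l 4, x5, x6, x7⟩ = 0 ∧
      p.minorTN.dot ⟨l 0, l 1, l 2, l 3, l 4, x5, x6, x7⟩ = 0 ∧
      p.minorTM.dot ⟨l 0, l 1, l 2, l 3, l 4, x5, x6, x7⟩ = 0 := by
    generalize p.minorTS = r at htop
    generalize p.minorTN = s at htop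
    generalize p.minorTM = u at htop
    simp only [top, det3, he] at htop
    simp only [Row.dot]
    generalize r.x0 * l 0 + r.x1 * l 1 + r.x2 * l 2 + r.x3 * l 3 + r.x4 * l 4 = r0
    generalize s.x0 * l 0 + s.x1 * l 1 + s.x2 * l 2 + s.x3 * l 3 + s.x4 * l 4 = s0
    generalize u.x0 * l 0 + u.x1 * l 1 + u.x2 * l 2 + u.x3 * l 3 + u.x4 * l 4 = u0
    generalize r.x5 = a at *
    generalize r.x6 = b at *
    generalize r.x7 = c at *
    generalize s.x5 = a' at *
    generalize s.x6 = b' at *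
    generalize s.x7 = c' at *
    generalize u.x5 = a'' at *
    generalize u.x6 = b'' at *
    generalize u.x7 = c'' at *
    have hd := htop
    set d := a * (b' * c'' + -1 * (c' * b'')) + b * (c' * a'' + -1 * (a' * c'')) +
      c * (a' * b'' + -1 * (b' * a'')) with hd'
    refine ⟨-(r0 * (b' * c'' - c' * b'') - s0 * (b * c'' - c * b'') + u0 * (b * c' - c * b')) / d,
      -(-r0 * (a' * c'' - c' * a'') + s0 * (a * c'' - c * a'') - u0 * (a * c' - c * a')) / d,
      -(r0 * (a' * b'' - b' * a'') - s0 * (a * b'' - b * a'') + u0 * (a * b' - b * a')) / d,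
      ?_, ?_, ?_⟩ <;>
    · field_simp
      rw [hd']
      ring
  refine ⟨⟨l 0, l 1, l 2, l 3, l 4, x5, x6, x7⟩, ?_, ?_⟩
  · intro hz
    apply hl
    rw [← hz]
    funext i
    fin_cases i <;> rfl
  have hlow : (⟨l 0, l 1, l 2, l 3, l 4, x5, x6, x7⟩ : Row ℂ).low = l := by
    funext i
    fin_cases i <;> rfl
  have key (v : Row ℂ) (hv : (p.red v).low ⬝ᵥ l = 0) :
      v.dot ⟨l 0, l 1, l 2, l 3, l 4, x5, x6, x7⟩ = 0 := by
    have := red_dot he h1 h2 h3 v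
    rw [(isLow_red he v).dot_eq, hlow, hv] at this
    exact (mul_eq_zero.mp this.symm).resolve_left htop
  exact ⟨h1, h2, h3, key _ (congrFun hl0 0), key _ (congrFun hl0 1), key _ (congrFun hl0 2),
    key _ (congrFun hl0 3), key _ (congrFun hl0 4)⟩

end Params

/-- A functional vanishing on sufficiently many iterates of a vector under an endomorphism
vanishes on some eigenvector. -/
theorem exists_eigenvector_of_iterates {E : Type*} [AddCommGroup E] [Module ℂ E]
    [FiniteDimensional ℂ E] (g : Module.End ℂ E) (r : E →ₗ[ℂ] ℂ) {n : ℕ}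
    (hn : Module.finrank ℂ E ≤ n) {k : E} (hk : k ≠ 0) (h : ∀ i < n, r ((g ^ i) k) = 0) :
    ∃ x ≠ 0, r x = 0 ∧ ∃ μ : ℂ, g x = μ • x := by
  have hall (q : Polynomial ℂ) : r (Polynomial.aeval g q k) = 0 := by
    rw [LinearMap.aeval_eq_aeval_mod_charpoly, Polynomial.aeval_eq_sum_range, LinearMap.sum_apply,
      map_sum]
    refine Finset.sum_eq_zero fun i hi => ?_
    rw [LinearMap.smul_apply, map_smul]
    by_cases hin : i < n
    · rw [h i hin, smul_zero]
    · have hdeg : (q %ₘ g.charpoly).coeff i = 0 := by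
        refine Polynomial.coeff_eq_zero_of_degree_lt
          ((Polynomial.degree_modByMonic_lt q g.charpoly_monic).trans_le ?_)
        refine Polynomial.degree_le_of_natDegree_le ?_
        rw [LinearMap.charpoly_natDegree]
        omega
      rw [hdeg, zero_smul]
  let W : Submodule ℂ E := Submodule.span ℂ (Set.range fun q : Polynomial ℂ =>
    Polynomial.aeval g q k)
  have hW : ∀ x ∈ W, g x ∈ W := by
    intro x hx
    induction hx using Submodule.span_induction with
    | mem x hx =>
      obtain ⟨q, rfl⟩ := hx
      exact Submodule.subset_span ⟨Polynomial.X * q, by simp⟩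
    | zero => simp
    | add x y _ _ hx hy => rw [map_add]; exact W.add_mem hx hy
    | smul a x _ hx => rw [map_smul]; exact W.smul_mem a hx
  have hkW : k ∈ W := Submodule.subset_span ⟨1, by simp⟩
  have hr : ∀ x ∈ W, r x = 0 := by
    intro x hx
    induction hx using Submodule.span_induction with
    | mem x hx =>
      obtain ⟨q, rfl⟩ := hx
      exact hall q
    | zero => simp
    | add x y _ _ hx hy => rw [map_add, hx, hy, add_zero]
    | smul a x _ hx => rw [map_smul, hx, smul_zero]
  have : Nontrivial W := ⟨⟨k, hkW⟩, 0, fun h => hk (congrArg Subtype.val h)⟩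
  obtain ⟨μ, hμ⟩ := Module.End.exists_eigenvalue (g.restrict hW)
  obtain ⟨x, hx⟩ := hμ.exists_hasEigenvector
  refine ⟨x, fun h0 => hx.2 (Subtype.ext h0), hr x x.2, μ, ?_⟩
  exact congrArg Subtype.val hx.apply_eq_smul

namespace Row

theorem add_def {R : Type*} [CommSemiring R] (u v : Row R) :
    u + v = ⟨u.x0 + v.x0, u.x1 + v.x1, u.x2 + v.x2, u.x3 + v.x3, u.x4 + v.x4, u.x5 + v.x5,
      u.x6 + v.x6, u.x7 + v.x7⟩ := rfl

theorem smul_def {R : Type*} [CommSemiring R] (r : R) (v : Row R) :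
    r • v = ⟨r * v.x0, r * v.x1, r * v.x2, r * v.x3, r * v.x4, r * v.x5, r * v.x6, r * v.x7⟩ := rfl

/-- The pairing of a row with a column, as a linear functional of the column. -/
def dotL (v : Row ℂ) : (Fin 8 → ℂ) →ₗ[ℂ] ℂ where
  toFun k := v.dot ⟨k 0, k 1, k 2, k 3, k 4, k 5, k 6, k 7⟩
  map_add' k l := by simp only [dot, Pi.add_apply]; ring
  map_smul' r k := by simp only [dot, Pi.smul_apply, smul_eq_mul, RingHom.id_apply]; ring

theorem dotL_add (u v : Row ℂ) : (u + v).dotL = u.dotL + v.dotL :=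
  LinearMap.ext fun _ => dot_add _ _ _

theorem dotL_smul (r : ℂ) (v : Row ℂ) : (r • v).dotL = r • v.dotL :=
  LinearMap.ext fun _ => smul_dot _ _ _

end Row

namespace Params

/-- The obstruction to recovering a solution from a zero of the eliminant (for `a = 1`). -/
def rho {R : Type*} [CommSemiring R] (p : Params R) : R :=
  64 * p.f0 ^ 3 * p.f1 ^ 2 + p.e * (80 * p.f0 ^ 4 * p.f3 ^ 2) +
  (360 * p.f0 ^ 3 * p.f2 * p.f3 +
    p.e * (480 * p.f0 ^ 3 * p.f1 + 96 * p.f0 ^ 2 * p.f1 ^ 2 * p.f3)) * p.b +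
  (900 * p.f0 ^ 3 + 180 * p.f0 ^ 2 * p.f1 * p.f3 + 108 * p.f0 * p.f1 ^ 2 * p.f2 +
    p.e * (405 * p.f0 ^ 2 * p.f2 ^ 2)) * p.b ^ 2 +
  (405 * p.f0 * p.f1 * p.f2 + p.e * (675 * p.f0 ^ 2 * p.f3 + 108 * p.f1 ^ 3)) * p.b ^ 3

theorem map_rho {R S : Type*} [CommSemiring R] [CommSemiring S] (φ : R →+* S) (p : Params R) :
    φ p.rho = (p.map φ).rho := by
  simp [map_ofNat, rho, map]

variable (p : Params ℂ)

/-- The combination `2 f₀ a · TN - 9 b · VN` of two minors. -/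
def zetaN : Row ℂ := (2 * p.f0 * p.a) • p.minorTN + (-(9 * p.b)) • p.minorVN

/-- The combination `2 f₀ a · VM - 9 b · SM` of two minors. -/
def zetaS : Row ℂ := (2 * p.f0 * p.a) • p.minorVM + (-(9 * p.b)) • p.minorSM

/-- The combination `2 f₀ a · TM - 9 b · VM` of two minors. -/
def zetaM : Row ℂ := (2 * p.f0 * p.a) • p.minorTM + (-(9 * p.b)) • p.minorVM

variable {p}

theorem mulC'_zetaM (he : p.e = -1) (ha : p.a = 1) :
    p.mulC' p.zetaM = (0 : ℂ) • p.zetaM := by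
  obtain ⟨f0, f1, f2, f3, a, b, e⟩ := p
  obtain rfl : e = -1 := he
  obtain rfl : a = 1 := ha
  simp only [mulC', zetaM, minorTM, minorVM, mul, mulT, mulY, mulC, cT, cY, cub, rowT, rowY,
    rowV, rowM, rowN, g0, g1, g2, Row.add_def, Row.smul_def, mul_zero, zero_mul, add_zero,
    zero_add, mul_one, one_pow]
  ext <;> dsimp only <;> ring

theorem mulC'_zetaN (he : p.e = -1) (ha : p.a = 1) :
    p.mulC' p.zetaN = (2700 ^ 3 * (2 * p.f0 - 3 / 2 * p.b * p.f3) : ℂ) • p.zetaS := by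
  obtain ⟨f0, f1, f2, f3, a, b, e⟩ := p
  obtain rfl : e = -1 := he
  obtain rfl : a = 1 := ha
  simp only [mulC', zetaN, zetaS, minorTN, minorVN, minorSM, minorVM, mul, mulT, mulY, mulC, cT,
    cY, cub, rowT, rowY, rowV, rowM, rowN, rowS, g0, g1, g2, Row.add_def, Row.smul_def, mul_zero,
    zero_mul, add_zero, zero_add, mul_one, one_pow]
  ext <;> dsimp only <;> ring

theorem mulC'_zetaS (he : p.e = -1) (ha : p.a = 1) :
    p.mulC' p.zetaS = (2700 ^ 3 * (2 / 45 * p.f0 ^ 2) : ℂ) • p.zetaN +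
      ((2700 ^ 3 * (1 / 5 * p.b * p.f1) : ℂ) • p.zetaS +
        (2700 ^ 3 * (-1 / 6 * p.b * p.f0) : ℂ) • p.zetaM) := by
  obtain ⟨f0, f1, f2, f3, a, b, e⟩ := p
  obtain rfl : e = -1 := he
  obtain rfl : a = 1 := ha
  simp only [mulC', zetaN, zetaS, zetaM, minorTN, minorVN, minorSM, minorVM, minorTM, mul, mulT,
    mulY, mulC, cT, cY, cub, rowT, rowY, rowV, rowM, rowN, rowS, g0, g1, g2, Row.add_def,
    Row.smul_def, mul_zero, zero_mul, add_zero, zero_add, mul_one, one_pow]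
  ext <;> dsimp only <;> ring

theorem mulC'_minorVN (he : p.e = -1) (ha : p.a = 1) :
    p.mulC' p.minorVN = (2700 ^ 3 * (2 / 45 * p.f0 ^ 2) : ℂ) • p.minorTS +
      (2700 ^ 3 * (1 / 6 * p.f3) : ℂ) • p.zetaS := by
  obtain ⟨f0, f1, f2, f3, a, b, e⟩ := p
  obtain rfl : e = -1 := he
  obtain rfl : a = 1 := ha
  simp only [mulC', zetaS, minorTS, minorVN, minorSM, minorVM, mul, mulT,
    mulY, mulC, cT, cY, cub, rowT, rowY, rowV, rowM, rowN, rowS, g0, g1, g2, Row.add_def,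
    Row.smul_def, mul_zero, zero_mul, add_zero, zero_add, mul_one, one_pow]
  ext <;> dsimp only <;> ring

theorem mulC'_minorSM (he : p.e = -1) (ha : p.a = 1) :
    p.mulC' p.minorSM = (2700 ^ 3 * (2 / 45 * p.f0 ^ 2) : ℂ) • p.minorVN +
      ((2700 ^ 3 * (-1 / 45 * p.f1) : ℂ) • p.zetaS +
        (2700 ^ 3 * (1 / 54 * p.f0) : ℂ) • p.zetaM) := by
  obtain ⟨f0, f1, f2, f3, a, b, e⟩ := p
  obtain rfl : e = -1 := he
  obtain rfl : a = 1 := ha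
  simp only [mulC', zetaS, zetaM, minorVN, minorSM, minorVM, minorTM, mul, mulT,
    mulY, mulC, cT, cY, cub, rowT, rowY, rowV, rowM, rowN, rowS, g0, g1, g2, Row.add_def,
    Row.smul_def, mul_zero, zero_mul, add_zero, zero_add, mul_one, one_pow]
  ext <;> dsimp only <;> ring

theorem top_zeta (he : p.e = -1) (ha : p.a = 1) :
    p.top p.zetaN p.zetaS p.zetaM = 486000 ^ 6 / 16200 * p.rho := by
  obtain ⟨f0, f1, f2, f3, a, b, e⟩ := p
  obtain rfl : e = -1 := he
  obtain rfl : a = 1 := ha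
  simp only [rho, top, det3, zetaN, zetaS, zetaM, minorTN, minorVN, minorSM, minorVM, minorTM, mul,
    mulT, mulY, mulC, cT, cY, cub, rowT, rowY, rowV, rowM, rowN, rowS, g0, g1, g2, Row.add_def,
    Row.smul_def, mul_zero, zero_mul, add_zero, zero_add, mul_one, one_pow]
  ring

end Params

namespace Row

/-- A column, given as a function, as a `Row`. -/
def ofFun (k : Fin 8 → ℂ) : Row ℂ := ⟨k 0, k 1, k 2, k 3, k 4, k 5, k 6, k 7⟩

theorem dotL_apply (v : Row ℂ) (k : Fin 8 → ℂ) : v.dotL k = v.dot (ofFun k) := rfl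

/-- The inverse of `Row.ofFun`. -/
def toFun (k : Row ℂ) : Fin 8 → ℂ := ![k.x0, k.x1, k.x2, k.x3, k.x4, k.x5, k.x6, k.x7]

theorem ofFun_toFun (k : Row ℂ) : ofFun k.toFun = k := rfl

end Row

namespace Params

variable {p : Params ℂ}

/-- The transpose of multiplication by `2700³ c`. -/
def act (p : Params ℂ) : Module.End ℂ (Fin 8 → ℂ) :=
  LinearMap.pi ![(2700 ^ 3 : ℂ) • LinearMap.proj 1, (2700 ^ 3 : ℂ) • LinearMap.proj 2,
    (2700 ^ 2 : ℂ) • p.cub.dotL, (2700 ^ 2 : ℂ) • p.cT.dotL, (2700 ^ 2 : ℂ) • p.cY.dotL,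
    (p.mulT p.cT).dotL, (p.mulT p.cY).dotL, (p.mulY p.cY).dotL]

theorem dotL_act (v : Row ℂ) (k : Fin 8 → ℂ) : v.dotL (p.act k) = (p.mulC' v).dotL k := by
  have h : Row.ofFun (p.act k) = ⟨2700 ^ 3 * k 1, 2700 ^ 3 * k 2, 2700 ^ 2 * p.cub.dotL k,
      2700 ^ 2 * p.cT.dotL k, 2700 ^ 2 * p.cY.dotL k, (p.mulT p.cT).dotL k,
      (p.mulT p.cY).dotL k, (p.mulY p.cY).dotL k⟩ := rfl
  rw [Row.dotL_apply, h]
  simp only [mulC', mulC, Row.dotL_add, Row.dotL_smul, LinearMap.add_apply, LinearMap.smul_apply,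
    smul_eq_mul]
  have h' : (⟨0, 2700 * v.x0, 2700 * v.x1, 0, 0, 0, 0, 0⟩ : Row ℂ).dotL k =
      2700 * v.x0 * k 1 + 2700 * v.x1 * k 2 := by
    simp [Row.dotL_apply, Row.ofFun, Row.dot]
  rw [h']
  simp only [Row.dot]
  ring

/-- The common kernel of `zetaN`, `zetaS`, `zetaM`. -/
def zetaKer (p : Params ℂ) : Submodule ℂ (Fin 8 → ℂ) :=
  LinearMap.ker p.zetaN.dotL ⊓ (LinearMap.ker p.zetaS.dotL ⊓ LinearMap.ker p.zetaM.dotL)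

theorem mem_zetaKer {k : Fin 8 → ℂ} : k ∈ p.zetaKer ↔
    p.zetaN.dotL k = 0 ∧ p.zetaS.dotL k = 0 ∧ p.zetaM.dotL k = 0 := Iff.rfl

theorem act_mem (he : p.e = -1) (ha : p.a = 1) : ∀ k ∈ p.zetaKer, p.act k ∈ p.zetaKer := by
  intro k hk
  obtain ⟨hN, hS, hM⟩ := mem_zetaKer.mp hk
  refine mem_zetaKer.mpr ⟨?_, ?_, ?_⟩ <;> rw [dotL_act]
  · rw [mulC'_zetaN he ha, Row.dotL_smul, LinearMap.smul_apply, hS, smul_zero]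
  · simp only [mulC'_zetaS he ha, Row.dotL_smul, Row.dotL_add, LinearMap.smul_apply,
      LinearMap.add_apply, hN, hS, hM, smul_zero, add_zero]
  · rw [mulC'_zetaM he ha, Row.dotL_smul, LinearMap.smul_apply, hM, smul_zero]

/-- A column in the common kernel is determined by its first five coordinates. -/
theorem eq_zero_of_mem_zetaKer (he : p.e = -1) (ha : p.a = 1) (hr : p.rho ≠ 0) {k : Fin 8 → ℂ}
    (hk : k ∈ p.zetaKer) (h0 : k 0 = 0) (h1 : k 1 = 0) (h2 : k 2 = 0) (h3 : k 3 = 0)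
    (h4 : k 4 = 0) : k = 0 := by
  have ht : p.top p.zetaN p.zetaS p.zetaM ≠ 0 := by
    rw [top_zeta he ha]
    exact mul_ne_zero (by norm_num) hr
  obtain ⟨hN, hS, hM⟩ := mem_zetaKer.mp hk
  rw [Row.dotL_apply] at hN hS hM
  generalize p.zetaN = r at ht hN
  generalize p.zetaS = s at ht hS
  generalize p.zetaM = u at ht hM
  simp only [top, det3, he] at ht
  simp only [Row.dot, Row.ofFun, h0, h1, h2, h3, h4, mul_zero, zero_add] at hN hS hM
  have h5 : k 5 = 0 := by
    refine (mul_eq_zero.mp ?_).resolve_left ht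
    linear_combination (s.x6 * u.x7 - s.x7 * u.x6) * hN - (r.x6 * u.x7 - r.x7 * u.x6) * hS +
      (r.x6 * s.x7 - r.x7 * s.x6) * hM
  have h6 : k 6 = 0 := by
    refine (mul_eq_zero.mp ?_).resolve_left ht
    linear_combination -(s.x5 * u.x7 - s.x7 * u.x5) * hN + (r.x5 * u.x7 - r.x7 * u.x5) * hS -
      (r.x5 * s.x7 - r.x7 * s.x5) * hM
  have h7 : k 7 = 0 := by
    refine (mul_eq_zero.mp ?_).resolve_left ht
    linear_combination (s.x5 * u.x6 - s.x6 * u.x5) * hN - (r.x5 * u.x6 - r.x6 * u.x5) * hS +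
      (r.x5 * s.x6 - r.x6 * s.x5) * hM
  funext i
  fin_cases i <;> assumption

theorem finrank_zetaKer_le (he : p.e = -1) (ha : p.a = 1) (hr : p.rho ≠ 0) :
    Module.finrank ℂ p.zetaKer ≤ 5 := by
  let l : p.zetaKer →ₗ[ℂ] (Fin 5 → ℂ) :=
    (LinearMap.funLeft ℂ ℂ (Fin.castLE (by norm_num : 5 ≤ 8))).comp p.zetaKer.subtype
  have hl : Function.Injective l := by
    rw [injective_iff_map_eq_zero]
    intro k hk
    exact Subtype.ext (eq_zero_of_mem_zetaKer he ha hr k.2 (congrFun hk 0) (congrFun hk 1)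
      (congrFun hk 2) (congrFun hk 3) (congrFun hk 4))
  simpa using LinearMap.finrank_le_finrank_of_injective hl

theorem IsKer.mem_zetaKer {k : Row ℂ} (h : p.IsKer k) : k.toFun ∈ p.zetaKer := by
  refine Params.mem_zetaKer.mpr ⟨?_, ?_, ?_⟩ <;>
    simp [zetaN, zetaS, zetaM, Row.dotL_apply, Row.ofFun_toFun, Row.dot_add, Row.smul_dot, h.tn,
      h.vn, h.vm, h.sm, h.tm]

theorem minorSM_act (he : p.e = -1) (ha : p.a = 1) {k : Fin 8 → ℂ} (hk : k ∈ p.zetaKer) :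
    p.minorSM.dotL (p.act k) = 2700 ^ 3 * (2 / 45 * p.f0 ^ 2) * p.minorVN.dotL k := by
  obtain ⟨-, hS, hM⟩ := Params.mem_zetaKer.mp hk
  simp only [dotL_act, mulC'_minorSM he ha, Row.dotL_add, Row.dotL_smul, LinearMap.add_apply,
    LinearMap.smul_apply, hS, hM, smul_eq_mul, mul_zero, add_zero]

theorem minorVN_act (he : p.e = -1) (ha : p.a = 1) {k : Fin 8 → ℂ} (hk : k ∈ p.zetaKer) :
    p.minorVN.dotL (p.act k) = 2700 ^ 3 * (2 / 45 * p.f0 ^ 2) * p.minorTS.dotL k := by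
  obtain ⟨-, hS, -⟩ := Params.mem_zetaKer.mp hk
  simp only [dotL_act, mulC'_minorVN he ha, Row.dotL_add, Row.dotL_smul, LinearMap.add_apply,
    LinearMap.smul_apply, hS, smul_eq_mul, mul_zero, add_zero]

theorem IsKer.minorSM_iterate (he : p.e = -1) (ha : p.a = 1) {k : Row ℂ} (h : p.IsKer k) (i : ℕ)
    (hi : i < 5) : p.minorSM.dotL ((p.act ^ i) k.toFun) = 0 := by
  have hm (i : ℕ) : (p.act ^ i) k.toFun ∈ p.zetaKer := by
    induction i with
    | zero => exact h.mem_zetaKer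
    | succ i ih => rw [pow_succ', Module.End.mul_apply]; exact act_mem he ha _ ih
  have hsm (i : ℕ) : p.minorSM.dotL ((p.act ^ (i + 1)) k.toFun) =
      2700 ^ 3 * (2 / 45 * p.f0 ^ 2) * p.minorVN.dotL ((p.act ^ i) k.toFun) := by
    rw [pow_succ', Module.End.mul_apply, minorSM_act he ha (hm i)]
  have hvn (i : ℕ) : p.minorVN.dotL ((p.act ^ (i + 1)) k.toFun) =
      2700 ^ 3 * (2 / 45 * p.f0 ^ 2) * p.minorTS.dotL ((p.act ^ i) k.toFun) := by
    rw [pow_succ', Module.End.mul_apply, minorVN_act he ha (hm i)]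
  have hd (v : Row ℂ) : v.dotL k.toFun = v.dot k := rfl
  have h1 : (p.act ^ 2) k.toFun = p.act (p.act k.toFun) := rfl
  interval_cases i
  · exact h.sm
  · rw [hsm 0, pow_zero, Module.End.one_apply, hd, h.vn, mul_zero]
  · rw [hsm 1, hvn 0, pow_zero, Module.End.one_apply, hd, h.ts, mul_zero, mul_zero]
  · rw [hsm 2, hvn 1, pow_one, dotL_act, hd, h.cts, mul_zero, mul_zero]
  · rw [hsm 3, hvn 2, h1, dotL_act, dotL_act, hd, h.ccts, mul_zero, mul_zero]

/-- An eigenvector of `act` in the common kernel has nonzero leading coordinate. -/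
theorem eigenvector_ne_zero (he : p.e = -1) (ha : p.a = 1) (hr : p.rho ≠ 0) (hf : p.f0 ≠ 0)
    {k : Fin 8 → ℂ} (hk : k ∈ p.zetaKer) {c : ℂ} (hc : p.act k = (2700 ^ 3 * c) • k)
    (h0 : k 0 = 0) : k = 0 := by
  have h1 : k 1 = 0 := by
    have := congrFun hc 0
    simpa [act, h0] using this
  have h2 : k 2 = 0 := by
    have := congrFun hc 1
    simpa [act, h1] using this
  have hcub : p.cub.dotL k = 2700 * c * k 2 := by
    have := congrFun hc 2
    have : 2700 ^ 2 * p.cub.dotL k = 2700 ^ 3 * c * k 2 := this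
    linear_combination this / 2700 ^ 2
  have hcT : p.cT.dotL k = 2700 * c * k 3 := by
    have := congrFun hc 3
    have : 2700 ^ 2 * p.cT.dotL k = 2700 ^ 3 * c * k 3 := this
    linear_combination this / 2700 ^ 2
  have hcY : p.cY.dotL k = 2700 * c * k 4 := by
    have := congrFun hc 4
    have : 2700 ^ 2 * p.cY.dotL k = 2700 ^ 3 * c * k 4 := this
    linear_combination this / 2700 ^ 2
  simp only [Row.dotL_apply, Row.dot, Row.ofFun, h0, h1, h2, cub, cT, cY, he, ha] at hcub hcT hcY
  have hrho := hr
  simp only [rho, he] at hrho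
  have h3 : k 3 ^ 2 = 0 := by
    refine (mul_eq_zero.mp ?_).resolve_left (mul_ne_zero hf hrho)
    set β := -1 * (20 * p.f0 ^ 2 * p.f3 * 1) + (45 * p.f0 * p.f2 + -1 * (12 * p.f1 ^ 2)) * p.b
      with hβ
    set γ := p.f0 * (120 * p.f1 * 1 + -1 * (450 * p.b)) with hγ
    linear_combination (-1 / 27000 : ℂ) * (γ ^ 2 * (k 3 * hcY - k 4 * hcT) -
      (5400 * p.f0 * (γ * k 4 - β * k 3) - 540 * p.f1 * p.b * γ * k 3) * hcub)
  have h4 : k 4 ^ 2 = 0 := by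
    refine (mul_eq_zero.mp ?_).resolve_left (mul_ne_zero hf hrho)
    set β := -1 * (20 * p.f0 ^ 2 * p.f3 * 1) + (45 * p.f0 * p.f2 + -1 * (12 * p.f1 ^ 2)) * p.b
      with hβ
    set γ := p.f0 * (120 * p.f1 * 1 + -1 * (450 * p.b)) with hγ
    linear_combination (-1 / 27000 : ℂ) * (β ^ 2 * (k 3 * hcY - k 4 * hcT) -
      (p.f0 * (90 * p.f3 * p.b + -1 * (120 * p.f0)) * (β * k 3 - γ * k 4) -
        540 * p.f1 * p.b * β * k 4) * hcub)
  exact eq_zero_of_mem_zetaKer he ha hr hk h0 h1 h2 (pow_eq_zero_iff two_ne_zero |>.mp h3)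
    (pow_eq_zero_iff two_ne_zero |>.mp h4)

/-- The products of `A, B, C` prescribed by a solution of the relations determine `A, B, C`. -/
theorem Relations.exists_sol {c t y : ℂ} (h : p.Relations c t y) (he : p.e = -1) (ha : p.a = 1)
    (hf : p.f0 ≠ 0) (hr : p.rho ≠ 0) {k : Fin 8 → ℂ} (hk : k ∈ p.zetaKer)
    (hsm : p.minorSM.dotL k = 0) (h0 : k 0 = 1) (h1 : k 1 = c) (h2 : k 2 = c ^ 2) (h3 : k 3 = t)
    (h4 : k 4 = y) : ∃ A B C, p.Sol c A B C := by
  obtain ⟨V, hV⟩ : ∃ V, p.rowV.dot (Row.monomials c t y) = 180 * V := ⟨_ / 180, by ring⟩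
  obtain ⟨S, hS⟩ : ∃ S, p.rowS.dot (Row.monomials c t y) = 180 * S := ⟨_ / 180, by ring⟩
  obtain ⟨N, hN⟩ : ∃ N, p.rowN.dot (Row.monomials c t y) = 180 * N := ⟨_ / 180, by ring⟩
  obtain ⟨M, hM⟩ : ∃ M, p.rowM.dot (Row.monomials c t y) = 180 * M := ⟨_ / 180, by ring⟩
  obtain ⟨-, mTN, mTM, mVN, mVM, mSM⟩ := h.minors he hV hS hN hM
  have o1 : 2 * p.f0 ^ 2 * t - 9 * p.f0 * p.b * V + 45 * (c * y) = 0 := by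
    have hcY := h.cY
    simp only [Row.dot, Row.monomials, Params.cY, rowV, g2, he, ha] at hcY hV
    linear_combination (p.f0 * p.b / 20) * hV - hcY / 60
  have o2 : 2 * p.f0 ^ 2 * V - 9 * p.f0 * p.b * S + 45 * (c * N) = 0 := by
    have hcub := h.cub
    have hcT := h.cT
    simp only [Row.dot, Row.monomials, Params.cub, Params.cT, rowV, rowS, rowN, g0, g1, g2, he, ha]
      at hcub hcT hV hS hN
    linear_combination (-p.f0 ^ 2 / 90) * hV + (p.f0 * p.b / 20) * hS - (c / 4) * hN -
      hcub / 60 - p.f1 / 2700 * hcT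
  have o3 : 2 * p.f0 ^ 2 * y - 9 * p.f0 * p.b * N + 45 * (c * M) = 0 := by
    have hcT := h.cT
    simp only [Row.dot, Row.monomials, Params.cT, rowN, rowM, g0, g1, g2, he, ha] at hcT hN hM
    linear_combination (p.f0 * p.b / 20) * hN - (c / 4) * hM - p.f0 / 2700 * hcT
  have hmon : (Row.monomials c t y).toFun ∈ p.zetaKer := by
    have hd (v : Row ℂ) : v.dotL (Row.monomials c t y).toFun = v.dot (Row.monomials c t y) := rfl
    refine mem_zetaKer.mpr ⟨?_, ?_, ?_⟩ <;> rw [hd]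
    · rw [zetaN, Row.dot_add, Row.smul_dot, Row.smul_dot, mTN, mVN, ha]
      refine (mul_eq_zero.mp ?_).resolve_left hf
      linear_combination 486000 ^ 2 * (N * o1 - y * o2)
    · rw [zetaS, Row.dot_add, Row.smul_dot, Row.smul_dot, mVM, mSM, ha]
      refine (mul_eq_zero.mp ?_).resolve_left hf
      linear_combination 486000 ^ 2 * (M * o2 - N * o3)
    · rw [zetaM, Row.dot_add, Row.smul_dot, Row.smul_dot, mTM, mVM, ha]
      refine (mul_eq_zero.mp ?_).resolve_left hf
      linear_combination 486000 ^ 2 * (M * o1 - y * o3)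
  have hkm : k = (Row.monomials c t y).toFun := by
    refine sub_eq_zero.mp (eq_zero_of_mem_zetaKer he ha hr (p.zetaKer.sub_mem hk hmon) ?_ ?_ ?_ ?_
      ?_)
    · exact sub_eq_zero.mpr h0
    · exact sub_eq_zero.mpr h1
    · exact sub_eq_zero.mpr h2
    · exact sub_eq_zero.mpr h3
    · exact sub_eq_zero.mpr h4
  have hSM : S * M = N ^ 2 := by
    rw [hkm] at hsm
    have : p.minorSM.dot (Row.monomials c t y) = 0 := hsm
    rw [mSM] at this
    linear_combination this / 486000 ^ 2
  obtain ⟨B, C, hB, hBC, hC⟩ : ∃ B C : ℂ, B ^ 2 = S ∧ B * C = N ∧ C ^ 2 = M := by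
    by_cases hM0 : M = 0
    · obtain ⟨B, hB⟩ := IsAlgClosed.exists_pow_nat_eq S two_pos
      have hN0 : N = 0 := by
        rw [hM0, mul_zero] at hSM
        exact (pow_eq_zero_iff two_ne_zero).mp hSM.symm
      exact ⟨B, 0, hB, by rw [hN0, mul_zero], by rw [hM0]; norm_num⟩
    · obtain ⟨C, hC⟩ := IsAlgClosed.exists_pow_nat_eq M two_pos
      have hC0 : C ≠ 0 := fun h => hM0 (by rw [← hC, h]; norm_num)
      refine ⟨N / C, C, ?_, by field_simp, hC⟩
      field_simp
      rw [hC, ← hSM, mul_comm]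
  obtain ⟨A, hA⟩ : ∃ A : ℂ, 2 * p.f0 ^ 2 * A - 9 * p.f0 * p.b * B + 45 * c * C = 0 :=
    ⟨(9 * p.f0 * p.b * B - 45 * c * C) / (2 * p.f0 ^ 2), by field_simp; ring⟩
  have hf2 : 2 * p.f0 ^ 2 ≠ 0 := mul_ne_zero two_ne_zero (pow_ne_zero 2 hf)
  have hAC : A * C = y := by
    refine mul_left_cancel₀ hf2 ?_
    linear_combination C * hA - o3 + 9 * p.f0 * p.b * hBC - 45 * c * hC
  have hAB : A * B = V := by
    refine mul_left_cancel₀ hf2 ?_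
    linear_combination B * hA - o2 + 9 * p.f0 * p.b * hB - 45 * c * hBC
  have hAA : A ^ 2 = t := by
    refine mul_left_cancel₀ hf2 ?_
    linear_combination A * hA - o1 + 9 * p.f0 * p.b * hAB - 45 * c * hAC
  refine ⟨A, B, C, ⟨?_, ?_, ?_, ?_, ?_⟩⟩
  · rw [hAA, hAC, hV, hAB]
  · rw [hAA, hAC, hS, hB]
  · rw [hAA, hAC, hN, hBC]
  · rw [hAA, hAC, hM, hC]
  · rw [ha]; linear_combination hA

/-- A zero of the eliminant at which the obstruction does not vanish gives a solution of the
incidence equations. -/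
theorem exists_sol (he : p.e = -1) (ha : p.a = 1) (hf : p.f0 ≠ 0) (hr : p.rho ≠ 0)
    (htop : p.top p.minorTS p.minorTN p.minorTM ≠ 0) (hdet : p.kdet = 0) :
    ∃ c A B C, p.Sol c A B C := by
  obtain ⟨k, hk0, hk⟩ := exists_isKer he htop hdet
  have hk0' : (⟨k.toFun, hk.mem_zetaKer⟩ : p.zetaKer) ≠ 0 := by
    intro h
    refine hk0 ?_
    have h' : k.toFun = 0 := congrArg Subtype.val h
    funext i
    fin_cases i
    · exact congrFun h' 0
    · exact congrFun h' 1
    · exact congrFun h' 2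
    · exact congrFun h' 3
    · exact congrFun h' 4
  have hit (i : ℕ) (x : p.zetaKer) :
      (((p.act.restrict (act_mem he ha)) ^ i) x : Fin 8 → ℂ) = (p.act ^ i) (x : Fin 8 → ℂ) := by
    induction i with
    | zero => rfl
    | succ i ih =>
      rw [pow_succ', pow_succ', Module.End.mul_apply, Module.End.mul_apply,
        LinearMap.coe_restrict_apply, ih]
  obtain ⟨x, hx0, hxr, μ, hμ⟩ := exists_eigenvector_of_iterates (p.act.restrict (act_mem he ha))
    (p.minorSM.dotL.comp p.zetaKer.subtype) (finrank_zetaKer_le he ha hr) hk0' (by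
      intro i hi
      rw [LinearMap.comp_apply, Submodule.subtype_apply, hit]
      exact hk.minorSM_iterate he ha i hi)
  have hx : p.act (x : Fin 8 → ℂ) = (2700 ^ 3 * (μ / 2700 ^ 3)) • (x : Fin 8 → ℂ) := by
    rw [mul_div_cancel₀ _ (by norm_num)]
    exact congrArg Subtype.val hμ
  have hz : (x : Fin 8 → ℂ) 0 ≠ 0 := fun h0 =>
    hx0 (Subtype.ext (eigenvector_ne_zero he ha hr hf x.2 hx h0))
  set c := μ / 2700 ^ 3 with hc
  obtain ⟨l, hl, hlr, hl0, hlc⟩ : ∃ l ∈ p.zetaKer, p.minorSM.dotL l = 0 ∧ l 0 = 1 ∧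
      p.act l = (2700 ^ 3 * c) • l := by
    refine ⟨((x : Fin 8 → ℂ) 0)⁻¹ • (x : Fin 8 → ℂ), p.zetaKer.smul_mem _ x.2, ?_, ?_, ?_⟩
    · rw [map_smul]
      simp only [LinearMap.comp_apply, Submodule.subtype_apply] at hxr
      rw [hxr, smul_zero]
    · simp [hz]
    · rw [map_smul, hx, smul_comm]
  have c0 := congrFun hlc 0
  have c1 := congrFun hlc 1
  have h1 : l 1 = c := by
    have : 2700 ^ 3 * l 1 = 2700 ^ 3 * c * l 0 := c0
    rw [hl0] at this
    linear_combination this / 2700 ^ 3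
  have h2 : l 2 = c ^ 2 := by
    have : 2700 ^ 3 * l 2 = 2700 ^ 3 * c * l 1 := c1
    rw [h1] at this
    linear_combination this / 2700 ^ 3
  have hcub : 2700 ^ 2 * p.cub.dotL l = 2700 ^ 3 * c * l 2 := congrFun hlc 2
  have hcT : 2700 ^ 2 * p.cT.dotL l = 2700 ^ 3 * c * l 3 := congrFun hlc 3
  have hcY : 2700 ^ 2 * p.cY.dotL l = 2700 ^ 3 * c * l 4 := congrFun hlc 4
  have hrel : p.Relations c (l 3) (l 4) := by
    simp only [Row.dotL_apply, Row.dot, Row.ofFun, hl0, h1, h2, cub, cT, cY] at hcub hcT hcY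
    refine ⟨?_, ?_, ?_⟩ <;> simp only [Row.dot, Row.monomials, cub, cT, cY]
    · linear_combination hcub / 2700 ^ 2
    · linear_combination hcT / 2700 ^ 2
    · linear_combination hcY / 2700 ^ 2
  exact ⟨c, hrel.exists_sol he ha hf hr hl hlr hl0 h1 h2 rfl rfl⟩

end Params

/-- The determinant of a matrix of polynomials whose value at `b` has a kernel of dimension at
least two vanishes to order two at `b`. -/
theorem sq_dvd_det {n : ℕ} (M : Matrix (Fin (n + 1)) (Fin (n + 1)) (Polynomial ℂ)) (b : ℂ)
    {k d : Fin (n + 1) → ℂ} (hk : (M.map (Polynomial.eval b)).mulVec k = 0)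
    (hd : (M.map (Polynomial.eval b)).mulVec d = 0) (hk0 : k 0 = 1) (hd0 : d 0 = 0)
    {j : Fin (n + 1)} (hj : d j ≠ 0) : (Polynomial.X - Polynomial.C b) ^ 2 ∣ M.det := by
  have hcr (N : Matrix (Fin (n + 1)) (Fin (n + 1)) (Polynomial ℂ)) (x : Fin (n + 1) → ℂ)
      (w : Fin (n + 1) → Polynomial ℂ) (i : Fin (n + 1))
      (hw : N.mulVec (fun i => Polynomial.C (x i)) = (Polynomial.X - Polynomial.C b) • w) :
      N.det * Polynomial.C (x i) = (Polynomial.X - Polynomial.C b) * (N.updateCol i w).det := by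
    have h1 : N.cramer (N.mulVec fun i => Polynomial.C (x i)) i =
        N.det * Polynomial.C (x i) := by
      rw [Matrix.cramer_eq_adjugate_mulVec, Matrix.mulVec_mulVec, Matrix.adjugate_mul,
        Matrix.smul_mulVec, Matrix.one_mulVec]
      rfl
    rw [← h1, hw, map_smul, Pi.smul_apply, Matrix.cramer_apply, smul_eq_mul]
  have hdiv (x : Fin (n + 1) → ℂ) (hx : (M.map (Polynomial.eval b)).mulVec x = 0) :
      ∃ w, M.mulVec (fun i => Polynomial.C (x i)) = (Polynomial.X - Polynomial.C b) • w := by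
    have h (i : Fin (n + 1)) : (Polynomial.X - Polynomial.C b) ∣
        M.mulVec (fun i => Polynomial.C (x i)) i := by
      rw [Polynomial.dvd_iff_isRoot, Polynomial.IsRoot, Matrix.mulVec, dotProduct,
        Polynomial.eval_finsetSum]
      simpa [Matrix.mulVec, dotProduct] using congrFun hx i
    choose w hw using h
    exact ⟨w, funext hw⟩
  obtain ⟨u, hu⟩ := hdiv k hk
  obtain ⟨v, hv⟩ := hdiv d hd
  have h1 := hcr M k u 0 hu
  have hM' : (M.updateCol 0 u).mulVec (fun i => Polynomial.C (d i)) =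
      (Polynomial.X - Polynomial.C b) • v := by
    rw [← hv]
    funext i
    simp only [Matrix.mulVec, dotProduct]
    refine Finset.sum_congr rfl fun l _ => ?_
    by_cases hl : l = 0
    · simp [hl, hd0]
    · rw [Matrix.updateCol_ne hl]
  have h2 := hcr _ d v j hM'
  rw [hk0, Polynomial.C_1, mul_one] at h1
  have hunit : IsUnit (Polynomial.C (d j)) := Polynomial.isUnit_C.mpr (isUnit_iff_ne_zero.mpr hj)
  rw [← hunit.dvd_mul_right, h1, mul_assoc, h2]
  exact ⟨((M.updateCol 0 u).updateCol j v).det, by ring⟩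

namespace Params

theorem map_kMat {R S : Type*} [CommRing R] [CommRing S] (φ : R →+* S) (p : Params R) :
    p.kMat.map φ = (p.map φ).kMat := by
  have h (v : Row R) (j : Fin 5) : φ (v.low j) = (v.map φ).low j := by
    fin_cases j <;> rfl
  ext i j
  rw [Matrix.map_apply]
  fin_cases i <;>
    simp only [kMat, Matrix.of_apply, Fin.mk_one, Fin.zero_eta, Fin.reduceFinMk, Matrix.cons_val,
      h, map_red, map_minorVN, map_minorVM, map_minorSM, map_mulC', map_minorTS]

/-- Two solutions at a simple zero of the eliminant agree up to sign. -/
theorem Sol.eq_or_eq_neg {P : Params (Polynomial ℂ)} {b : ℂ} {p : Params ℂ}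
    (hP : P.map (Polynomial.evalRingHom b) = p) (hPe : P.e = -1)
    (hs : ¬ (Polynomial.X - Polynomial.C b) ^ 2 ∣ P.kdet) (h0 : p.f0 ≠ 0)
    {c A B C c' A' B' C' : ℂ} (h : p.Sol c A B C) (h' : p.Sol c' A' B' C') :
    c = c' ∧ (A = A' ∧ B = B' ∧ C = C' ∨ A = -A' ∧ B = -B' ∧ C = -C') := by
  have he : p.e = -1 := by
    rw [← hP]
    change Polynomial.evalRingHom b P.e = -1
    rw [hPe, map_neg, map_one]
  have hM : P.kMat.map (Polynomial.eval b) = p.kMat := by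
    rw [← hP, ← map_kMat]
    rfl
  have k1 := (h.isKer he h0).kMat_mulVec he
  have k2 := (h'.isKer he h0).kMat_mulVec he
  have hl : (Row.monomials c (A ^ 2) (A * C)).low = (Row.monomials c' (A' ^ 2) (A' * C')).low := by
    by_contra hne
    obtain ⟨j, hj⟩ := Function.ne_iff.mp hne
    refine hs ?_
    rw [← det_kMat hPe]
    refine sq_dvd_det P.kMat b (k := (Row.monomials c (A ^ 2) (A * C)).low)
      (d := (Row.monomials c (A ^ 2) (A * C)).low - (Row.monomials c' (A' ^ 2) (A' * C')).low)
      ?_ ?_ rfl (sub_self 1) (sub_ne_zero.mpr hj)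
    · rw [hM, k1]
    · rw [hM, Matrix.mulVec_sub, k1, k2, sub_zero]
  have hc : c = c' := congrFun hl 1
  have hT : A ^ 2 = A' ^ 2 := congrFun hl 3
  have hY : A * C = A' * C' := congrFun hl 4
  have rV := h.rowV
  have rS := h.rowS
  have rN := h.rowN
  have rM := h.rowM
  rw [hc, hT, hY] at rV rS rN rM
  have hV : A * B = A' * B' := by linear_combination (h'.rowV - rV) / 180
  have hS : B ^ 2 = B' ^ 2 := by linear_combination (h'.rowS - rS) / 180
  have hN : B * C = B' * C' := by linear_combination (h'.rowN - rN) / 180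
  have hM : C ^ 2 = C' ^ 2 := by linear_combination (h'.rowM - rM) / 180
  refine ⟨hc, ?_⟩
  by_cases hA : A' = 0
  · have hA0 : A = 0 := by simpa [hA] using hT
    by_cases hB : B' = 0
    · have hB0 : B = 0 := by simpa [hB] using hS
      rcases sq_eq_sq_iff_eq_or_eq_neg.mp hM with h | h
      · exact Or.inl ⟨hA0.trans hA.symm, hB0.trans hB.symm, h⟩
      · exact Or.inr ⟨by rw [hA0, hA, neg_zero], by rw [hB0, hB, neg_zero], h⟩
    · rcases sq_eq_sq_iff_eq_or_eq_neg.mp hS with h | h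
      · exact Or.inl ⟨hA0.trans hA.symm, h, mul_left_cancel₀ hB (by rw [← hN, h])⟩
      · refine Or.inr ⟨by rw [hA0, hA, neg_zero], h, mul_left_cancel₀ hB ?_⟩
        linear_combination -hN + C * h
  · rcases sq_eq_sq_iff_eq_or_eq_neg.mp hT with h | h
    · exact Or.inl ⟨h, mul_left_cancel₀ hA (by rw [← hV, h]), mul_left_cancel₀ hA (by rw [← hY, h])⟩
    · refine Or.inr ⟨h, mul_left_cancel₀ hA ?_, mul_left_cancel₀ hA ?_⟩
      · linear_combination -hV + B * h
      · linear_combination -hY + C * h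

end Params

section Degree

open Polynomial

variable {R : Type*} [CommRing R]

/-- The degree of `q` is at most the integer `d`, where only `0` has negative degree. -/
def DegLE (d : ℤ) (q : R[X]) : Prop := ∀ n : ℕ, d < n → q.coeff n = 0

namespace DegLE

variable {d i j : ℤ} {q r : R[X]}

theorem zero : DegLE d (0 : R[X]) := fun _ _ => coeff_zero _

theorem mono (h : DegLE i q) (hd : i ≤ d) : DegLE d q := fun n hn => h n (hd.trans_lt hn)

theorem add (h : DegLE d q) (h' : DegLE d r) : DegLE d (q + r) := fun n hn => by
  rw [coeff_add, h n hn, h' n hn, add_zero]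

theorem mul (h : DegLE i q) (h' : DegLE j r) (hd : i + j ≤ d) : DegLE d (q * r) := fun n hn => by
  rw [coeff_mul]
  refine Finset.sum_eq_zero fun x hx => ?_
  have hx := Finset.HasAntidiagonal.mem_antidiagonal.mp hx
  by_cases h1 : i < x.1
  · rw [h _ h1, zero_mul]
  · rw [h' _ (by omega), mul_zero]

theorem of_natDegree_le {n : ℕ} (h : q.natDegree ≤ n) : DegLE n q := fun m hm =>
  coeff_eq_zero_of_natDegree_lt (by omega)

theorem natDegree_le {n : ℕ} (h : DegLE n q) : q.natDegree ≤ n :=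
  natDegree_le_iff_coeff_eq_zero.mpr fun m hm => h m (by exact_mod_cast hm)

theorem neg_one : DegLE 0 (-1 : R[X]) := of_natDegree_le (n := 0) (by compute_degree)

end DegLE

/-- The coordinates of `v` have degree at most `d` when the basis `1, c, c², τ, Y, τ², τY, Y²` is
given the weights `0, 1, 2, 2, 2, 4, 4, 4`. -/
structure Row.DegLE (d : ℤ) (v : Row R[X]) : Prop where
  x0 : Wronski.DegLE d v.x0
  x1 : Wronski.DegLE (d - 1) v.x1
  x2 : Wronski.DegLE (d - 2) v.x2
  x3 : Wronski.DegLE (d - 2) v.x3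
  x4 : Wronski.DegLE (d - 2) v.x4
  x5 : Wronski.DegLE (d - 4) v.x5
  x6 : Wronski.DegLE (d - 4) v.x6
  x7 : Wronski.DegLE (d - 4) v.x7

namespace Row.DegLE

variable {d i j : ℤ} {u v : Row R[X]}

theorem add (hu : u.DegLE d) (hv : v.DegLE d) : (u + v).DegLE d :=
  ⟨hu.x0.add hv.x0, hu.x1.add hv.x1, hu.x2.add hv.x2, hu.x3.add hv.x3, hu.x4.add hv.x4,
    hu.x5.add hv.x5, hu.x6.add hv.x6, hu.x7.add hv.x7⟩

theorem smul {q : R[X]} (hq : Wronski.DegLE i q) (hv : v.DegLE j) (h : i + j ≤ d) :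
    (q • v).DegLE d :=
  ⟨hq.mul hv.x0 h, hq.mul hv.x1 (by omega), hq.mul hv.x2 (by omega), hq.mul hv.x3 (by omega),
    hq.mul hv.x4 (by omega), hq.mul hv.x5 (by omega), hq.mul hv.x6 (by omega),
    hq.mul hv.x7 (by omega)⟩

end Row.DegLE

namespace Params

/-- The parameters with `a = 1` and `b` an indeterminate. -/
noncomputable def generic (f0 f1 f2 f3 : R) : Params R[X] :=
  ⟨C f0, C f1, C f2, C f3, 1, X, -1⟩

variable {p : Params R[X]} {d i j : ℤ} {u v w : Row R[X]}

theorem degLE_det3 {e a b c a' b' c' a'' b'' c'' : R[X]} {k : ℤ} (he : DegLE 0 e)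
    (ha : DegLE i a) (hb : DegLE i b) (hc : DegLE i c) (ha' : DegLE j a') (hb' : DegLE j b')
    (hc' : DegLE j c') (ha'' : DegLE k a'') (hb'' : DegLE k b'') (hc'' : DegLE k c'')
    (h : i + (j + k) ≤ d) : DegLE d (det3 e a b c a' b' c' a'' b'' c'') := by
  have key {x y z w : R[X]} (hx : DegLE j x) (hy : DegLE k y) (hz : DegLE j z) (hw : DegLE k w) :
      DegLE (j + k) (x * y + e * (z * w)) :=
    (hx.mul hy le_rfl).add (he.mul (hz.mul hw le_rfl) (by omega))
  exact ((ha.mul (key hb' hc'' hc' hb'') h).add (hb.mul (key hc' ha'' ha' hc'') h)).add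
    (hc.mul (key ha' hb'' hb' ha'') h)

/-- The degree bounds satisfied by the products `c³`, `cτ`, `cY`. -/
structure DegBound (p : Params R[X]) : Prop where
  e : DegLE 0 p.e
  cub : p.cub.DegLE 3
  cT : p.cT.DegLE 3
  cY : p.cY.DegLE 3

theorem DegBound.mulC (hp : p.DegBound) (hv : v.DegLE d) : (p.mulC v).DegLE (d + 1) := by
  have h2 : DegLE 0 (2700 : R[X]) := DegLE.of_natDegree_le (n := 0) (by compute_degree)
  refine Row.DegLE.add ?_ (Row.DegLE.add (Row.DegLE.smul hv.x2 hp.cub (by omega))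
    (Row.DegLE.add (Row.DegLE.smul hv.x3 hp.cT (by omega))
      (Row.DegLE.smul hv.x4 hp.cY (by omega))))
  exact ⟨.zero, h2.mul hv.x0 (by omega), h2.mul hv.x1 (by omega), .zero, .zero, .zero, .zero,
    .zero⟩

theorem DegBound.mulT (hp : p.DegBound) (hv : v.DegLE d) : (p.mulT v).DegLE (d + 2) := by
  have h2 : DegLE 0 (2700 : R[X]) := DegLE.of_natDegree_le (n := 0) (by compute_degree)
  have h4 : DegLE 0 (2700 ^ 2 : R[X]) := DegLE.of_natDegree_le (n := 0) (by compute_degree)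
  refine Row.DegLE.add ?_ (Row.DegLE.add
    (Row.DegLE.smul (h2.mul hv.x1 (zero_add _).le) hp.cT (by omega))
    (Row.DegLE.smul hv.x2 (hp.mulC hp.cT) (by omega)))
  exact ⟨.zero, .zero, .zero, h4.mul hv.x0 (by omega), .zero, h4.mul hv.x3 (by omega),
    h4.mul hv.x4 (by omega), .zero⟩

theorem DegBound.mulY (hp : p.DegBound) (hv : v.DegLE d) : (p.mulY v).DegLE (d + 2) := by
  have h2 : DegLE 0 (2700 : R[X]) := DegLE.of_natDegree_le (n := 0) (by compute_degree)
  have h4 : DegLE 0 (2700 ^ 2 : R[X]) := DegLE.of_natDegree_le (n := 0) (by compute_degree)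
  refine Row.DegLE.add ?_ (Row.DegLE.add
    (Row.DegLE.smul (h2.mul hv.x1 (zero_add _).le) hp.cY (by omega))
    (Row.DegLE.smul hv.x2 (hp.mulC hp.cY) (by omega)))
  exact ⟨.zero, .zero, .zero, .zero, h4.mul hv.x0 (by omega), .zero, h4.mul hv.x3 (by omega),
    h4.mul hv.x4 (by omega)⟩

theorem DegBound.mul (hp : p.DegBound) (hu : u.DegLE i) (hv : v.DegLE j) :
    (p.mul u v).DegLE (i + j) := by
  have h2 : DegLE 0 (2700 : R[X]) := DegLE.of_natDegree_le (n := 0) (by compute_degree)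
  have h4 : DegLE 0 (2700 ^ 2 : R[X]) := DegLE.of_natDegree_le (n := 0) (by compute_degree)
  exact (Row.DegLE.smul (h4.mul hu.x0 (zero_add _).le) hv le_rfl).add
    ((Row.DegLE.smul (h2.mul hu.x1 (zero_add _).le) (hp.mulC hv) (by omega)).add
      ((Row.DegLE.smul hu.x2 (hp.mulC (hp.mulC hv)) (by omega)).add
        ((Row.DegLE.smul hu.x3 (hp.mulT hv) (by omega)).add
          (Row.DegLE.smul hu.x4 (hp.mulY hv) (by omega)))))

theorem DegBound.mulC' (hp : p.DegBound) (hv : v.DegLE d) : (p.mulC' v).DegLE (d + 1) := by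
  have h4 : DegLE 0 (2700 ^ 2 : R[X]) := DegLE.of_natDegree_le (n := 0) (by compute_degree)
  exact (Row.DegLE.smul h4 (hp.mulC hv) (zero_add _).le).add
    ((Row.DegLE.smul hv.x5 (hp.mulT hp.cT) (by omega)).add
      ((Row.DegLE.smul hv.x6 (hp.mulT hp.cY) (by omega)).add
        (Row.DegLE.smul hv.x7 (hp.mulY hp.cY) (by omega))))

theorem DegBound.top (hp : p.DegBound) (hu : u.DegLE d) (hv : v.DegLE i) (hw : w.DegLE j) :
    DegLE (d + i + j - 12) (p.top u v w) :=
  degLE_det3 hp.e hu.x5 hu.x6 hu.x7 hv.x5 hv.x6 hv.x7 hw.x5 hw.x6 hw.x7 (by omega)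

theorem DegBound.minor (hp : p.DegBound) {r s : Row R[X]} (hu : u.DegLE 2) (hv : v.DegLE 2)
    (hr : r.DegLE 2) (hs : s.DegLE 2) : (p.mul u v + p.e • p.mul r s).DegLE 4 :=
  (hp.mul hu hv).add (Row.DegLE.smul hp.e (hp.mul hr hs) (by omega))

theorem DegBound.det5 (hp : p.DegBound) {r s t : Row R[X]} (hu : u.DegLE 4) (hv : v.DegLE 4)
    (hr : r.DegLE 4) (hs : s.DegLE 5) (ht : t.DegLE 6) : DegLE 16 (p.det5 u v r s t) := by
  have key {α β i j : ℤ} {x y z w : R[X]} (hx : DegLE (α - i) x) (hy : DegLE (β - j) y)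
      (hz : DegLE (α - j) z) (hw : DegLE (β - i) w) :
      DegLE (α + β - i - j) (x * y + p.e * (z * w)) :=
    (hx.mul hy (by omega)).add (hp.e.mul (hz.mul hw le_rfl) (by omega))
  have d3 {i j k : ℤ} {a b c a' b' c' a'' b'' c'' : R[X]}
      (ha : DegLE (4 - i) a) (hb : DegLE (4 - j) b) (hc : DegLE (4 - k) c)
      (ha' : DegLE (5 - i) a') (hb' : DegLE (5 - j) b') (hc' : DegLE (5 - k) c')
      (ha'' : DegLE (6 - i) a'') (hb'' : DegLE (6 - j) b'') (hc'' : DegLE (6 - k) c'') :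
      DegLE (15 - i - j - k) (det3 p.e a b c a' b' c' a'' b'' c'') :=
    ((ha.mul (key hb' hc'' hc' hb'') (by omega)).add
      (hb.mul (key hc' ha'' ha' hc'') (by omega))).add
      (hc.mul (key ha' hb'' hb' ha'') (by omega))
  have hu0 : DegLE (4 - 0) u.x0 := hu.x0
  have hv0 : DegLE (4 - 0) v.x0 := hv.x0
  have hr0 : DegLE (4 - 0) r.x0 := hr.x0
  have hs0 : DegLE (5 - 0) s.x0 := hs.x0
  have ht0 : DegLE (6 - 0) t.x0 := ht.x0
  refine ((((((((DegLE.add ?_ ?_).add ?_).add ?_).add ?_).add ?_).add ?_).add ?_).add ?_).add ?_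
  · exact (key hu0 hv.x1 hu.x1 hv0).mul
      (d3 hr.x2 hr.x3 hr.x4 hs.x2 hs.x3 hs.x4 ht.x2 ht.x3 ht.x4) (by omega)
  · exact (hp.e.mul (key hu0 hv.x2 hu.x2 hv0) (zero_add _).le).mul
      (d3 hr.x1 hr.x3 hr.x4 hs.x1 hs.x3 hs.x4 ht.x1 ht.x3 ht.x4) (by omega)
  · exact (key hu0 hv.x3 hu.x3 hv0).mul
      (d3 hr.x1 hr.x2 hr.x4 hs.x1 hs.x2 hs.x4 ht.x1 ht.x2 ht.x4) (by omega)
  · exact (hp.e.mul (key hu0 hv.x4 hu.x4 hv0) (zero_add _).le).mul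
      (d3 hr.x1 hr.x2 hr.x3 hs.x1 hs.x2 hs.x3 ht.x1 ht.x2 ht.x3) (by omega)
  · exact (key hu.x1 hv.x2 hu.x2 hv.x1).mul
      (d3 hr0 hr.x3 hr.x4 hs0 hs.x3 hs.x4 ht0 ht.x3 ht.x4) (by omega)
  · exact (hp.e.mul (key hu.x1 hv.x3 hu.x3 hv.x1) (zero_add _).le).mul
      (d3 hr0 hr.x2 hr.x4 hs0 hs.x2 hs.x4 ht0 ht.x2 ht.x4) (by omega)
  · exact (key hu.x1 hv.x4 hu.x4 hv.x1).mul
      (d3 hr0 hr.x2 hr.x3 hs0 hs.x2 hs.x3 ht0 ht.x2 ht.x3) (by omega)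
  · exact (key hu.x2 hv.x3 hu.x3 hv.x2).mul
      (d3 hr0 hr.x1 hr.x4 hs0 hs.x1 hs.x4 ht0 ht.x1 ht.x4) (by omega)
  · exact (hp.e.mul (key hu.x2 hv.x4 hu.x4 hv.x2) (zero_add _).le).mul
      (d3 hr0 hr.x1 hr.x3 hs0 hs.x1 hs.x3 ht0 ht.x1 ht.x3) (by omega)
  · exact (key hu.x3 hv.x4 hu.x4 hv.x3).mul
      (d3 hr0 hr.x1 hr.x2 hs0 hs.x1 hs.x2 ht0 ht.x1 ht.x2) (by omega)

theorem DegBound.red (hp : p.DegBound) (hTS : p.minorTS.DegLE 4) (hTN : p.minorTN.DegLE 4)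
    (hTM : p.minorTM.DegLE 4) (hv : v.DegLE d) : (p.red v).DegLE d :=
  (Row.DegLE.smul (hp.top hTS hTN hTM) hv (by omega)).add
    (Row.DegLE.smul hp.e ((Row.DegLE.smul (hp.top hv hTN hTM) hTS (by omega)).add
      ((Row.DegLE.smul (hp.top hTS hv hTM) hTN (by omega)).add
        (Row.DegLE.smul (hp.top hTS hTN hv) hTM (by omega)))) (zero_add _).le)

theorem natDegree_kdet_generic (f0 f1 f2 f3 : R) :
    (generic f0 f1 f2 f3).kdet.natDegree ≤ 16 := by
  have h {n : ℕ} {q : R[X]} (hq : q.natDegree ≤ n) : DegLE n q := .of_natDegree_le hq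
  have hp : (generic f0 f1 f2 f3).DegBound := by
    refine ⟨.neg_one, ⟨?_, ?_, ?_, ?_, ?_, .zero, .zero, .zero⟩,
      ⟨?_, ?_, ?_, ?_, ?_, .zero, .zero, .zero⟩, ⟨?_, ?_, .zero, ?_, .zero, .zero, .zero, .zero⟩⟩
    all_goals simp only [cub, cT, cY, generic, Int.reduceSub]
    · exact h (n := 3) (by compute_degree)
    · exact h (n := 2) (by compute_degree)
    · exact h (n := 1) (by compute_degree)
    · exact h (n := 1) (by compute_degree)
    · exact h (n := 1) (by compute_degree)
    · exact h (n := 3) (by compute_degree)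
    · exact h (n := 2) (by compute_degree)
    · exact h (n := 1) (by compute_degree)
    · exact h (n := 1) (by compute_degree)
    · exact DegLE.mono (h (n := 0) (by compute_degree)) (by norm_num)
    · exact h (n := 3) (by compute_degree)
    · exact DegLE.mono (h (n := 1) (by compute_degree)) (by norm_num)
    · exact h (n := 1) (by compute_degree)
  have hT : (rowT : Row R[X]).DegLE 2 :=
    ⟨.zero, .zero, .zero, h (n := 0) (by rw [rowT]; compute_degree), .zero, .zero, .zero,
      .zero⟩
  have hY : (rowY : Row R[X]).DegLE 2 :=
    ⟨.zero, .zero, .zero, .zero, h (n := 0) (by rw [rowY]; compute_degree), .zero, .zero,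
      .zero⟩
  have hV : (generic f0 f1 f2 f3).rowV.DegLE 2 := by
    refine ⟨?_, ?_, .zero, ?_, .zero, .zero, .zero, .zero⟩
    all_goals simp only [rowV, generic, g2, Int.reduceSub]
    · exact h (n := 2) (by compute_degree)
    · exact DegLE.mono (h (n := 0) (by compute_degree)) (by norm_num)
    · exact h (n := 0) (by compute_degree)
  have hS : (generic f0 f1 f2 f3).rowS.DegLE 2 := by
    refine ⟨?_, ?_, .zero, ?_, ?_, .zero, .zero, .zero⟩
    all_goals simp only [rowS, generic, g1, g2, Int.reduceSub]
    · exact h (n := 2) (by compute_degree)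
    · exact DegLE.mono (h (n := 0) (by compute_degree)) (by norm_num)
    · exact h (n := 0) (by compute_degree)
    · exact h (n := 0) (by compute_degree)
  have hN : (generic f0 f1 f2 f3).rowN.DegLE 2 := by
    refine ⟨?_, ?_, ?_, ?_, .zero, .zero, .zero, .zero⟩
    all_goals simp only [rowN, generic, g0, g1, g2, Int.reduceSub]
    · exact h (n := 2) (by compute_degree)
    · exact DegLE.mono (h (n := 0) (by compute_degree)) (by norm_num)
    · exact h (n := 0) (by compute_degree)
    · exact h (n := 0) (by compute_degree)
  have hM : (generic f0 f1 f2 f3).rowM.DegLE 2 := by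
    refine ⟨?_, ?_, .zero, ?_, .zero, .zero, .zero, .zero⟩
    all_goals simp only [rowM, generic, g0, g1, g2, Int.reduceSub]
    · exact h (n := 2) (by compute_degree)
    · exact h (n := 1) (by compute_degree)
    · exact h (n := 0) (by compute_degree)
  have hTS := hp.minor hT hS hV hV
  have hTN := hp.minor hT hN hV hY
  have hTM := hp.minor hT hM hY hY
  have hred {d : ℤ} {v : Row R[X]} (hv : v.DegLE d) := hp.red hTS hTN hTM hv
  exact (hp.det5 (hred (hp.minor hV hN hY hS)) (hred (hp.minor hV hM hY hN))
    (hred (hp.minor hS hM hN hN)) (hred (hp.mulC' hTS))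
    (hred (hp.mulC' (hp.mulC' hTS)))).natDegree_le

end Params

end Degree

namespace Params

theorem top_minor {R : Type*} [CommRing R] (p : Params R) (he : p.e = -1) :
    p.top p.minorTS p.minorTN p.minorTM =
      180 ^ 2 * 4860000 * 2700 ^ 6 * (p.f3 * (3 * p.f2 - p.f3 ^ 2) - 4 * p.f1) := by
  simp only [top, det3, minorTS, minorTN, minorTM, mul, mulT, mulY, mulC, cT, cY, cub, rowT, rowY,
    rowV, rowM, rowN, rowS, he, Row.add_def, Row.smul_def, mul_zero, zero_mul, add_zero,
    zero_add]
  ring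

end Params

namespace Params

open Polynomial

theorem map_generic {R S : Type*} [CommRing R] [CommRing S] (φ : R →+* S) (f0 f1 f2 f3 : R) :
    (generic f0 f1 f2 f3).map (mapRingHom φ) = generic (φ f0) (φ f1) (φ f2) (φ f3) := by
  simp [generic, map]

theorem eval_generic {R : Type*} [CommRing R] (f0 f1 f2 f3 b : R) :
    (generic f0 f1 f2 f3).map (evalRingHom b) = ⟨f0, f1, f2, f3, 1, b, -1⟩ := by
  simp [generic, map]

/-- The nondegeneracy conditions on the quartic `X⁴ + f₃X³ + f₂X² + f₁X + f₀` under which the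
incidence problem has exactly sixteen solutions, all with `a ≠ 0`. -/
structure Regular {K : Type*} [CommRing K] (f0 f1 f2 f3 : K) : Prop where
  f0_ne_zero : f0 ≠ 0
  left_ne_zero : f1 * (3 * f0 * f2 - f1 ^ 2) - 4 * f0 ^ 2 * f3 ≠ 0
  right_ne_zero : f3 * (3 * f2 - f3 ^ 2) - 4 * f1 ≠ 0
  kdet_ne_zero : (⟨f0, f1, f2, f3, 0, 1, -1⟩ : Params K).kdet ≠ 0
  coeff_ne_zero : (generic f0 f1 f2 f3).kdet.coeff 16 ≠ 0
  coprime_derivative : IsCoprime (generic f0 f1 f2 f3).kdet (derivative (generic f0 f1 f2 f3).kdet)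
  coprime_rho : IsCoprime (generic f0 f1 f2 f3).kdet (generic f0 f1 f2 f3).rho

/-- Integral polynomials which are coprime modulo `p`, where the leading coefficient of the first
is prime to `p`, are coprime over any field of characteristic zero. -/
theorem isCoprime_of_isCoprime_map {p : ℕ} [Fact p.Prime] {K : Type*} [Field K] [CharZero K]
    {f g : ℤ[X]} {n : ℕ} (hn : n ≠ 0) (hf : f.natDegree ≤ n) (hc : (f.coeff n : ZMod p) ≠ 0)
    (h : IsCoprime (f.map (Int.castRingHom (ZMod p))) (g.map (Int.castRingHom (ZMod p)))) :
    IsCoprime (f.map (Int.castRingHom K)) (g.map (Int.castRingHom K)) := by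
  set φ := Int.castRingHom (ZMod p)
  have hdeg : (f.map φ).natDegree = n :=
    natDegree_eq_of_le_of_coeff_ne_zero (natDegree_map_le.trans hf) (by rwa [coeff_map])
  have hres : f.resultant g n g.natDegree ≠ 0 := by
    intro h0
    have h1 : (f.map φ).resultant (g.map φ) n g.natDegree = 0 := by
      rw [resultant_map_map, h0, map_zero]
    obtain ⟨k, hk⟩ := Nat.exists_eq_add_of_le (natDegree_map_le (f := φ) (p := g))
    rw [hk, resultant_add_right_deg _ _ _ _ _ le_rfl] at h1
    rcases mul_eq_zero.mp h1 with h2 | h2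
    · refine pow_ne_zero k ?_ h2
      rwa [coeff_map]
    · refine resultant_ne_zero _ _ h ?_
      rwa [hdeg]
  obtain ⟨u, v, -, -, huv⟩ := exists_mul_add_mul_eq_C_resultant f g hf le_rfl (Or.inl hn)
  set r := f.resultant g n g.natDegree
  have hr : (r : K) ≠ 0 := Int.cast_ne_zero.mpr hres
  refine ⟨C (r : K)⁻¹ * u.map (Int.castRingHom K), C (r : K)⁻¹ * v.map (Int.castRingHom K), ?_⟩
  have h2 := congrArg (Polynomial.map (Int.castRingHom K)) huv
  rw [Polynomial.map_add, Polynomial.map_mul, Polynomial.map_mul, map_C] at h2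
  calc _ = C (r : K)⁻¹ * (f.map (Int.castRingHom K) * u.map (Int.castRingHom K) +
        g.map (Int.castRingHom K) * v.map (Int.castRingHom K)) := by ring
    _ = 1 := by rw [h2, ← C_mul, eq_intCast, inv_mul_cancel₀ hr, C_1]

theorem Regular.of_zmod {p : ℕ} [Fact p.Prime] {f0 f1 f2 f3 : ℤ}
    (h : Regular (f0 : ZMod p) (f1 : ZMod p) (f2 : ZMod p) (f3 : ZMod p)) :
    Regular (f0 : ℂ) (f1 : ℂ) (f2 : ℂ) (f3 : ℂ) := by
  set P := generic f0 f1 f2 f3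
  have hp : P.map (mapRingHom (Int.castRingHom (ZMod p))) =
    generic (f0 : ZMod p) (f1 : ZMod p) (f2 : ZMod p) (f3 : ZMod p) := map_generic ..
  have hC : P.map (mapRingHom (Int.castRingHom ℂ)) =
    generic (f0 : ℂ) (f1 : ℂ) (f2 : ℂ) (f3 : ℂ) := map_generic ..
  have kp := P.map_kdet (mapRingHom (Int.castRingHom (ZMod p)))
  have kC := P.map_kdet (mapRingHom (Int.castRingHom ℂ))
  have rp := P.map_rho (mapRingHom (Int.castRingHom (ZMod p)))
  have rC := P.map_rho (mapRingHom (Int.castRingHom ℂ))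
  rw [coe_mapRingHom] at kp kC rp rC
  rw [hp] at kp rp
  rw [hC] at kC rC
  obtain ⟨h1, h2, h3, h4, h5, h6, h7⟩ := h
  have lift {x : ℤ} (hx : (x : ZMod p) ≠ 0) : (x : ℂ) ≠ 0 := by
    refine Int.cast_ne_zero.mpr fun h0 => hx ?_
    rw [h0, Int.cast_zero]
  have hcoeff : ((P.kdet.coeff 16 : ℤ) : ZMod p) ≠ 0 := by
    rwa [← kp, coeff_map] at h5
  have hdeg : P.kdet.natDegree ≤ 16 := natDegree_kdet_generic ..
  refine ⟨lift h1, ?_, ?_, ?_, ?_, ?_, ?_⟩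
  · have := lift (x := f1 * (3 * f0 * f2 - f1 ^ (2 : ℕ)) - 4 * f0 ^ (2 : ℕ) * f3)
      (by push_cast; exact h2)
    push_cast at this
    exact this
  · have := lift (x := f3 * (3 * f2 - f3 ^ (2 : ℕ)) - 4 * f1) (by push_cast; exact h3)
    push_cast at this
    exact this
  · have key (R : Type) [CommRing R] :
        (((⟨f0, f1, f2, f3, 0, 1, -1⟩ : Params ℤ).kdet : ℤ) : R) =
          (⟨f0, f1, f2, f3, 0, 1, -1⟩ : Params R).kdet := by
      have := map_kdet (⟨f0, f1, f2, f3, 0, 1, -1⟩ : Params ℤ) (Int.castRingHom R)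
      simpa [map] using this
    rw [← key] at h4 ⊢
    exact lift h4
  · rw [← kC, coeff_map]
    exact lift hcoeff
  · rw [← kC, derivative_map]
    refine isCoprime_of_isCoprime_map (by norm_num) hdeg hcoeff ?_
    rw [← derivative_map, kp]
    exact h6
  · rw [← kC, ← rC]
    refine isCoprime_of_isCoprime_map (by norm_num) hdeg hcoeff ?_
    rw [kp, rp]
    exact h7

section Complex

variable {f0 f1 f2 f3 : ℂ}

theorem Regular.card_roots (h : Regular f0 f1 f2 f3) :
    {b : ℂ | (⟨f0, f1, f2, f3, 1, b, -1⟩ : Params ℂ).kdet = 0}.ncard = 16 := by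
  set q := (generic f0 f1 f2 f3).kdet with hq
  have hdeg : q.natDegree = 16 :=
    natDegree_eq_of_le_of_coeff_ne_zero (natDegree_kdet_generic ..) h.coeff_ne_zero
  have hq0 : q ≠ 0 := fun h0 => by rw [h0] at hdeg; simp at hdeg
  have hev (b : ℂ) : (⟨f0, f1, f2, f3, 1, b, -1⟩ : Params ℂ).kdet = q.eval b := by
    rw [← eval_generic, ← map_kdet, coe_evalRingHom]
  have hset : {b : ℂ | (⟨f0, f1, f2, f3, 1, b, -1⟩ : Params ℂ).kdet = 0} =
      (q.roots.toFinset : Set ℂ) := by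
    ext b
    simp [hev, hq0]
  have hsep : q.Separable := h.coprime_derivative
  rw [hset, Set.ncard_coe_finset, Multiset.toFinset_card_of_nodup (nodup_roots hsep), ← hdeg]
  exact (splits_iff_card_roots.mp (IsAlgClosed.splits q))

theorem Regular.rho_ne_zero (h : Regular f0 f1 f2 f3) {b : ℂ}
    (hb : (⟨f0, f1, f2, f3, 1, b, -1⟩ : Params ℂ).kdet = 0) :
    (⟨f0, f1, f2, f3, 1, b, -1⟩ : Params ℂ).rho ≠ 0 := by
  intro hr
  rw [← eval_generic, ← map_kdet, coe_evalRingHom] at hb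
  rw [← eval_generic, ← map_rho, coe_evalRingHom] at hr
  obtain ⟨u, v, huv⟩ := h.coprime_rho
  simpa [hb, hr] using congrArg (eval b) huv

theorem Regular.not_sq_dvd (h : Regular f0 f1 f2 f3) (b : ℂ) :
    ¬ (X - C b) ^ 2 ∣ (generic f0 f1 f2 f3).kdet := by
  intro hd
  have hsep : (generic f0 f1 f2 f3).kdet.Separable := h.coprime_derivative
  rw [sq] at hd
  exact not_isUnit_X_sub_C b (hsep.squarefree _ hd)

/-- Every zero of the eliminant comes from a solution. -/
theorem Regular.exists_sol (h : Regular f0 f1 f2 f3) {b : ℂ}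
    (hb : (⟨f0, f1, f2, f3, 1, b, -1⟩ : Params ℂ).kdet = 0) :
    ∃ c A B C, (⟨f0, f1, f2, f3, 1, b, -1⟩ : Params ℂ).Sol c A B C := by
  refine Params.exists_sol rfl rfl h.f0_ne_zero (h.rho_ne_zero hb) ?_ hb
  rw [top_minor _ rfl]
  exact mul_ne_zero (by norm_num) h.right_ne_zero

/-- A solution is determined up to sign by `b`. -/
theorem Regular.eq_or_eq_neg (h : Regular f0 f1 f2 f3) {b c A B C c' A' B' C' : ℂ}
    (hs : (⟨f0, f1, f2, f3, 1, b, -1⟩ : Params ℂ).Sol c A B C)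
    (hs' : (⟨f0, f1, f2, f3, 1, b, -1⟩ : Params ℂ).Sol c' A' B' C') :
    c = c' ∧ (A = A' ∧ B = B' ∧ C = C' ∨ A = -A' ∧ B = -B' ∧ C = -C') :=
  Sol.eq_or_eq_neg (eval_generic f0 f1 f2 f3 b) rfl (h.not_sq_dvd b) h.f0_ne_zero hs hs'

end Complex

end Params

namespace ListPoly

variable {R : Type*} [CommRing R]

open Polynomial

/-- The polynomial with the given list of coefficients, constant term first. -/
noncomputable def toPoly (R : Type*) [CommRing R] : List ℕ → R[X]
  | [] => 0
  | a :: l => C (a : R) + X * toPoly R l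

def eval (x : ℕ) : List ℕ → ℕ
  | [] => 0
  | a :: l => a + x * eval x l

def add : List ℕ → List ℕ → List ℕ
  | [], m => m
  | l, [] => l
  | a :: l, b :: m => (a + b) :: add l m

def mul : List ℕ → List ℕ → List ℕ
  | [], _ => []
  | a :: l, m => add (m.map (a * ·)) (0 :: mul l m)

def deriv : List ℕ → List ℕ
  | [] => []
  | _ :: l => add l (0 :: deriv l)

/-- The polynomial with these coefficients is `1` modulo `p`. -/
def isOne (p : ℕ) : List ℕ → Bool
  | [] => false
  | a :: l => a % p == 1 && l.all (· % p == 0)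

theorem eval_toPoly (x : ℕ) (l : List ℕ) : (toPoly R l).eval (x : R) = (eval x l : ℕ) := by
  induction l with
  | nil => simp [toPoly, eval]
  | cons a l ih => simp [toPoly, eval, ih]

theorem toPoly_add (l m : List ℕ) : toPoly R (add l m) = toPoly R l + toPoly R m := by
  induction l, m using add.induct with
  | case1 m => simp [toPoly, add]
  | case2 l h => cases l <;> simp [toPoly, add]
  | case3 a l b m ih =>
    simp only [toPoly, add, ih, Nat.cast_add, C_add]
    ring

theorem toPoly_map_mul (a : ℕ) (l : List ℕ) :
    toPoly R (l.map (a * ·)) = C (a : R) * toPoly R l := by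
  induction l with
  | nil => simp [toPoly]
  | cons b l ih =>
    simp only [toPoly, List.map_cons, ih, Nat.cast_mul, C_mul]
    ring

theorem toPoly_mul (l m : List ℕ) : toPoly R (mul l m) = toPoly R l * toPoly R m := by
  induction l with
  | nil => simp [toPoly, mul]
  | cons a l ih =>
    simp only [toPoly, mul, toPoly_add, toPoly_map_mul, ih, Nat.cast_zero, C_0]
    ring

theorem toPoly_deriv (l : List ℕ) : toPoly R (deriv l) = derivative (toPoly R l) := by
  induction l with
  | nil => simp [toPoly, deriv]
  | cons a l ih => simp [toPoly, deriv, toPoly_add, ih]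

theorem toPoly_eq_zero {p : ℕ} {l : List ℕ} (h : ∀ a ∈ l, a % p = 0) : toPoly (ZMod p) l = 0 := by
  induction l with
  | nil => rfl
  | cons a l ih =>
    have ha : (a : ZMod p) = 0 :=
      (ZMod.natCast_eq_zero_iff a p).mpr (Nat.dvd_of_mod_eq_zero (h a List.mem_cons_self))
    rw [toPoly, ih fun b hb => h b (List.mem_cons_of_mem a hb), ha]
    simp

theorem toPoly_eq_one {p : ℕ} {l : List ℕ} (h : isOne p l = true) :
    toPoly (ZMod p) l = 1 := by
  cases l with
  | nil => simp [isOne] at h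
  | cons a l =>
    simp only [isOne, Bool.and_eq_true, beq_iff_eq, List.all_eq_true] at h
    have ha : (a : ZMod p) = 1 := by
      rw [← ZMod.natCast_mod a p, h.1, Nat.cast_one]
    rw [toPoly, toPoly_eq_zero h.2, ha]
    simp

theorem natDegree_toPoly_lt {n : ℕ} {l : List ℕ} (h : l.length ≤ n) :
    (toPoly R l).degree < n := by
  induction l generalizing n with
  | nil => simp [toPoly]
  | cons a l ih =>
    obtain ⟨n, rfl⟩ : ∃ m, n = m + 1 := ⟨n - 1, by simp at h; omega⟩
    refine (degree_add_le _ _).trans_lt (max_lt ?_ ?_)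
    · exact degree_C_le.trans_lt (by exact_mod_cast Nat.succ_pos n)
    · rcases eq_or_ne (toPoly R l) 0 with h0 | h0
      · rw [h0, mul_zero, degree_zero]
        exact WithBot.bot_lt_coe _
      · refine (degree_mul_le _ _).trans_lt ?_
        have h1 := ih (n := n) (by simpa using h)
        have h2 : (X : R[X]).degree ≤ 1 := degree_X_le
        rw [degree_eq_natDegree h0] at h1 ⊢
        have h3 : (toPoly R l).natDegree < n := by exact_mod_cast h1
        calc (X : R[X]).degree + ((toPoly R l).natDegree : WithBot ℕ)
            ≤ 1 + ((toPoly R l).natDegree : WithBot ℕ) := by gcongr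
          _ < ((n + 1 : ℕ) : WithBot ℕ) := by
            exact_mod_cast (by omega : 1 + (toPoly R l).natDegree < n + 1)

/-- A polynomial of degree at most `16` modulo a prime `p ≥ 17` is determined by its values at
`0, …, 16`. -/
theorem eq_toPoly {p : ℕ} [Fact p.Prime] (hp : 17 ≤ p) {q : (ZMod p)[X]} (hq : q.natDegree ≤ 16)
    {l : List ℕ} (hl : l.length ≤ 17)
    (h : ∀ x : ℕ, x < 17 → q.eval (x : ZMod p) = (eval x l : ℕ)) : q = toPoly (ZMod p) l := by
  have hinj : Set.InjOn (fun x : ℕ => (x : ZMod p)) (Finset.range 17) := by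
    intro x hx y hy hxy
    have := (ZMod.natCast_eq_natCast_iff' x y p).mp hxy
    simp only [Finset.coe_range, Set.mem_Iio] at hx hy
    rwa [Nat.mod_eq_of_lt (by omega), Nat.mod_eq_of_lt (by omega)] at this
  refine eq_of_degrees_lt_of_eval_index_eq (Finset.range 17) hinj ?_ ?_ ?_
  · rw [Finset.card_range]
    exact (degree_le_of_natDegree_le hq).trans_lt (by norm_num)
  · rw [Finset.card_range]
    exact natDegree_toPoly_lt hl
  · intro x hx
    rw [h x (Finset.mem_range.mp hx), eval_toPoly]

theorem coeff_toPoly (l : List ℕ) (n : ℕ) : (toPoly R l).coeff n = (l.getD n 0 : ℕ) := by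
  induction l generalizing n with
  | nil => simp [toPoly]
  | cons a l ih =>
    cases n with
    | zero => simp [toPoly]
    | succ n => simp [toPoly, ih]

end ListPoly

open Polynomial in
theorem Params.natDegree_rho_generic {R : Type*} [CommRing R] (f0 f1 f2 f3 : R) :
    (generic f0 f1 f2 f3).rho.natDegree ≤ 16 := by
  simp only [rho, generic]
  compute_degree!

/-- A proof of regularity of a quartic modulo `p`: the coefficients of the eliminant and of `rho`,
and Bézout coefficients for the eliminant with its derivative and with `rho`. -/
structure Certificate where
  (p f0 f1 f2 f3 : ℕ)
  (k r u v u' v' : List ℕ)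

namespace Certificate

open Polynomial Params

variable (c : Certificate)

/-- The parameters of the certificate with `-1` represented by `p - 1`. -/
def params (a b : ℕ) : Params ℕ := ⟨c.f0, c.f1, c.f2, c.f3, a, b, c.p - 1⟩

def check : Bool :=
  [17, 19, 23, 29, 31, 37].contains c.p && c.f0 % c.p != 0 &&
  (c.f1 * (3 * c.f0 * c.f2 + (c.p - 1) * c.f1 ^ 2) + (c.p - 1) * (4 * c.f0 ^ 2 * c.f3)) % c.p != 0
  && (c.f3 * (3 * c.f2 + (c.p - 1) * c.f3 ^ 2) + (c.p - 1) * (4 * c.f1)) % c.p != 0 &&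
  (c.params 0 1).kdet % c.p != 0 && c.k.length == 17 && c.k.getD 16 0 % c.p != 0 &&
  c.r.length == 4 &&
  (List.range 17).all (fun b => (c.params 1 b).kdet % c.p == ListPoly.eval b c.k % c.p) &&
  (List.range 17).all (fun b => (c.params 1 b).rho % c.p == ListPoly.eval b c.r % c.p) &&
  ListPoly.isOne c.p
    (ListPoly.add (ListPoly.mul c.u c.k) (ListPoly.mul c.v (ListPoly.deriv c.k))) &&
  ListPoly.isOne c.p (ListPoly.add (ListPoly.mul c.u' c.k) (ListPoly.mul c.v' c.r))

theorem map_params {p : ℕ} (hp : 0 < p) (h : c.p = p) (a b : ℕ) :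
    (c.params a b).map (Nat.castRingHom (ZMod p)) =
      ⟨(c.f0 : ZMod p), c.f1, c.f2, c.f3, a, b, -1⟩ := by
  subst h
  simp [params, Params.map, Nat.cast_sub (Nat.one_le_iff_ne_zero.mpr hp.ne')]

theorem regular (h : c.check = true) :
    c.p.Prime ∧
      Regular (c.f0 : ZMod c.p) (c.f1 : ZMod c.p) (c.f2 : ZMod c.p) (c.f3 : ZMod c.p) := by
  simp only [check, Bool.and_eq_true, bne_iff_ne, beq_iff_eq, List.contains_iff_mem,
    List.all_eq_true, List.mem_range, ne_eq] at h
  obtain ⟨⟨⟨⟨⟨⟨⟨⟨⟨⟨⟨hp, h0⟩, h1⟩, h2⟩, h3⟩, hk⟩, h4⟩, hr⟩, hek⟩, her⟩, hu⟩, hv⟩ := h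
  have hprime : c.p.Prime ∧ 17 ≤ c.p := by
    simp only [List.mem_cons, List.not_mem_nil, or_false] at hp
    rcases hp with h | h | h | h | h | h <;> rw [h] <;> norm_num
  obtain ⟨hprime, h17⟩ := hprime
  have : Fact c.p.Prime := ⟨hprime⟩
  have hpos : 0 < c.p := hprime.pos
  have ne {x : ℕ} (hx : ¬ x % c.p = 0) : (x : ZMod c.p) ≠ 0 := fun h0 =>
    hx (Nat.mod_eq_zero_of_dvd ((ZMod.natCast_eq_zero_iff x c.p).mp h0))
  have eq {x y : ℕ} (hx : x % c.p = y % c.p) : (x : ZMod c.p) = y :=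
    (ZMod.natCast_eq_natCast_iff' x y c.p).mpr hx
  have hm (a b : ℕ) := c.map_params hpos rfl a b
  have hmk (a b : ℕ) : (⟨(c.f0 : ZMod c.p), c.f1, c.f2, c.f3, a, b, -1⟩ : Params _).kdet =
      ((c.params a b).kdet : ℕ) := by
    rw [← hm, ← map_kdet]
    rfl
  have hmr (a b : ℕ) : (⟨(c.f0 : ZMod c.p), c.f1, c.f2, c.f3, a, b, -1⟩ : Params _).rho =
      ((c.params a b).rho : ℕ) := by
    rw [← hm, ← map_rho]
    rfl
  have hone : ((c.p - 1 : ℕ) : ZMod c.p) = -1 := by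
    rw [Nat.cast_sub hpos, ZMod.natCast_self, zero_sub, Nat.cast_one]
  have hkp : (generic (c.f0 : ZMod c.p) c.f1 c.f2 c.f3).kdet = ListPoly.toPoly (ZMod c.p) c.k := by
    refine ListPoly.eq_toPoly h17 (natDegree_kdet_generic ..) hk.le fun x hx => ?_
    rw [← coe_evalRingHom, map_kdet, eval_generic, ← eq (hek x hx), ← hmk, Nat.cast_one]
  have hrp : (generic (c.f0 : ZMod c.p) c.f1 c.f2 c.f3).rho = ListPoly.toPoly (ZMod c.p) c.r := by
    refine ListPoly.eq_toPoly h17 (natDegree_rho_generic ..) (hr.le.trans (by norm_num))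
      fun x hx => ?_
    rw [← coe_evalRingHom, map_rho, eval_generic, ← eq (her x hx), ← hmr, Nat.cast_one]
  refine ⟨hprime, ne h0, ?_, ?_, ?_, ?_, ?_, ?_⟩
  · have := ne h1
    push_cast [hone] at this
    convert this using 1
    ring
  · have := ne h2
    push_cast [hone] at this
    convert this using 1
    ring
  · have := ne h3
    rw [← hmk] at this
    simpa using this
  · rw [hkp, ListPoly.coeff_toPoly]
    exact ne h4
  · rw [hkp]
    refine ⟨ListPoly.toPoly _ c.u, ListPoly.toPoly _ c.v, ?_⟩
    rw [← ListPoly.toPoly_deriv, ← ListPoly.toPoly_mul, ← ListPoly.toPoly_mul,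
      ← ListPoly.toPoly_add]
    exact ListPoly.toPoly_eq_one hu
  · rw [hkp, hrp]
    refine ⟨ListPoly.toPoly _ c.u', ListPoly.toPoly _ c.v', ?_⟩
    rw [← ListPoly.toPoly_mul, ← ListPoly.toPoly_mul, ← ListPoly.toPoly_add]
    exact ListPoly.toPoly_eq_one hv

end Certificate

/-- One certificate for each class of instances. -/
def certificates : List Certificate :=
  [
    ⟨23, 1, 3, 17, 3, [15, 15, 11, 1, 17, 8, 21, 7, 17, 10, 0, 16, 12, 0, 1, 14, 14], [17, 22, 2,
      5], [7, 18, 21, 22, 8, 3, 1, 13, 17, 20, 10, 4, 12, 7, 14], [13, 5, 18, 18, 13, 18, 6, 0,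
      16, 9, 12, 20, 17, 15, 4, 2], [21, 19, 15], [14, 21, 2, 6, 0, 19, 9, 20, 4, 1, 0, 8, 4, 11,
      9, 4]⟩,
    ⟨23, 1, 1, 6, 7, [21, 4, 16, 17, 22, 20, 7, 20, 17, 17, 3, 3, 14, 0, 14, 1, 22], [8, 7, 4,
      12], [6, 19, 4, 22, 17, 21, 2, 3, 14, 14, 17, 22, 6, 16, 10], [9, 12, 7, 16, 13, 13, 0, 6,
      17, 18, 3, 5, 11, 19, 10, 8], [6, 1, 16], [16, 12, 19, 14, 16, 8, 10, 8, 10, 18, 18, 7, 10,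
      22, 13, 9]⟩,
    ⟨23, 1, 0, 11, 10, [3, 18, 13, 5, 11, 14, 1, 15, 19, 11, 5, 0, 18, 15, 14, 12, 15], [4, 17,
      11, 12], [12, 19, 4, 8, 7, 13, 21, 21, 0, 22, 8, 22, 8, 8, 9], [7, 22, 12, 13, 1, 6, 19, 3,
      13, 15, 13, 11, 16, 2, 4, 21], [9, 22, 13], [5, 8, 4, 6, 6, 16, 1, 10, 14, 8, 17, 19, 16,
      18, 18, 1]⟩,
    ⟨23, 1, 2, 6, 21, [20, 18, 14, 11, 8, 15, 16, 7, 1, 14, 11, 15, 8, 3, 4, 17, 22], [5, 19, 14,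
      10], [18, 6, 15, 3, 9, 9, 5, 2, 1, 17, 13, 13, 17, 4, 10], [12, 18, 13, 9, 1, 17, 17, 7, 0,
      14, 17, 9, 4, 6, 20, 8], [5, 21, 9], [17, 22, 10, 8, 16, 17, 2, 14, 9, 16, 3, 5, 20, 6, 9,
      17]⟩,
    ⟨23, 1, 2, 12, 7, [15, 19, 22, 20, 4, 8, 0, 22, 8, 8, 22, 11, 15, 13, 21, 10, 21], [16, 4, 10,
      14], [5, 20, 0, 19, 14, 13, 15, 4, 11, 17, 0, 16, 16, 3, 22], [7, 9, 16, 22, 2, 14, 8, 11,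
      13, 19, 3, 3, 18, 5, 13, 13], [21, 16, 5], [12, 16, 15, 15, 4, 19, 2, 16, 6, 16, 5, 15, 12,
      11, 9, 4]⟩,
    ⟨23, 1, 1, 8, 9, [21, 7, 16, 7, 2, 4, 0, 20, 15, 13, 14, 7, 22, 5, 18, 2, 19], [1, 12, 4, 1],
      [19, 7, 7, 13, 2, 11, 16, 15, 6, 21, 22, 11, 4, 5, 7], [22, 4, 2, 14, 9, 19, 22, 3, 3, 0,
      17, 1, 10, 5, 9, 1], [13, 2, 11], [4, 3, 1, 2, 6, 16, 5, 3, 15, 5, 10, 20, 20, 13, 17, 21]⟩,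
    ⟨23, 1, 0, 8, 10, [9, 14, 10, 18, 21, 19, 22, 18, 11, 3, 4, 7, 22, 13, 3, 15, 13], [4, 4, 4,
      12], [1, 5, 12, 10, 5, 17, 7, 19, 6, 12, 16, 2, 18, 9, 17], [6, 2, 0, 2, 10, 10, 5, 8, 17,
      14, 0, 10, 10, 5, 18, 9], [20, 21, 20], [7, 8, 12, 11, 14, 6, 6, 2, 2, 5, 17, 16, 21, 7, 1,
      9]⟩,
    ⟨23, 1, 0, 21, 7, [18, 22, 1, 15, 3, 21, 1, 16, 16, 19, 4, 15, 14, 20, 22, 0, 2], [13, 20, 16,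
      13], [11, 22, 16, 21, 12, 1, 21, 16, 15, 11, 10, 9, 20, 17, 14], [13, 20, 5, 5, 22, 12, 7,
      20, 17, 3, 15, 16, 17, 13, 9, 2], [22, 11, 11], [5, 0, 22, 3, 1, 14, 0, 21, 6, 3, 12, 19, 7,
      14, 14, 16]⟩,
    ⟨23, 1, 1, 4, 1, [16, 7, 2, 17, 22, 17, 21, 20, 3, 6, 12, 19, 12, 15, 14, 5, 17], [7, 13, 0,
      9], [10, 14, 10, 21, 3, 15, 17, 7, 3, 20, 19, 15, 8, 20, 8], [20, 9, 0, 14, 13, 5, 18, 7,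
      16, 15, 5, 12, 12, 17, 8, 11], [0, 10, 7], [10, 21, 4, 6, 21, 6, 17, 16, 5, 7, 14, 20, 10,
      16, 13, 20]⟩,
    ⟨23, 1, 0, 5, 3, [21, 11, 12, 9, 0, 2, 10, 14, 5, 0, 5, 2, 17, 5, 1, 19, 1], [16, 18, 21, 22],
      [19, 10, 22, 0, 22, 17, 17, 20, 18, 11, 19, 10, 19, 20, 12], [14, 15, 17, 1, 3, 7, 12, 22,
      13, 11, 1, 20, 11, 8, 9, 5], [17, 12, 11], [18, 17, 21, 11, 18, 0, 21, 17, 14, 16, 12, 18,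
      11, 10, 15, 11]⟩,
    ⟨23, 1, 1, 9, 11, [8, 0, 11, 8, 8, 22, 14, 11, 2, 10, 8, 12, 10, 12, 20, 13, 1], [21, 18, 4,
      22], [3, 7, 21, 7, 1, 21, 12, 11, 15, 15, 10, 22, 13, 3, 20], [10, 4, 21, 4, 7, 7, 15, 9,
      20, 0, 3, 6, 11, 0, 20, 16], [0, 0, 2], [11, 7, 1, 6, 6, 16, 0, 5, 5, 20, 17, 5, 8, 5, 11,
      2]⟩,
    ⟨23, 1, 1, 12, 15, [6, 0, 12, 6, 15, 18, 0, 9, 2, 0, 5, 13, 12, 12, 1, 20, 20], [4, 21, 5, 9],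
      [4, 11, 5, 21, 11, 2, 6, 5, 9, 6, 11, 15, 1, 7, 1], [3, 6, 5, 17, 2, 15, 14, 22, 10, 3, 21,
      9, 8, 9, 16, 10], [18, 20, 2], [2, 17, 18, 17, 11, 9, 16, 3, 5, 0, 21, 2, 20, 18, 1, 16]⟩,
    ⟨23, 1, 3, 21, 20, [3, 19, 0, 8, 6, 5, 15, 20, 1, 15, 12, 15, 16, 2, 17, 0, 22], [17, 0, 17,
      14], [4, 20, 12, 18, 0, 10, 12, 17, 4, 9, 8, 0, 18, 20, 17], [20, 11, 17, 0, 22, 3, 8, 20,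
      14, 19, 20, 1, 0, 20, 16, 9], [18, 3], [5, 1, 16, 4, 16, 13, 14, 19, 14, 17, 1, 13, 6, 11,
      15]⟩,
    ⟨23, 1, 4, 12, 10, [1, 20, 15, 12, 10, 21, 10, 11, 17, 11, 2, 9, 1, 15, 19, 17, 19], [16, 22,
      2, 5], [20, 4, 2, 15, 12, 17, 16, 3, 7, 15, 18, 16, 0, 18, 19], [14, 14, 6, 4, 4, 18, 14, 0,
      21, 8, 11, 22, 4, 22, 21, 6], [5, 11, 19], [17, 20, 14, 7, 15, 14, 22, 10, 9, 16, 0, 11, 17,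
      21, 20, 6]⟩,
    ⟨23, 1, 1, 7, 8, [9, 18, 22, 0, 3, 5, 18, 19, 16, 18, 8, 16, 18, 20, 2, 20, 21], [4, 6, 18,
      18], [21, 11, 2, 14, 6, 11, 20, 19, 17, 7, 21, 4, 7, 9, 18], [10, 4, 19, 19, 15, 6, 18, 8,
      15, 15, 4, 19, 1, 19, 12, 19], [15, 19, 20], [1, 9, 22, 15, 10, 4, 11, 9, 18, 1, 15, 3, 16,
      11, 16, 15]⟩,
    ⟨23, 1, 6, 22, 6, [14, 5, 14, 1, 22, 12, 13, 0, 14, 8, 15, 4, 16, 10, 14, 8, 4], [22, 7, 5,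
      0], [1, 4, 10, 13, 16, 22, 22, 7, 12, 2, 12, 13, 14, 1, 17], [2, 18, 15, 10, 0, 0, 4, 11, 8,
      7, 0, 18, 10, 4, 14, 9], [8], [19, 12, 15, 12, 13, 17, 12, 8, 21, 21, 4, 4, 15, 21, 12]⟩,
    ⟨23, 1, 1, 0, 22, [19, 8, 6, 0, 5, 6, 10, 21, 0, 11, 9, 19, 19, 18, 13, 15, 1], [7, 7, 7, 15],
      [10, 6, 14, 9, 16, 15, 14, 12, 2, 16, 19, 9, 0, 5, 20], [8, 4, 22, 2, 14, 18, 2, 12, 2, 20,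
      1, 16, 6, 10, 19, 16], [13, 14, 5], [1, 2, 22, 12, 4, 11, 4, 15, 20, 13, 21, 0, 16, 15, 7,
      15]⟩,
    ⟨23, 1, 3, 13, 5, [21, 18, 8, 3, 7, 0, 6, 2, 3, 9, 2, 15, 13, 3, 11, 3, 15], [2, 22, 1, 5],
      [16, 1, 18, 22, 10, 19, 1, 1, 22, 22, 8, 19, 16, 20, 13], [21, 14, 8, 1, 16, 12, 6, 15, 0,
      0, 5, 18, 1, 20, 9, 15], [1, 18, 20], [13, 4, 22, 22, 6, 5, 21, 7, 16, 4, 14, 22, 5, 10, 15,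
      9]⟩,
    ⟨23, 1, 1, 7, 1, [12, 12, 8, 17, 9, 3, 9, 0, 1, 7, 17, 7, 2, 5, 5, 13, 15], [7, 12, 0, 5],
      [22, 19, 13, 18, 6, 14, 20, 10, 4, 1, 2, 18, 5, 7, 2], [3, 1, 14, 14, 0, 11, 7, 3, 18, 10,
      20, 15, 19, 22, 4, 20], [18, 4, 11], [12, 14, 2, 3, 15, 22, 0, 9, 8, 17, 17, 2, 11, 13, 10,
      13]⟩,
    ⟨23, 1, 4, 19, 19, [15, 7, 17, 15, 19, 5, 7, 15, 6, 22, 5, 0, 13, 22, 21, 17, 3], [20, 2, 15,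
      3], [18, 6, 10, 5, 4, 4, 9, 7, 8, 16, 4, 8, 5, 14, 9], [1, 7, 10, 9, 2, 10, 0, 0, 6, 1, 1,
      22, 21, 19, 8, 21], [18, 14, 2], [13, 21, 9, 22, 0, 10, 7, 12, 18, 19, 6, 17, 19, 5, 0,
      21]⟩,
    ⟨23, 1, 2, 21, 21, [22, 2, 3, 12, 5, 2, 20, 19, 8, 12, 13, 11, 15, 9, 22, 14, 8], [5, 6, 19,
      16], [6, 16, 16, 0, 15, 12, 13, 14, 12, 20, 17, 7, 6, 2, 18], [15, 3, 3, 10, 17, 7, 19, 12,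
      14, 19, 20, 4, 15, 20, 21, 19], [18, 15, 6], [13, 17, 2, 7, 10, 15, 17, 22, 18, 8, 3, 4, 12,
      22, 21, 20]⟩,
    ⟨19, 1, 0, 11, 6, [17, 10, 10, 6, 7, 1, 8, 7, 11, 9, 7, 1, 6, 11, 15, 6, 10], [8, 10, 3, 16],
      [14, 18, 14, 1, 8, 3, 5, 5, 6, 4, 14, 13, 6, 14, 8], [1, 18, 9, 13, 4, 9, 3, 6, 5, 16, 14,
      6, 15, 12, 13, 9], [16, 0, 13], [16, 17, 13, 5, 3, 16, 8, 17, 18, 16, 0, 15, 9, 7, 6, 18]⟩,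
    ⟨19, 1, 1, 14, 4, [9, 2, 3, 0, 15, 17, 14, 2, 3, 13, 18, 2, 15, 6, 6, 5, 11], [0, 11, 18, 12],
      [14, 14, 15, 7, 16, 0, 12, 14, 2, 12, 10, 11, 0, 15, 7], [4, 6, 3, 3, 14, 2, 1, 16, 13, 1,
      12, 5, 0, 6, 1, 15], [17, 6, 13], [11, 14, 6, 0, 16, 15, 17, 13, 0, 13, 4, 8, 18, 11, 3,
      15]⟩,
    ⟨17, 1, 0, 7, 3, [10, 12, 0, 0, 8, 16, 6, 6, 6, 6, 7, 3, 0, 0, 5, 9, 11], [11, 12, 10, 15],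
      [12, 16, 3, 4, 6, 2, 11, 2, 0, 15, 15, 3, 15, 3, 16], [0, 3, 7, 5, 9, 12, 1, 11, 11, 13, 15,
      13, 9, 2, 10, 16], [2, 16, 8], [6, 3, 16, 0, 0, 10, 13, 14, 10, 14, 4, 16, 6, 13, 4, 10]⟩,
    ⟨19, 1, 4, 0, 4, [9, 12, 6, 14, 9, 14, 17, 8, 16, 5, 6, 5, 14, 18, 3, 16, 8], [10, 11, 18, 2],
      [13, 0, 6, 6, 2, 12, 2, 7, 2, 18, 11, 16, 9, 9, 5], [3, 3, 4, 11, 9, 7, 16, 17, 6, 10, 6,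
      11, 2, 9, 4, 8], [4, 17, 16], [6, 17, 15, 6, 2, 11, 16, 16, 3, 12, 12, 9, 7, 5, 0, 12]⟩,
    ⟨19, 1, 0, 3, 5, [12, 2, 6, 1, 3, 15, 3, 14, 15, 13, 3, 17, 14, 13, 16, 8, 7], [14, 4, 10, 7],
      [9, 5, 11, 5, 17, 14, 11, 14, 18, 5, 10, 4, 11, 11, 14], [13, 16, 5, 7, 9, 18, 16, 11, 18,
      17, 16, 1, 2, 4, 4, 11], [0, 11], [15, 8, 18, 0, 0, 9, 6, 18, 9, 1, 8, 1, 10, 14, 8]⟩,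
    ⟨19, 1, 1, 16, 17, [14, 16, 14, 12, 0, 10, 10, 11, 10, 14, 0, 3, 6, 10, 16, 13, 1], [10, 10,
      10, 8], [14, 9, 18, 5, 7, 8, 8, 12, 0, 6, 7, 17, 10, 11, 8], [8, 14, 6, 17, 5, 12, 4, 6, 2,
      5, 5, 11, 0, 8, 9, 9], [0, 0, 12], [2, 17, 6, 17, 15, 2, 15, 16, 1, 11, 5, 12, 16, 10, 18,
      8]⟩,
    ⟨17, 1, 2, 8, 8, [7, 4, 12, 16, 13, 14, 4, 8, 1, 5, 1, 5, 9, 8, 10, 1, 15], [15, 2, 16, 12],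
      [11, 10, 10, 6, 1, 6, 8, 7, 11, 9, 9, 9, 15, 0, 1], [15, 9, 3, 1, 9, 0, 15, 4, 12, 3, 15, 2,
      4, 0, 9, 1], [6, 5, 13], [12, 16, 8, 6, 0, 11, 0, 9, 5, 2, 16, 10, 9, 9, 3, 5]⟩,
    ⟨29, 1, 4, 7, 6, [14, 13, 9, 26, 12, 10, 6, 12, 18, 9, 13, 27, 2, 10, 15, 8, 2], [0, 11, 23,
      1], [23, 3, 13, 25, 26, 28, 11, 7, 15, 7, 28, 1, 21, 7, 15], [11, 21, 17, 23, 14, 6, 4, 15,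
      8, 27, 6, 22, 8, 9, 17, 19], [27, 10, 14], [16, 15, 21, 22, 18, 3, 13, 10, 27, 22, 7, 27,
      14, 20, 19, 1]⟩,
    ⟨17, 1, 1, 0, 13, [16, 14, 14, 9, 5, 10, 9, 13, 9, 9, 0, 16, 11, 1, 10, 2, 11], [8, 6, 10, 8],
      [3, 9, 2, 12, 9, 10, 0, 14, 15, 2, 9, 1, 3, 3, 14], [10, 8, 16, 10, 2, 14, 14, 0, 4, 7, 5,
      3, 0, 16, 2, 14], [3, 9, 10], [9, 4, 0, 11, 5, 15, 8, 15, 11, 16, 8, 1, 0, 9, 14, 16]⟩,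
    ⟨29, 1, 1, 9, 7, [13, 21, 3, 5, 21, 23, 2, 12, 8, 24, 3, 1, 27, 12, 19, 1, 4], [1, 10, 23, 1],
      [27, 7, 24, 28, 15, 22, 8, 9, 1, 28, 18, 1, 8, 26, 8], [22, 19, 7, 12, 24, 15, 12, 9, 5, 25,
      3, 4, 23, 15, 14, 14], [23, 5, 20], [21, 25, 22, 26, 4, 27, 17, 25, 5, 5, 12, 25, 1, 16, 2,
      7]⟩,
    ⟨29, 2, 0, 9, 14, [15, 27, 18, 10, 11, 6, 28, 2, 3, 7, 14, 24, 5, 7, 24, 6, 28], [28, 3, 13,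
      16], [18, 3, 18, 3, 23, 5, 23, 28, 4, 5, 7, 28, 17, 18, 21], [4, 4, 20, 6, 1, 15, 18, 9, 28,
      3, 5, 0, 2, 7, 15, 15], [6, 16, 21], [2, 2, 17, 9, 14, 12, 16, 28, 20, 0, 10, 24, 11, 0, 18,
      14]⟩,
    ⟨17, 1, 1, 6, 1, [6, 2, 5, 15, 12, 12, 4, 2, 11, 2, 0, 8, 15, 3, 12, 13, 1], [1, 3, 0, 15],
      [6, 7, 5, 16, 16, 16, 1, 1, 11, 13, 6, 8, 15, 10, 6], [8, 1, 16, 15, 3, 6, 15, 5, 8, 7, 2,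
      15, 5, 1, 0, 6], [7, 13, 8], [10, 14, 2, 15, 4, 6, 4, 4, 1, 2, 7, 11, 0, 6, 16, 4]⟩,
    ⟨29, 1, 1, 13, 2, [17, 7, 16, 1, 16, 27, 5, 13, 27, 25, 0, 27, 1, 24, 4, 20, 1], [5, 17, 20,
      8], [7, 7, 27, 20, 21, 26, 6, 10, 18, 28, 9, 27, 16, 24, 13], [8, 14, 18, 7, 13, 17, 14, 2,
      23, 24, 16, 11, 9, 5, 7, 1], [15, 18, 4], [13, 7, 23, 4, 16, 26, 12, 12, 22, 6, 16, 0, 6,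
      25, 18, 14]⟩,
    ⟨29, 1, 0, 3, 12, [16, 16, 15, 15, 20, 1, 10, 2, 5, 8, 27, 28, 19, 27, 1, 26, 11], [22, 26,
      10, 20], [11, 17, 18, 23, 7, 9, 5, 8, 13, 11, 28, 6, 15, 24, 4], [9, 24, 4, 23, 0, 17, 24,
      0, 13, 7, 8, 6, 15, 24, 17, 7], [21, 23, 24], [23, 12, 2, 24, 26, 4, 7, 24, 9, 19, 3, 28,
      23, 13, 28, 10]⟩,
    ⟨31, 1, 1, 10, 3, [27, 9, 24, 3, 3, 20, 3, 0, 10, 18, 10, 30, 29, 20, 19, 29, 25], [26, 19,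
      26, 26], [28, 21, 29, 8, 2, 16, 1, 15, 29, 21, 27, 28, 13, 30, 7], [16, 20, 15, 29, 28, 0,
      6, 3, 21, 28, 25, 17, 30, 29, 3, 17], [19, 22, 9], [28, 30, 5, 26, 20, 28, 4, 4, 8, 17, 8,
      16, 17, 13, 18, 14]⟩,
    ⟨31, 1, 0, 15, 8, [20, 17, 3, 16, 26, 16, 0, 13, 30, 24, 5, 29, 3, 28, 25, 17, 22], [26, 17,
      16, 25], [29, 22, 24, 10, 14, 30, 16, 3, 30, 13, 7, 0, 10, 18, 17], [17, 23, 18, 24, 9, 1,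
      15, 21, 1, 17, 4, 29, 24, 20, 27, 28], [2, 18, 10], [14, 21, 14, 19, 28, 17, 11, 21, 21, 21,
      20, 14, 16, 25, 13, 16]⟩,
    ⟨37, 1, 1, 15, 19, [12, 10, 4, 28, 23, 28, 18, 16, 26, 31, 18, 1, 35, 6, 35, 11, 25], [7, 26,
      26, 24], [7, 2, 23, 8, 31, 2, 3, 4, 18, 8, 27, 26, 7, 30, 27], [25, 15, 12, 18, 20, 20, 13,
      3, 21, 6, 16, 21, 19, 1, 13, 33], [23, 10, 22], [3, 34, 30, 14, 20, 2, 16, 26, 0, 24, 33,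
      16, 12, 6, 20, 11]⟩,
    ⟨17, 1, 3, 11, 10, [7, 11, 16, 15, 7, 11, 9, 7, 14, 16, 3, 6, 0, 1, 3, 4, 5], [5, 8, 15, 10],
      [2, 4, 10, 0, 12, 15, 13, 1, 1, 6, 9, 14, 3, 3, 15], [5, 1, 2, 16, 14, 8, 16, 12, 0, 8, 3,
      1, 13, 12, 8, 15], [4, 13, 12], [15, 0, 9, 15, 2, 0, 10, 13, 7, 10, 9, 13, 8, 0, 13, 11]⟩,
    ⟨17, 1, 1, 2, 3, [8, 7, 1, 8, 10, 10, 6, 4, 3, 14, 15, 13, 1, 2, 14, 15, 16], [7, 15, 2, 3],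
      [12, 9, 1, 6, 1, 6, 16, 15, 2, 4, 14, 0, 8, 2, 15], [1, 9, 4, 5, 13, 0, 1, 8, 11, 5, 7, 12,
      7, 0, 6, 15], [0, 10, 4], [5, 7, 3, 1, 16, 6, 1, 9, 10, 3, 4, 3, 15, 5, 7, 7]⟩,
    ⟨19, 1, 2, 18, 2, [14, 10, 17, 17, 10, 11, 3, 4, 14, 9, 1, 6, 10, 15, 16, 12, 6], [12, 3, 4,
      16], [9, 8, 0, 5, 15, 18, 0, 13, 4, 1, 17, 11, 5, 10, 2], [16, 9, 7, 9, 10, 17, 0, 6, 16, 7,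
      18, 10, 16, 10, 5, 7], [13, 7, 6], [15, 1, 11, 18, 4, 17, 8, 15, 1, 18, 3, 12, 11, 18, 16,
      12]⟩,
    ⟨29, 1, 2, 11, 10, [0, 4, 20, 26, 21, 24, 27, 3, 13, 2, 22, 5, 16, 24, 26, 5, 15], [28, 0, 6,
      20], [6, 8, 27, 24, 23, 16, 28, 18, 9, 9, 9, 5, 10, 16, 14], [22, 6, 24, 3, 25, 11, 13, 22,
      20, 22, 5, 22, 11, 26, 27, 10], [19, 24, 18], [28, 18, 6, 3, 10, 0, 21, 3, 3, 1, 24, 0, 27,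
      18, 12, 1]⟩,
    ⟨29, 1, 1, 11, 5, [9, 25, 13, 5, 14, 16, 16, 6, 21, 20, 1, 26, 12, 13, 25, 6, 28], [7, 19, 6,
      15], [17, 6, 10, 7, 25, 8, 28, 24, 15, 11, 16, 14, 4, 26, 14], [9, 26, 28, 17, 2, 17, 7, 11,
      3, 24, 9, 7, 16, 11, 20, 10], [25, 12, 25], [26, 7, 3, 12, 23, 0, 23, 6, 8, 27, 22, 24, 24,
      18, 23, 21]⟩,
    ⟨29, 1, 1, 16, 22, [15, 19, 6, 26, 16, 28, 13, 12, 1, 0, 16, 28, 8, 7, 28, 4, 23], [1, 8, 0,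
      19], [3, 12, 2, 0, 4, 5, 23, 28, 6, 16, 16, 7, 17, 21, 14], [16, 11, 9, 9, 1, 12, 23, 28,
      23, 16, 5, 21, 0, 4, 17, 10], [7, 17, 11], [12, 9, 7, 6, 2, 25, 16, 4, 9, 26, 28, 7, 18, 20,
      0, 5]⟩,
    ⟨29, 1, 2, 18, 7, [23, 28, 9, 16, 1, 7, 19, 26, 7, 7, 22, 13, 28, 1, 7, 3, 19], [19, 10, 7,
      1], [27, 26, 4, 9, 1, 13, 10, 22, 19, 28, 26, 3, 7, 2, 19], [11, 15, 5, 12, 2, 24, 22, 11,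
      18, 3, 9, 26, 26, 6, 7, 26], [11, 21, 7], [2, 26, 2, 4, 20, 15, 28, 24, 25, 4, 1, 5, 10, 13,
      18, 12]⟩,
    ⟨31, 1, 0, 22, 10, [26, 28, 0, 0, 16, 21, 28, 16, 2, 19, 12, 6, 6, 27, 10, 24, 3], [29, 26,
      25, 8], [7, 24, 1, 9, 9, 25, 14, 8, 6, 23, 14, 2, 9, 15, 11], [19, 15, 26, 7, 27, 7, 9, 24,
      11, 29, 0, 24, 6, 30, 21, 9], [15, 17, 17], [24, 30, 2, 22, 24, 5, 1, 26, 0, 20, 28, 8, 19,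
      4, 26, 13]⟩]

theorem check_certificates : certificates.all Certificate.check = true := by
  decide +kernel

namespace Cover

open Params

section

variable {R : Type*} [CommRing R]

/-- The value at `x` of the coordinate on the projective line which vanishes at `s₁` and has a pole
at `s₂`, up to a factor depending only on `s₂, x, y, z, w`. -/
def coord (l s1 s2 x y z w : R) : R := l * (x - s1) * ((y - s2) * (z - s2) * (w - s2))

/-- The quartic with the given roots is regular. -/
def RegularRoots (t1 t2 t3 t4 : R) : Prop :=
  Regular (t1 * t2 * t3 * t4) (-(t1 * t2 * t3 + t1 * t2 * t4 + t1 * t3 * t4 + t2 * t3 * t4))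
    (t1 * t2 + t1 * t3 + t1 * t4 + t2 * t3 + t2 * t4 + t3 * t4) (-(t1 + t2 + t3 + t4))

end

def points : List ℕ := [1, 2, 3, 4, 5, 6, 11, 12, 13, 17, 19, 23]

/-- The quartic with roots `t₁, …, t₄` has the coefficients listed in the certificate. -/
def matchesRoots (c : Certificate) (t1 t2 t3 t4 : ℤ) : Bool :=
  (t1 * t2 * t3 * t4 - c.f0) % c.p == 0 &&
  (-(t1 * t2 * t3 + t1 * t2 * t4 + t1 * t3 * t4 + t2 * t3 * t4) - c.f1) % c.p == 0 &&
  (t1 * t2 + t1 * t3 + t1 * t4 + t2 * t3 + t2 * t4 + t3 * t4 - c.f2) % c.p == 0 &&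
  (-(t1 + t2 + t3 + t4) - c.f3) % c.p == 0

def checkSplit (c : Certificate) (l s1 s2 : ℕ) : List ℕ → Bool
  | [x, y, z, w] => matchesRoots c (coord l s1 s2 x y z w) (coord l s1 s2 y x z w)
      (coord l s1 s2 z x y w) (coord l s1 s2 w x y z)
  | _ => false

def checkAt (l s1 s2 i : ℕ) (L : List ℕ) : Bool :=
  L.contains s1 && (L.erase s1).contains s2 &&
    checkSplit (certificates.getD i ⟨0, 0, 0, 0, 0, [], [], [], [], [], []⟩) l s1 s2
      ((L.erase s1).erase s2)

/-- The code of a subset packs two of its elements, a scaling factor and the index of a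
certificate. -/
def checkCode (q : List ℕ × ℕ) : Bool :=
  checkAt (q.2 / 46 % 37) (q.2 / 46 / 37 / 24) (q.2 / 46 / 37 % 24) (q.2 % 46) q.1

def codes : List ℕ :=
  [960117, 563413, 541951, 489306, 264288, 509751, 267632, 560191, 570966, 482498, 471877, 550370,
    227198, 540333, 805692, 214781, 714983, 214879, 786555, 460282, 234006, 253841, 795295, 214820,
    215326, 264273, 499520, 460558, 560376, 182358, 509549, 783386, 519860, 482050, 972216, 497409,
    252311, 184250, 274904, 192567, 570219, 713324, 701964, 203143, 530154, 184554, 570682, 500719,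
    519387, 538263, 196292, 196239, 716598, 783752, 203516, 196392, 226892, 237092, 225268, 948157,
    182806, 497175, 481713, 458537, 733852, 962096, 244136, 172423, 196208, 233805, 785041, 172647,
    195828, 226557, 211379, 172728, 704817, 174249, 267865, 192838, 264828, 224759, 264641, 225234,
    145040, 549895, 781324, 488530, 488952, 152284, 267585, 250615, 250843, 143491, 133689, 152506,
    141704, 151810, 155205, 284616, 501083, 727726, 162399, 155451, 509924, 237225, 131887, 523160,
    519943, 155710, 713758, 489258, 472470, 805098, 495337, 960852, 727677, 210345, 499351, 536641,
    237140, 785408, 267316, 541516, 161748, 233594, 501128, 161792, 145688, 225452, 133365, 233775,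
    223500, 471641, 209682, 227349, 224731, 264689, 478519, 133741, 701415, 152316, 183959, 130054,
    523210, 456881, 196430, 489454, 129728, 497633, 141654, 700372, 470505, 797232, 145184, 169519,
    155711, 151772, 267312, 196158, 162526, 130194, 267320, 143896, 701974, 195792, 250481, 133742,
    174652, 482413, 717007, 460236, 155024, 129399, 496299, 210087, 799117, 539858, 155815, 172839,
    703392, 699896, 184651, 209819, 130138, 785231, 168729, 223942, 202981, 141556, 185846, 184100,
    172044, 212071, 130151, 133006, 703006, 211653, 132951, 172784, 560423, 530112, 215248, 193170,
    501368, 141742, 131477, 454950, 215014, 224731, 121718, 114281, 101259, 452829, 488753, 453659,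
    267876, 500736, 267546, 560291, 494468, 787120, 104715, 111468, 795759, 102367, 102351, 715582,
    267742, 471790, 110968, 815732, 114084, 779895, 90323, 540414, 943788, 90959, 959198, 100709,
    223980, 100970, 237189, 91130, 101392, 233271, 91146, 248966, 103926, 560334, 121132, 120981,
    278352, 92423, 266394, 698524, 237109, 91036, 780072, 570957, 114868, 458811, 501128, 208347,
    494550, 267734, 88786, 114267, 563852, 497639, 714900, 815723, 88661, 202929, 471506, 797565,
    192512, 110819, 962096, 564342, 184740, 252035, 815537, 704821, 196289, 196451, 102320, 701280,
    121318, 104799, 519395, 489330, 100749, 114874, 248799, 88882, 111506, 470404, 249419, 459636,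
    182536, 703942, 237667, 538109, 114737, 499248, 233637, 91235, 203060, 90989, 90323, 458262,
    167028, 111235, 538076, 535123, 550394, 469895, 509455, 103043, 499206, 207968, 233533, 254524,
    104707, 215330, 211329, 184563, 237089, 102314, 104210, 172923, 195870, 166852, 88562, 453715,
    114135, 87332, 121128, 143897, 102845, 478496, 100883, 698792, 100932, 943512, 162243, 494609,
    959060, 126609, 100977, 133407, 542162, 699988, 104697, 87141, 133592, 500911, 133313, 536412,
    274624, 972078, 87129, 151584, 536791, 799172, 126275, 530072, 92843, 111104, 551730, 237243,
    944891, 104700, 727402, 121044, 945120, 797323, 551784, 143680, 227243, 120983, 100740, 703621,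
    126835, 100655, 100799, 142095, 453429, 132022, 141467, 132080, 969271, 110869, 126323, 104850,
    209854, 103106, 523442, 102913, 102195, 253830, 250934, 141683, 458809, 133360, 88967, 88844,
    534613, 151806, 89305, 102235, 114237, 203242, 130151, 167031, 142084, 130230, 196020, 455141,
    115014, 87045, 162716, 781914, 497358, 89393, 816000, 167124, 89396, 87545, 129959, 151987,
    88832, 143479, 102235, 512490, 86856, 92422, 100757, 126277, 141463, 162828, 86848, 88832,
    121858, 196424, 91126, 130047, 126744, 111252, 227016, 172547, 114556, 141960, 209674, 458818,
    161970, 131147, 89059, 251024, 209439, 88784, 73508, 472330, 806063, 451584, 512535, 70475,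
    561153, 61827, 285513, 717098, 62014, 451407, 263958, 59947, 73556, 73660, 247622, 61986,
    488985, 470591, 550220, 968690, 80505, 206653, 560746, 492756, 73618, 223386, 49691, 482591,
    815969, 206498, 237070, 223148, 206641, 59906, 80277, 785053, 214690, 215103, 51537, 253749,
    519299, 254571, 214966, 51167, 458534, 705600, 223517, 254385, 214503, 233329, 214603, 266482,
    458396, 206419, 815356, 522971, 815675, 696951, 73303, 80750, 471573, 202726, 182437, 492766,
    183871, 47804, 469940, 48587, 165575, 73846, 186192, 186216, 560288, 497822, 173743, 805344,
    48173, 73754, 492068, 794891, 174172, 182859, 60261, 264608, 533098, 265704, 61511, 47980,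
    47998, 74074, 63039, 533284, 172229, 48503, 206787, 48410, 63352, 206653, 70109, 59909, 243486,
    479196, 165743, 185624, 234049, 80920, 196609, 172143, 63676, 206545, 274994, 196700, 202736,
    783800, 51257, 211752, 491991, 62104, 226650, 50378, 59620, 70175, 264606, 497090, 46510,
    124845, 80826, 143015, 63204, 80327, 532779, 63257, 536870, 80558, 162343, 781517, 513228,
    143387, 697090, 51943, 972031, 284386, 705000, 62118, 61692, 805834, 145382, 501128, 51855,
    133696, 133779, 73984, 541894, 155627, 560932, 247037, 143758, 266118, 250292, 151722, 244358,
    124441, 70750, 62206, 244084, 46875, 46250, 61457, 498874, 49409, 46186, 209724, 145364, 73934,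
    141825, 131929, 455227, 131208, 131574, 816140, 944808, 209817, 63305, 73933, 51389, 250392,
    73850, 51758, 512445, 80596, 124661, 700372, 206337, 223980, 151862, 947016, 700042, 560423,
    80171, 193119, 522563, 162251, 145134, 497426, 60407, 46108, 701465, 550395, 48274, 69880,
    142289, 46875, 47902, 472336, 80097, 80520, 133227, 47944, 168553, 533571, 266345, 252634,
    250704, 184645, 247121, 46706, 129407, 145417, 509270, 165790, 968764, 155165, 47964, 169527,
    186027, 243529, 523210, 206043, 166120, 211650, 50286, 169105, 131302, 61660, 253691, 236858,
    131378, 172597, 215097, 173928, 532915, 523207, 80227, 102674, 727771, 101345, 104101, 100515,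
    44495, 529787, 80916, 713707, 61686, 513224, 63439, 110732, 80657, 570506, 70351, 44915,
    121056, 61613, 44485, 114658, 92696, 44460, 80474, 83449, 103986, 114589, 84049, 83496, 787204,
    274956, 509224, 236771, 535174, 49470, 560793, 49793, 234006, 777966, 208519, 73754, 208302,
    223241, 44483, 223796, 103872, 458394, 560150, 62008, 102814, 49911, 206679, 277753, 44956,
    248560, 44776, 539647, 63865, 960900, 45132, 50203, 84324, 51524, 50140, 458549, 51679, 61515,
    48657, 48135, 943520, 111613, 80887, 80050, 45283, 202791, 104752, 61796, 165702, 44859, 88840,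
    570863, 167554, 696398, 960319, 45098, 519361, 494321, 114221, 80511, 44642, 48356, 44510,
    247119, 529594, 44623, 61735, 174479, 48178, 174019, 264557, 88975, 44948, 48165, 941808,
    780487, 48419, 196147, 50142, 81009, 49793, 491980, 63261, 223288, 48396, 89486, 226605, 59645,
    252220, 74198, 215467, 246933, 254200, 165187, 83823, 46937, 63718, 145182, 782010, 81022,
    519550, 536318, 144903, 69970, 44760, 111324, 70433, 63309, 532915, 46015, 455266, 100471,
    101346, 46703, 247678, 275042, 73982, 45178, 145197, 110873, 86934, 249417, 492344, 51474,
    247389, 277476, 455314, 142236, 60135, 161741, 80639, 44356, 209490, 73932, 87083, 124570,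
    114367, 49459, 493756, 59662, 141406, 84276, 45178, 469940, 251069, 132849, 51203, 44669,
    265838, 50002, 45167, 46047, 83960, 941441, 536600, 717007, 89381, 184463, 193130, 497816,
    165924, 167219, 87684, 87407, 184466, 133036, 124570, 126643, 167120, 51474, 100698, 49726,
    209626, 48486, 131931, 208474, 166889, 50186]

theorem check_codes : ((points.sublistsLen 6).zip codes).all checkCode = true := by
  decide +kernel

theorem length_codes : codes.length = 924 := by
  decide +kernel

theorem matchesRoots.regularRoots {c : Certificate} (hc : c ∈ certificates) {t1 t2 t3 t4 : ℤ}
    (h : matchesRoots c t1 t2 t3 t4 = true) :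
    RegularRoots (t1 : ℂ) (t2 : ℂ) (t3 : ℂ) (t4 : ℂ) := by
  obtain ⟨hp, hr⟩ := c.regular (List.all_eq_true.mp check_certificates c hc)
  have : Fact c.p.Prime := ⟨hp⟩
  simp only [matchesRoots, Bool.and_eq_true, beq_iff_eq] at h
  have key {x : ℤ} {y : ℕ} (hxy : (x - y) % c.p = 0) : (y : ZMod c.p) = (x : ZMod c.p) := by
    have := (ZMod.intCast_zmod_eq_zero_iff_dvd _ _).mpr (Int.dvd_of_emod_eq_zero hxy)
    push_cast at this
    exact (sub_eq_zero.mp this).symm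
  rw [key h.1.1.1, key h.1.1.2, key h.1.2, key h.2] at hr
  have := hr.of_zmod
  push_cast at this
  exact this

theorem checkSplit.exists {c : Certificate} (hc : c ∈ certificates) {l s1 s2 : ℕ} {L : List ℕ}
    (h : checkSplit c l s1 s2 L = true) :
    ∃ x y z w : ℕ, L = [x, y, z, w] ∧
      RegularRoots (coord (l : ℂ) s1 s2 x y z w) (coord (l : ℂ) s1 s2 y x z w)
        (coord (l : ℂ) s1 s2 z x y w) (coord (l : ℂ) s1 s2 w x y z) := by
  unfold checkSplit at h
  split at h
  · rename_i x y z w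
    refine ⟨x, y, z, w, rfl, ?_⟩
    have := matchesRoots.regularRoots hc h
    simpa [coord] using this
  · exact absurd h (by simp)

theorem exists_of_all_zip {α β : Type*} {l : List α} {m : List β} {f : α × β → Bool}
    (h : (l.zip m).all f = true) (hlen : l.length ≤ m.length) {a : α} (ha : a ∈ l) :
    ∃ b, f (a, b) = true := by
  rw [← List.map_fst_zip hlen] at ha
  obtain ⟨⟨_, b⟩, hq, rfl⟩ := List.mem_map.mp ha
  exact ⟨b, List.all_eq_true.mp h _ hq⟩

theorem exists_perm {L : List ℕ} (hL : L ∈ points.sublistsLen 6) :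
    ∃ l s1 s2 x y z w : ℕ, L.Perm [s1, s2, x, y, z, w] ∧
      RegularRoots (coord (l : ℂ) s1 s2 x y z w) (coord (l : ℂ) s1 s2 y x z w)
        (coord (l : ℂ) s1 s2 z x y w) (coord (l : ℂ) s1 s2 w x y z) := by
  obtain ⟨k, h⟩ := exists_of_all_zip check_codes
    (by rw [length_codes, List.length_sublistsLen]; decide) hL
  simp only [checkCode, checkAt, Bool.and_eq_true, List.contains_iff_mem] at h
  have hk : k % 46 < certificates.length := (Nat.mod_lt _ (by norm_num)).trans_eq (by rfl)
  rw [List.getD_eq_getElem _ _ hk] at h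
  obtain ⟨⟨h1, h2⟩, h3⟩ := h
  obtain ⟨x, y, z, w, he, hr⟩ := checkSplit.exists (List.getElem_mem hk) h3
  exact ⟨_, _, _, x, y, z, w,
    (List.perm_cons_erase h1).trans
      ((List.perm_cons_erase h2).trans (he ▸ List.Perm.refl _) |>.cons _),
    hr⟩

/-- Any six of the points can be ordered in such a way that two of them are moved to `0` and `∞` and
the other four become the roots of a regular quartic. -/
theorem exists_regularRoots {T : Finset ℕ}
    (hT : T ⊆ ({1, 2, 3, 4, 5, 6, 11, 12, 13, 17, 19, 23} : Finset ℕ)) (hcard : T.card = 6) :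
    ∃ l s1 s2 x y z w : ℕ, [s1, s2, x, y, z, w].Nodup ∧ T = {s1, s2, x, y, z, w} ∧
      RegularRoots (coord (l : ℂ) s1 s2 x y z w) (coord (l : ℂ) s1 s2 y x z w)
        (coord (l : ℂ) s1 s2 z x y w) (coord (l : ℂ) s1 s2 w x y z) := by
  have hmem : T.val ∈ Multiset.powersetCard 6 (points : Multiset ℕ) :=
    Multiset.mem_powersetCard.mpr ⟨Finset.val_le_iff.mpr hT, hcard⟩
  rw [Multiset.powersetCard_coe, Multiset.mem_coe, List.mem_map] at hmem
  obtain ⟨L, hL, hLT⟩ := hmem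
  obtain ⟨l, s1, s2, x, y, z, w, hperm, hr⟩ := exists_perm hL
  have hval : T.val = ([s1, s2, x, y, z, w] : Multiset ℕ) := by
    rw [← hLT]
    exact Quotient.sound hperm
  refine ⟨l, s1, s2, x, y, z, w, ?_, ?_, hr⟩
  · have := T.nodup
    rwa [hval] at this
  · ext a
    rw [← Finset.mem_val, hval]
    simp

end Cover

namespace Geometry

/-- The value at `γ(s)` of the form paired with `x`, and its first two derivatives in `s`. -/
noncomputable def pair0 (x : Fin (2 * 3) → ℂ) (s : ℂ) : ℂ :=
  x 0 * s ^ 5 / 120 - x 1 * s ^ 4 / 24 + x 2 * s ^ 3 / 6 - x 3 * s ^ 2 / 2 - x 4 * s - x 5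

noncomputable def pair1 (x : Fin (2 * 3) → ℂ) (s : ℂ) : ℂ :=
  x 0 * s ^ 4 / 24 - x 1 * s ^ 3 / 6 + x 2 * s ^ 2 / 2 - x 3 * s - x 4

noncomputable def pair2 (x : Fin (2 * 3) → ℂ) (s : ℂ) : ℂ :=
  x 0 * s ^ 3 / 6 - x 1 * s ^ 2 / 2 + x 2 * s - x 3

theorem formLC_three (x y : Fin (2 * 3) → ℂ) :
    formLC 3 x y =
      (x 0 * y 5 - y 0 * x 5) + (x 1 * y 4 - y 1 * x 4) + (x 2 * y 3 - y 2 * x 3) := by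
  simp only [formLC, Fin.sum_univ_three]
  rfl

theorem gammaLC_three (i : Fin (2 * 3)) :
    gammaLC 3 i = fun s =>
      ((-1 : ℂ) ^ ((i : ℕ) - 3) / (Nat.factorial (i : ℕ))) * s ^ (i : ℕ) := by
  funext s
  simp only [gammaLC]
  ring

theorem iteratedDeriv_gammaLC (k : ℕ) (i : Fin (2 * 3)) (s : ℂ) :
    iteratedDeriv k (gammaLC 3 i) s =
      ((-1 : ℂ) ^ ((i : ℕ) - 3) / (Nat.factorial (i : ℕ))) *
        ((Nat.descFactorial (i : ℕ) k : ℂ) * s ^ ((i : ℕ) - k)) := by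
  rw [gammaLC_three, iteratedDeriv_const_mul_field, iteratedDeriv_pow]

theorem oscLC_eq_span (s : ℂ) :
    oscLC 3 3 s = Submodule.span ℂ
      {![1, s, s ^ 2 / 2, s ^ 3 / 6, -s ^ 4 / 24, s ^ 5 / 120],
        ![0, 1, s, s ^ 2 / 2, -s ^ 3 / 6, s ^ 4 / 24],
        ![0, 0, 1, s, -s ^ 2 / 2, s ^ 3 / 6]} := by
  rw [oscLC]
  congr 1
  have h0 : (fun i => iteratedDeriv 0 (gammaLC 3 i) s) =
      ![1, s, s ^ 2 / 2, s ^ 3 / 6, -s ^ 4 / 24, s ^ 5 / 120] := by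
    funext i
    rw [iteratedDeriv_gammaLC]
    fin_cases i <;> simp [Nat.factorial, Nat.descFactorial] <;> ring
  have h1 : (fun i => iteratedDeriv 1 (gammaLC 3 i) s) =
      ![0, 1, s, s ^ 2 / 2, -s ^ 3 / 6, s ^ 4 / 24] := by
    funext i
    rw [iteratedDeriv_gammaLC]
    fin_cases i <;> simp [Nat.factorial, Nat.descFactorial] <;> ring
  have h2 : (fun i => iteratedDeriv 2 (gammaLC 3 i) s) =
      ![0, 0, 1, s, -s ^ 2 / 2, s ^ 3 / 6] := by
    funext i
    rw [iteratedDeriv_gammaLC]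
    fin_cases i <;> simp [Nat.factorial, Nat.descFactorial] <;> ring
  rw [← h0, ← h1, ← h2]
  ext x
  simp [Fin.exists_fin_succ, eq_comm]

theorem mem_oscLC_iff (x : Fin (2 * 3) → ℂ) (s : ℂ) :
    x ∈ oscLC 3 3 s ↔ pair0 x s = 0 ∧ pair1 x s = 0 ∧ pair2 x s = 0 := by
  rw [oscLC_eq_span, Submodule.mem_span_triple]
  constructor
  · rintro ⟨a, b, c, rfl⟩
    simp [pair0, pair1, pair2]
    refine ⟨?_, ?_, ?_⟩ <;> ring
  · rintro ⟨h0, h1, h2⟩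
    simp only [pair0, pair1, pair2] at h0 h1 h2
    refine ⟨x 0, x 1 - x 0 * s, x 2 - x 1 * s + x 0 * s ^ 2 / 2, ?_⟩
    funext i
    fin_cases i <;> simp
    · ring
    · linear_combination h2
    · linear_combination h1 - s * h2
    · linear_combination h0 - s * h1 + s ^ 2 / 2 * h2

end Geometry

namespace Geometry

open Submodule

/-- The integral over `[0, s]` of the product of the quadratics attached to `p` and `q`. -/
noncomputable def gram (p q : Fin 3 → ℝ) (s : ℝ) : ℝ :=
  p 0 * q 0 * s ^ 5 / 20 - (p 0 * q 1 + p 1 * q 0) * s ^ 4 / 8 +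
    (p 0 * q 2 + p 2 * q 0) * s ^ 3 / 6 + p 1 * q 1 * s ^ 3 / 3 -
    (p 1 * q 2 + p 2 * q 1) * s ^ 2 / 2 + p 2 * q 2 * s

theorem gram_mono (p : Fin 3 → ℝ) {s s' : ℝ} (h : s < s') :
    0 ≤ gram p p s' - gram p p s ∧ (gram p p s' - gram p p s = 0 → p = 0) := by
  set m := (s + s') / 2
  set d := s' - s with hd
  have hpos : 0 < d := sub_pos.mpr h
  have key : gram p p s' - gram p p s =
      d * (p 0 * m ^ 2 / 2 - p 1 * m + p 2 + p 0 * d ^ 2 / 24) ^ 2 +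
        d ^ 3 / 12 * (p 0 * m - p 1) ^ 2 + d ^ 5 / 720 * p 0 ^ 2 := by
    simp only [gram, m, d]
    ring
  have h1 : 0 ≤ d * (p 0 * m ^ 2 / 2 - p 1 * m + p 2 + p 0 * d ^ 2 / 24) ^ 2 := by positivity
  have h2 : 0 ≤ d ^ 3 / 12 * (p 0 * m - p 1) ^ 2 := by positivity
  have h3 : 0 ≤ d ^ 5 / 720 * p 0 ^ 2 := by positivity
  refine ⟨by rw [key]; positivity, fun h0 => ?_⟩
  rw [key] at h0
  have e3 : p 0 = 0 := by
    have : d ^ 5 / 720 * p 0 ^ 2 = 0 := by linarith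
    simpa [hpos.ne'] using this
  have e2 : p 1 = 0 := by
    have : d ^ 3 / 12 * (p 0 * m - p 1) ^ 2 = 0 := by linarith
    simpa [hpos.ne', e3] using this
  have e1 : p 2 = 0 := by
    have : d * (p 0 * m ^ 2 / 2 - p 1 * m + p 2 + p 0 * d ^ 2 / 24) ^ 2 = 0 := by linarith
    simpa [hpos.ne', e3, e2] using this
  funext i
  fin_cases i <;> assumption

/-- The real vector in `F₃(s)` with the given first three coordinates. -/
noncomputable def lift (p : Fin 3 → ℝ) (s : ℝ) : Fin (2 * 3) → ℝ :=
  ![p 0, p 1, p 2, p 0 * s ^ 3 / 6 - p 1 * s ^ 2 / 2 + p 2 * s,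
    -p 0 * s ^ 4 / 8 + p 1 * s ^ 3 / 3 - p 2 * s ^ 2 / 2,
    p 0 * s ^ 5 / 20 - p 1 * s ^ 4 / 8 + p 2 * s ^ 3 / 6]

theorem formLC_lift (p q : Fin 3 → ℝ) (s s' : ℝ) :
    formLC 3 (fun i => (lift p s i : ℂ)) (fun i => (lift q s' i : ℂ)) =
      ((gram p q s' - gram p q s : ℝ) : ℂ) := by
  rw [formLC_three]
  simp [lift, gram]
  ring

/-- A conjugation stable subspace meeting `F₃(s)` with `s` real contains a real vector there. -/
theorem exists_lift_mem {H : Submodule ℂ (Fin (2 * 3) → ℂ)} (hc : conjStableLC 3 H) {s : ℝ}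
    (h : H ⊓ oscLC 3 3 (s : ℂ) ≠ ⊥) : ∃ p : Fin 3 → ℝ, p ≠ 0 ∧ (fun i => (lift p s i : ℂ)) ∈ H := by
  obtain ⟨x, ⟨hxH, hxF⟩, hx0⟩ := (Submodule.ne_bot_iff _).mp h
  have key (r : Fin (2 * 3) → ℝ) (hr : (fun i => (r i : ℂ)) ∈ oscLC 3 3 (s : ℂ)) :
      r = lift (![r 0, r 1, r 2]) s := by
    rw [mem_oscLC_iff] at hr
    simp only [pair0, pair1, pair2] at hr
    norm_cast at hr
    obtain ⟨h0, h1, h2⟩ := hr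
    funext i
    fin_cases i <;> simp [lift]
    · linear_combination -h2
    · linear_combination -h1 + s * h2
    · linear_combination -h0 + s * h1 - s ^ 2 / 2 * h2
  have fin (r : Fin (2 * 3) → ℝ) (hr : (fun i => (r i : ℂ)) ∈ oscLC 3 3 (s : ℂ))
      (hrH : (fun i => (r i : ℂ)) ∈ H) (hr0 : r ≠ 0) :
      ∃ p : Fin 3 → ℝ, p ≠ 0 ∧ (fun i => (lift p s i : ℂ)) ∈ H := by
    refine ⟨![r 0, r 1, r 2], fun h0 => hr0 ?_, ?_⟩
    · rw [key r hr, h0]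
      funext i
      fin_cases i <;> simp [lift]
    · rwa [← key r hr]
  set y : Fin (2 * 3) → ℂ := fun i => (starRingEnd ℂ) (x i) with hy
  have hyH : y ∈ H := hc x hxH
  have hyF : y ∈ oscLC 3 3 (s : ℂ) := by
    rw [SetLike.mem_coe, mem_oscLC_iff] at hxF
    rw [mem_oscLC_iff]
    obtain ⟨h0, h1, h2⟩ := hxF
    refine ⟨?_, ?_, ?_⟩
    · simpa [pair0, y, map_ofNat] using congrArg (starRingEnd ℂ) h0
    · simpa [pair1, y, map_ofNat] using congrArg (starRingEnd ℂ) h1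
    · simpa [pair2, y, map_ofNat] using congrArg (starRingEnd ℂ) h2
  have hre : (fun i => ((x i).re : ℂ)) = (1 / 2 : ℂ) • (x + y) := by
    funext i
    simp [y, Complex.re_eq_add_conj]
    ring
  have him : (fun i => ((x i).im : ℂ)) = (-Complex.I / 2 : ℂ) • (x - y) := by
    funext i
    simp [y, Complex.im_eq_sub_conj, Complex.inv_I, div_eq_mul_inv]
    ring
  by_cases h0 : (fun i => (x i).re) = 0
  · refine fin (fun i => (x i).im) ?_ ?_ fun h1 => hx0 ?_
    · rw [him]
      exact smul_mem _ _ (sub_mem hxF hyF)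
    · rw [him]
      exact smul_mem _ _ (sub_mem hxH hyH)
    · funext i
      exact Complex.ext (congrFun h0 i) (congrFun h1 i)
  · refine fin (fun i => (x i).re) ?_ ?_ h0
    · rw [hre]
      exact smul_mem _ _ (add_mem hxF hyF)
    · rw [hre]
      exact smul_mem _ _ (add_mem hxH hyH)

theorem gram_add_left (p q r : Fin 3 → ℝ) (s : ℝ) : gram (p + q) r s = gram p r s + gram q r s := by
  simp only [gram, Pi.add_apply]
  ring

theorem gram_smul_left (c : ℝ) (p q : Fin 3 → ℝ) (s : ℝ) : gram (c • p) q s = c * gram p q s := by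
  simp only [gram, Pi.smul_apply, smul_eq_mul]
  ring

theorem gram_add_right (p q r : Fin 3 → ℝ) (s : ℝ) :
    gram p (q + r) s = gram p q s + gram p r s := by
  simp only [gram, Pi.add_apply]
  ring

theorem gram_smul_right (c : ℝ) (p q : Fin 3 → ℝ) (s : ℝ) :
    gram p (c • q) s = c * gram p q s := by
  simp only [gram, Pi.smul_apply, smul_eq_mul]
  ring

theorem gram_comm (p q : Fin 3 → ℝ) (s : ℝ) : gram p q s = gram q p s := by
  simp only [gram]
  ring

theorem gram_eq_lift (p q : Fin 3 → ℝ) (s : ℝ) :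
    gram p q s = p 0 * lift q s 5 + p 1 * lift q s 4 + p 2 * lift q s 3 := by
  simp [gram, lift]
  ring

/-- Real vectors in `F₃(s₁), …, F₃(s₄)`, with `s₁ < ⋯ < s₄`, which are orthogonal to each other,
are linearly independent. -/
theorem coeff_eq_zero_of_gram {p1 p2 p3 p4 : Fin 3 → ℝ} {s1 s2 s3 s4 : ℝ} (h12 : s1 < s2)
    (h23 : s2 < s3) (h34 : s3 < s4) (hp1 : p1 ≠ 0) (hp2 : p2 ≠ 0) (hp3 : p3 ≠ 0) (hp4 : p4 ≠ 0)
    (g23 : gram p2 p3 s3 = gram p2 p3 s2) (g24 : gram p2 p4 s4 = gram p2 p4 s2)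
    (g34 : gram p3 p4 s4 = gram p3 p4 s3) {c1 c2 c3 c4 : ℝ}
    (h : c1 • lift p1 s1 + c2 • lift p2 s2 + c3 • lift p3 s3 + c4 • lift p4 s4 = 0) :
    c1 = 0 ∧ c2 = 0 ∧ c3 = 0 ∧ c4 = 0 := by
  have hp : c1 • p1 = -(c2 • p2 + (c3 • p3 + c4 • p4)) := by
    funext i
    fin_cases i
    · exact eq_neg_of_add_eq_zero_left (by simpa [lift, add_assoc] using congrFun h 0)
    · exact eq_neg_of_add_eq_zero_left (by simpa [lift, add_assoc] using congrFun h 1)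
    · exact eq_neg_of_add_eq_zero_left (by simpa [lift, add_assoc] using congrFun h 2)
  have hlin (p : Fin 3 → ℝ) : c1 * gram p p1 s1 + c2 * gram p p2 s2 + c3 * gram p p3 s3 +
      c4 * gram p p4 s4 = 0 := by
    have e3 := congrFun h 3
    have e4 := congrFun h 4
    have e5 := congrFun h 5
    simp only [Pi.add_apply, Pi.smul_apply, smul_eq_mul, Pi.zero_apply] at e3 e4 e5
    simp only [gram_eq_lift]
    linear_combination p 0 * e5 + p 1 * e4 + p 2 * e3
  obtain ⟨n2, z2⟩ := gram_mono (c2 • p2 + (c3 • p3 + c4 • p4)) h12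
  obtain ⟨n3, z3⟩ := gram_mono (c3 • p3 + c4 • p4) h23
  obtain ⟨n4, z4⟩ := gram_mono (c4 • p4) h34
  have h1 (p : Fin 3 → ℝ) : c1 * gram p p1 s1 =
      -(c2 * gram p p2 s1 + (c3 * gram p p3 s1 + c4 * gram p p4 s1)) := by
    have := congrArg (fun q => gram p q s1) hp
    rw [← neg_one_smul ℝ] at this
    simp only [gram_add_right, gram_smul_right] at this
    linear_combination this
  have key : (gram (c2 • p2 + (c3 • p3 + c4 • p4)) (c2 • p2 + (c3 • p3 + c4 • p4)) s2 -
        gram (c2 • p2 + (c3 • p3 + c4 • p4)) (c2 • p2 + (c3 • p3 + c4 • p4)) s1) +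
      (gram (c3 • p3 + c4 • p4) (c3 • p3 + c4 • p4) s3 -
        gram (c3 • p3 + c4 • p4) (c3 • p3 + c4 • p4) s2) +
      (gram (c4 • p4) (c4 • p4) s4 - gram (c4 • p4) (c4 • p4) s3) = 0 := by
    have l2 := hlin p2
    have l3 := hlin p3
    have l4 := hlin p4
    rw [h1] at l2 l3 l4
    simp only [gram_add_left, gram_smul_left, gram_add_right, gram_smul_right]
    simp only [gram_comm p3 p2, gram_comm p4 p2, gram_comm p4 p3] at l3 l4 ⊢
    linear_combination c2 * l2 + c3 * l3 + c4 * l4 - c2 * c3 * g23 - c2 * c4 * g24 - c3 * c4 * g34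
  have hr4 := z4 (by linarith)
  have hr3 := z3 (by linarith)
  have hr2 := z2 (by linarith)
  rw [hr3, add_zero] at hr2
  rw [hr4, add_zero] at hr3
  rw [hr2, hr3, hr4] at hp
  simp only [add_zero, neg_zero] at hp
  exact ⟨(smul_eq_zero.mp hp).resolve_right hp1, (smul_eq_zero.mp hr2).resolve_right hp2,
    (smul_eq_zero.mp hr3).resolve_right hp3, (smul_eq_zero.mp hr4).resolve_right hp4⟩

/-- An isotropic subspace of dimension at most three which meets `F₃(s)` for four real values of
`s` is not stable under complex conjugation. -/
theorem not_conjStableLC {H : Submodule ℂ (Fin (2 * 3) → ℂ)} (hH : Module.finrank ℂ H = 3)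
    (hi : ∀ x ∈ H, ∀ y ∈ H, formLC 3 x y = 0) {s : Fin 4 → ℝ} (hs : StrictMono s)
    (hm : ∀ j, H ⊓ oscLC 3 3 (s j : ℂ) ≠ ⊥) : ¬ conjStableLC 3 H := by
  intro hc
  choose p hp0 hp using fun j => exists_lift_mem hc (hm j)
  have g (i j : Fin 4) : gram (p i) (p j) (s j) = gram (p i) (p j) (s i) := by
    have := hi _ (hp i) _ (hp j)
    rw [formLC_lift] at this
    exact sub_eq_zero.mp (Complex.ofReal_eq_zero.mp this)
  have hdep : ¬ LinearIndependent ℂ (fun j => (⟨_, hp j⟩ : H)) := fun hl => by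
    have := hl.fintype_card_le_finrank
    simp [hH] at this
  rw [Fintype.not_linearIndependent_iff] at hdep
  obtain ⟨c, hc0, j, hj⟩ := hdep
  have hlt (i : Fin 3) : s i.castSucc < s i.succ := hs (Fin.castSucc_lt_succ)
  have key (d : Fin 4 → ℝ) (hd : ∀ k, ∑ i, d i * lift (p i) (s i) k = 0) : d j = 0 := by
    have := coeff_eq_zero_of_gram (hlt 0) (hlt 1) (hlt 2) (hp0 _) (hp0 _) (hp0 _) (hp0 _)
      (g _ _) (g _ _) (g _ _) (c1 := d 0) (c2 := d 1) (c3 := d 2) (c4 := d 3) (by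
        funext k
        simpa [Fin.sum_univ_four] using hd k)
    obtain ⟨d0, d1, d2, d3⟩ := this
    fin_cases j <;> assumption
  have hsum (k) : ∑ i, c i * (lift (p i) (s i) k : ℂ) = 0 := by
    have := congrFun (congrArg Subtype.val hc0) k
    simpa using this
  refine hj (Complex.ext (key (fun i => (c i).re) fun k => ?_)
    (key (fun i => (c i).im) fun k => ?_))
  · simpa using congrArg Complex.re (hsum k)
  · simpa using congrArg Complex.im (hsum k)

end Geometry

namespace Params

section Wronskian

variable {K : Type*} [Field K] [CharZero K] (p : Params K)

/-- The quartic whose roots are the four finite nonzero points. -/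
def quartic (t : K) : K := t ^ 4 + p.f3 * t ^ 3 + p.f2 * t ^ 2 + p.f1 * t + p.f0

/-- The part of the Wronskian coming from the vector with coordinates `a, b, c`. -/
def wronskianInfty (c t : K) : K :=
  p.f0 ^ 4 * p.a ^ 2 + 6 * p.f0 ^ 3 * p.a * p.b * t +
    (10 * p.f0 ^ 2 * p.a * c + 12 * p.f0 ^ 2 * p.b ^ 2) * t ^ 2 + 45 * p.f0 * p.b * c * t ^ 3 +
    45 * c ^ 2 * t ^ 4

/-- The part of the Wronskian coming from the vector with coordinates `A, B, C`. -/
def wronskianZero (A B C t : K) : K :=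
  45 * C ^ 2 + 45 * B * C * t + (12 * B ^ 2 + 10 * A * C) * t ^ 2 + 6 * A * B * t ^ 3 +
    A ^ 2 * t ^ 4

/-- The defects of the four incidence equations. -/
def defect (c A B C : K) : Fin 4 → K :=
  ![45 * p.f0 * p.b * c - 45 * C ^ 2 -
      (-(p.f0 * A ^ 2) + p.f1 * (p.g2 + 10 * p.f0 * p.a * c) + p.f2 * p.g1 + p.f3 * p.g0),
    45 * c ^ 2 - 45 * B * C -
      (-(p.f1 * A ^ 2) + p.f2 * (p.g2 + 10 * p.f0 * p.a * c) + p.f3 * p.g1 + p.g0),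
    -(12 * B ^ 2 + 10 * A * C) -
      (-(p.f2 * A ^ 2) + p.f3 * (p.g2 + 10 * p.f0 * p.a * c) + p.g1),
    -(6 * A * B) - (-(p.f3 * A ^ 2) + (p.g2 + 10 * p.f0 * p.a * c))]

variable {p}

theorem sol_iff_defect {c A B C : K} (he : p.e = -1) :
    p.Sol c A B C ↔ p.defect c A B C = 0 ∧
      2 * p.f0 ^ 2 * p.a * A - 9 * p.f0 * p.b * B + 45 * c * C = 0 := by
  constructor
  · rintro ⟨hV, hS, hN, hM, horth⟩
    simp only [Params.rowV, Params.rowS, Params.rowN, Params.rowM, Row.dot, Row.monomials, he]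
      at hV hS hN hM
    refine ⟨funext fun i => ?_, horth⟩
    fin_cases i <;> simp [defect]
    · linear_combination hM / 4
    · linear_combination hN / 4
    · linear_combination hS / 15
    · linear_combination hV / 30
  · rintro ⟨h, horth⟩
    have hM := congrFun h 0
    have hN := congrFun h 1
    have hS := congrFun h 2
    have hV := congrFun h 3
    simp [defect] at hM hN hS hV
    constructor
    · simp only [Params.rowV, Row.dot, Row.monomials, he]
      linear_combination 30 * hV
    · simp only [Params.rowS, Row.dot, Row.monomials, he]
      linear_combination 15 * hS
    · simp only [Params.rowN, Row.dot, Row.monomials, he]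
      linear_combination 4 * hN
    · simp only [Params.rowM, Row.dot, Row.monomials, he]
      linear_combination 4 * hM
    · exact horth

theorem wronskian_eq {F : Type*} [Field F] {p : Params F} (he : p.e = -1) (c A B C t : F) :
    p.wronskianInfty c t - t ^ 3 * wronskianZero A B C t =
      p.quartic t * (p.g0 + p.g1 * t + (p.g2 + 10 * p.f0 * p.a * c) * t ^ 2 - A ^ 2 * t ^ 3) +
        t ^ 3 * ∑ i : Fin 4, t ^ (i : ℕ) * p.defect c A B C i := by
  simp [Fin.sum_univ_four, defect, wronskianInfty, wronskianZero, quartic, g0, g1, g2, he]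
  ring

theorem Sol.wronskian_eq_zero {c A B C : K} (h : p.Sol c A B C) (he : p.e = -1) {t : K}
    (ht : p.quartic t = 0) : p.wronskianInfty c t - t ^ 3 * wronskianZero A B C t = 0 := by
  rw [wronskian_eq he, ht, ((sol_iff_defect he).mp h).1]
  simp

theorem Sol.of_wronskian {c A B C : K} (he : p.e = -1) {t : Fin 4 → K} (ht : t.Injective)
    (ht0 : ∀ j, t j ≠ 0) (hq : ∀ j, p.quartic (t j) = 0)
    (hw : ∀ j, p.wronskianInfty c (t j) - t j ^ 3 * wronskianZero A B C (t j) = 0)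
    (horth : 2 * p.f0 ^ 2 * p.a * A - 9 * p.f0 * p.b * B + 45 * c * C = 0) : p.Sol c A B C := by
  refine (sol_iff_defect he).mpr
    ⟨Matrix.eq_zero_of_forall_index_sum_pow_mul_eq_zero ht fun j => ?_, horth⟩
  have := hw j
  rw [wronskian_eq he, hq, zero_mul, zero_add] at this
  exact (mul_eq_zero.mp this).resolve_left (pow_ne_zero 3 (ht0 j))

/-- If the first part of the Wronskian vanishes at the roots of a regular quartic, then
it is zero. -/
theorem eq_zero_of_wronskianInfty {c : K} (hl : p.f1 * (3 * p.f0 * p.f2 - p.f1 ^ 2) -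
    4 * p.f0 ^ 2 * p.f3 ≠ 0) (h0 : p.f0 ≠ 0) {t : Fin 4 → K} (ht : t.Injective)
    (hq : ∀ j, p.quartic (t j) = 0) (hw : ∀ j, p.wronskianInfty c (t j) = 0) :
    p.a = 0 ∧ p.b = 0 ∧ c = 0 := by
  have key := Matrix.eq_zero_of_forall_index_sum_pow_mul_eq_zero
    (v := ![p.f0 ^ 4 * p.a ^ 2 - 45 * c ^ 2 * p.f0, 6 * p.f0 ^ 3 * p.a * p.b - 45 * c ^ 2 * p.f1,
      10 * p.f0 ^ 2 * p.a * c + 12 * p.f0 ^ 2 * p.b ^ 2 - 45 * c ^ 2 * p.f2,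
      45 * p.f0 * p.b * c - 45 * c ^ 2 * p.f3]) ht fun j => by
    simp [Fin.sum_univ_four]
    have h1 := hw j
    have h2 := hq j
    simp only [wronskianInfty, quartic] at h1 h2
    linear_combination h1 - 45 * c ^ 2 * h2
  have k0 : p.f0 ^ 4 * p.a ^ 2 - 45 * c ^ 2 * p.f0 = 0 := congrFun key 0
  have k1 : 6 * p.f0 ^ 3 * p.a * p.b - 45 * c ^ 2 * p.f1 = 0 := congrFun key 1
  have k2 : 10 * p.f0 ^ 2 * p.a * c + 12 * p.f0 ^ 2 * p.b ^ 2 - 45 * c ^ 2 * p.f2 = 0 :=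
    congrFun key 2
  have k3 : 45 * p.f0 * p.b * c - 45 * c ^ 2 * p.f3 = 0 := congrFun key 3
  by_cases hc : c = 0
  · simp [hc, h0] at k0 k2
    simp_all
  · have ha : p.a ≠ 0 := fun ha => by simp [ha, hc, h0] at k0
    have e0 : p.f0 ^ 3 * p.a ^ 2 = 45 * c ^ 2 := mul_left_cancel₀ h0 (by linear_combination k0)
    have e1 : 6 * p.b = p.f1 * p.a := by
      refine mul_left_cancel₀ (mul_ne_zero (pow_ne_zero 3 h0) ha) ?_
      linear_combination k1 - p.f1 * e0
    have e2 : 30 * c = p.a * (3 * p.f0 * p.f2 - p.f1 ^ 2) := by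
      refine mul_left_cancel₀ (mul_ne_zero (pow_ne_zero 2 h0) ha) ?_
      linear_combination 3 * k2 - 3 * p.f2 * e0 - p.f0 ^ 2 * (6 * p.b + p.f1 * p.a) * e1
    have e3 : p.f0 * p.b = c * p.f3 :=
      mul_left_cancel₀ (mul_ne_zero (by norm_num : (45 : K) ≠ 0) hc) (by linear_combination k3)
    refine absurd (mul_left_cancel₀ (mul_ne_zero ha hc) ?_) hl
    linear_combination -p.f1 * c * e2 + 4 * p.f0 ^ 2 * p.a * e3 - 2 / 3 * k1

/-- If the second part of the Wronskian vanishes at the roots of a regular quartic, then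
it is zero. -/
theorem eq_zero_of_wronskianZero {A B C : K}
    (hr : p.f3 * (3 * p.f2 - p.f3 ^ 2) - 4 * p.f1 ≠ 0) {t : Fin 4 → K} (ht : t.Injective)
    (hq : ∀ j, p.quartic (t j) = 0) (hw : ∀ j, wronskianZero A B C (t j) = 0) :
    A = 0 ∧ B = 0 ∧ C = 0 := by
  have key := Matrix.eq_zero_of_forall_index_sum_pow_mul_eq_zero
    (v := ![45 * C ^ 2 - A ^ 2 * p.f0, 45 * B * C - A ^ 2 * p.f1,
      12 * B ^ 2 + 10 * A * C - A ^ 2 * p.f2, 6 * A * B - A ^ 2 * p.f3]) ht fun j => by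
    simp [Fin.sum_univ_four]
    have h1 := hw j
    have h2 := hq j
    simp only [wronskianZero, quartic] at h1 h2
    linear_combination h1 - A ^ 2 * h2
  have k0 : 45 * C ^ 2 - A ^ 2 * p.f0 = 0 := congrFun key 0
  have k1 : 45 * B * C - A ^ 2 * p.f1 = 0 := congrFun key 1
  have k2 : 12 * B ^ 2 + 10 * A * C - A ^ 2 * p.f2 = 0 := congrFun key 2
  have k3 : 6 * A * B - A ^ 2 * p.f3 = 0 := congrFun key 3
  by_cases hA : A = 0
  · simp [hA] at k0 k2
    simp_all
  · have e1 : 6 * B = A * p.f3 := mul_left_cancel₀ hA (by linear_combination k3)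
    have e2 : 30 * C = A * (3 * p.f2 - p.f3 ^ 2) := by
      refine mul_left_cancel₀ hA ?_
      linear_combination 3 * k2 - (6 * B + A * p.f3) * e1
    refine absurd (mul_left_cancel₀ (pow_ne_zero 2 hA) ?_) hr
    linear_combination -p.f3 * A * e2 - 30 * C * e1 + 4 * k1

end Wronskian

end Params

namespace Geometry

open Submodule

/-- The alternating form on quintic polynomials, given by their coefficients. -/
def omega (u w : Fin 6 → ℂ) : ℂ :=
  10 * u 0 * w 5 - 2 * u 1 * w 4 + u 2 * w 3 - u 3 * w 2 + 2 * u 4 * w 1 - 10 * u 5 * w 0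

/-- The value and the first two derivatives at `t` of the quintic with coefficients `u`. -/
def jet (u : Fin 6 → ℂ) (t : ℂ) : Fin 3 → ℂ :=
  ![u 0 + u 1 * t + u 2 * t ^ 2 + u 3 * t ^ 3 + u 4 * t ^ 4 + u 5 * t ^ 5,
    u 1 + 2 * u 2 * t + 3 * u 3 * t ^ 2 + 4 * u 4 * t ^ 3 + 5 * u 5 * t ^ 4,
    2 * u 2 + 6 * u 3 * t + 12 * u 4 * t ^ 2 + 20 * u 5 * t ^ 3]

theorem jet_combination (α β γ : ℂ) (v w z : Fin 6 → ℂ) (t : ℂ) :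
    jet (α • v + β • w + γ • z) t = α • jet v t + β • jet w t + γ • jet z t := by
  funext i
  fin_cases i <;> simp [jet] <;> ring

theorem exists_cross_eq {w0 w1 w2 l0 l1 l2 : ℂ} (hw : w0 ≠ 0 ∨ w1 ≠ 0 ∨ w2 ≠ 0)
    (ho : w0 * l0 + w1 * l1 + w2 * l2 = 0) :
    ∃ x0 x1 x2, x1 * w2 - x2 * w1 = l0 ∧ x2 * w0 - x0 * w2 = l1 ∧ x0 * w1 - x1 * w0 = l2 := by
  rcases hw with h | h | h
  · refine ⟨0, -l2 / w0, l1 / w0, ?_, ?_, ?_⟩ <;> field_simp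
    · linear_combination -ho
    · ring
    · ring
  · refine ⟨l2 / w1, 0, -l0 / w1, ?_, ?_, ?_⟩ <;> field_simp
    · ring
    · linear_combination -ho
    · ring
  · refine ⟨-l1 / w2, l0 / w2, 0, ?_, ?_, ?_⟩ <;> field_simp
    · ring
    · ring
    · linear_combination -ho

theorem exists_cross_eq_smul {w0 w1 w2 x0 x1 x2 l0 l1 l2 : ℂ} (hl : l0 ≠ 0 ∨ l1 ≠ 0 ∨ l2 ≠ 0)
    (hw : w0 * l0 + w1 * l1 + w2 * l2 = 0) (hx : x0 * l0 + x1 * l1 + x2 * l2 = 0) :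
    ∃ m, x1 * w2 - x2 * w1 = m * l0 ∧ x2 * w0 - x0 * w2 = m * l1 ∧ x0 * w1 - x1 * w0 = m * l2 := by
  rcases hl with h | h | h
  · refine ⟨(x1 * w2 - x2 * w1) / l0, ?_, ?_, ?_⟩ <;> field_simp
    · linear_combination x2 * hw - w2 * hx
    · linear_combination w1 * hx - x1 * hw
  · refine ⟨(x2 * w0 - x0 * w2) / l1, ?_, ?_, ?_⟩ <;> field_simp
    · linear_combination w2 * hx - x2 * hw
    · linear_combination x0 * hw - w0 * hx
  · refine ⟨(x0 * w1 - x1 * w0) / l2, ?_, ?_, ?_⟩ <;> field_simp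
    · linear_combination x1 * hw - w1 * hx
    · linear_combination w0 * hx - x0 * hw

theorem exists_eq_smul_of_cross {w0 w1 w2 x0 x1 x2 : ℂ} (hw : w0 ≠ 0 ∨ w1 ≠ 0 ∨ w2 ≠ 0)
    (h0 : x1 * w2 - x2 * w1 = 0) (h1 : x2 * w0 - x0 * w2 = 0) (h2 : x0 * w1 - x1 * w0 = 0) :
    ∃ m, x0 = m * w0 ∧ x1 = m * w1 ∧ x2 = m * w2 := by
  rcases hw with h | h | h
  · refine ⟨x0 / w0, ?_, ?_, ?_⟩ <;> field_simp
    · linear_combination -h2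
    · linear_combination h1
  · refine ⟨x1 / w1, ?_, ?_, ?_⟩ <;> field_simp
    · linear_combination h2
    · linear_combination -h0
  · refine ⟨x2 / w2, ?_, ?_, ?_⟩ <;> field_simp
    · linear_combination -h1
    · linear_combination h0

/-- Nonzero orthogonal vectors supported at the end and at the beginning. -/
structure PreFrame (v w : Fin 6 → ℂ) : Prop where
  v0 : v 0 = 0
  v1 : v 1 = 0
  v2 : v 2 = 0
  w3 : w 3 = 0
  w4 : w 4 = 0
  w5 : w 5 = 0
  v_ne_zero : v ≠ 0
  w_ne_zero : w ≠ 0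
  orth : omega v w = 0

namespace PreFrame

variable {v w : Fin 6 → ℂ}

theorem v_cases (h : PreFrame v w) : v 3 ≠ 0 ∨ v 4 ≠ 0 ∨ v 5 ≠ 0 := by
  by_contra! hv
  obtain ⟨h3, h4, h5⟩ := hv
  refine h.v_ne_zero (funext fun i => ?_)
  fin_cases i
  exacts [h.v0, h.v1, h.v2, h3, h4, h5]

theorem w_cases (h : PreFrame v w) : w 0 ≠ 0 ∨ w 1 ≠ 0 ∨ w 2 ≠ 0 := by
  by_contra! hw
  obtain ⟨h0, h1, h2⟩ := hw
  refine h.w_ne_zero (funext fun i => ?_)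
  fin_cases i
  exacts [h0, h1, h2, h.w3, h.w4, h.w5]

theorem orth_eq (h : PreFrame v w) : -(v 3 * w 2) + 2 * v 4 * w 1 - 10 * v 5 * w 0 = 0 := by
  simpa [omega, h.v0, h.v1, h.v2] using h.orth

end PreFrame

/-- Two vectors supported at the end and at the beginning, and a third one which spans a
Lagrangian subspace together with them. -/
structure Frame (v w z : Fin 6 → ℂ) (μ ν : ℂ) : Prop extends PreFrame v w where
  x0 : z 1 * w 2 - z 2 * w 1 = μ * (10 * v 5)
  x1 : z 2 * w 0 - z 0 * w 2 = μ * (-2 * v 4)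
  x2 : z 0 * w 1 - z 1 * w 0 = μ * v 3
  y3 : z 4 * v 5 - z 5 * v 4 = ν * w 2
  y4 : z 5 * v 3 - z 3 * v 5 = ν * (-2 * w 1)
  y5 : z 3 * v 4 - z 4 * v 3 = ν * (10 * w 0)

theorem PreFrame.exists_frame {v w : Fin 6 → ℂ} (h : PreFrame v w) : ∃ z, Frame v w z 1 1 := by
  obtain ⟨x0, x1, x2, h0, h1, h2⟩ := exists_cross_eq (l0 := 10 * v 5) (l1 := -2 * v 4) (l2 := v 3)
    h.w_cases (by linear_combination -h.orth_eq)
  obtain ⟨x3, x4, x5, h3, h4, h5⟩ := exists_cross_eq (l0 := w 2) (l1 := -2 * w 1) (l2 := 10 * w 0)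
    h.v_cases (by linear_combination -h.orth_eq)
  exact ⟨![x0, x1, x2, x3, x4, x5], h, by simpa using h0, by simpa using h1, by simpa using h2,
    by simpa using h3, by simpa using h4, by simpa using h5⟩

theorem PreFrame.exists_frame_of_omega {v w z : Fin 6 → ℂ} (h : PreFrame v w)
    (hv : omega z v = 0) (hw : omega z w = 0) : ∃ μ ν, Frame v w z μ ν := by
  simp only [omega, h.v0, h.v1, h.v2] at hv
  simp only [omega, h.w3, h.w4, h.w5] at hw
  obtain ⟨μ, h0, h1, h2⟩ := exists_cross_eq_smul (w0 := w 0) (w1 := w 1) (w2 := w 2) (x0 := z 0)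
    (x1 := z 1) (x2 := z 2) (l0 := 10 * v 5) (l1 := -2 * v 4) (l2 := v 3)
    (by have := h.v_cases; simpa [or_comm, or_assoc, or_left_comm] using this)
    (by linear_combination -h.orth_eq) (by linear_combination hv)
  obtain ⟨ν, h3, h4, h5⟩ := exists_cross_eq_smul (w0 := v 3) (w1 := v 4) (w2 := v 5) (x0 := z 3)
    (x1 := z 4) (x2 := z 5) (l0 := w 2) (l1 := -2 * w 1) (l2 := 10 * w 0)
    (by have := h.w_cases; simpa [or_comm, or_assoc, or_left_comm] using this)
    (by linear_combination -h.orth_eq) (by linear_combination -hw)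
  exact ⟨μ, ν, h, h0, h1, h2, h3, h4, h5⟩

namespace Frame

variable {v w z z' : Fin 6 → ℂ} {μ ν : ℂ}

theorem mem_span_of_sub (h : Frame v w z 0 0) : z ∈ span ℂ {v, w} := by
  obtain ⟨β, h0, h1, h2⟩ := exists_eq_smul_of_cross h.w_cases (by simpa using h.x0)
    (by simpa using h.x1) (by simpa using h.x2)
  obtain ⟨α, h3, h4, h5⟩ := exists_eq_smul_of_cross h.v_cases (by simpa using h.y3)
    (by simpa using h.y4) (by simpa using h.y5)
  refine mem_span_pair.mpr ⟨α, β, funext fun i => ?_⟩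
  fin_cases i <;>
    simp [h.v0, h.v1, h.v2, h.w3, h.w4, h.w5, h0, h1, h2, h3, h4, h5]

theorem sub (h : Frame v w z μ ν) (h' : Frame v w z' μ ν) : Frame v w (z - z') 0 0 := by
  refine ⟨h.toPreFrame, ?_, ?_, ?_, ?_, ?_, ?_⟩ <;> simp only [Pi.sub_apply]
  · linear_combination h.x0 - h'.x0
  · linear_combination h.x1 - h'.x1
  · linear_combination h.x2 - h'.x2
  · linear_combination h.y3 - h'.y3
  · linear_combination h.y4 - h'.y4
  · linear_combination h.y5 - h'.y5

/-- A frame is isotropic. -/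
theorem omega_left (h : Frame v w z μ ν) (hμ : μ ≠ 0) : omega z v = 0 := by
  refine mul_left_cancel₀ hμ ?_
  simp only [omega, h.v0, h.v1, h.v2]
  linear_combination -z 0 * h.x0 - z 1 * h.x1 - z 2 * h.x2

theorem omega_right (h : Frame v w z μ ν) (hν : ν ≠ 0) : omega z w = 0 := by
  refine mul_left_cancel₀ hν ?_
  simp only [omega, h.w3, h.w4, h.w5]
  linear_combination z 3 * h.y3 + z 4 * h.y4 + z 5 * h.y5

theorem neg (h : Frame v w z μ ν) : Frame v (-w) (-z) μ ν where
  v0 := h.v0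
  v1 := h.v1
  v2 := h.v2
  w3 := by simp [h.w3]
  w4 := by simp [h.w4]
  w5 := by simp [h.w5]
  v_ne_zero := h.v_ne_zero
  w_ne_zero := neg_ne_zero.mpr h.w_ne_zero
  orth := by
    have := h.orth
    simp only [omega, Pi.neg_apply] at this ⊢
    linear_combination -this
  x0 := by
    simp only [Pi.neg_apply]
    linear_combination h.x0
  x1 := by
    simp only [Pi.neg_apply]
    linear_combination h.x1
  x2 := by
    simp only [Pi.neg_apply]
    linear_combination h.x2
  y3 := by
    simp only [Pi.neg_apply]
    linear_combination -h.y3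
  y4 := by
    simp only [Pi.neg_apply]
    linear_combination -h.y4
  y5 := by
    simp only [Pi.neg_apply]
    linear_combination -h.y5

/-- A frame can be rescaled. -/
theorem smul (h : Frame v w z μ ν) {α β : ℂ} (hα : α ≠ 0) (hβ : β ≠ 0) (γ : ℂ) :
    Frame (α • v) (β • w) (γ • z) (γ * μ * β / α) (γ * ν * α / β) where
  v0 := by simp [h.v0]
  v1 := by simp [h.v1]
  v2 := by simp [h.v2]
  w3 := by simp [h.w3]
  w4 := by simp [h.w4]
  w5 := by simp [h.w5]
  v_ne_zero := smul_ne_zero hα h.v_ne_zero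
  w_ne_zero := smul_ne_zero hβ h.w_ne_zero
  orth := by
    have := h.orth
    simp only [omega, Pi.smul_apply, smul_eq_mul] at this ⊢
    linear_combination α * β * this
  x0 := by
    simp only [Pi.smul_apply, smul_eq_mul]
    field_simp
    linear_combination γ * h.x0
  x1 := by
    simp only [Pi.smul_apply, smul_eq_mul]
    field_simp
    linear_combination γ * h.x1
  x2 := by
    simp only [Pi.smul_apply, smul_eq_mul]
    field_simp
    linear_combination γ * h.x2
  y3 := by
    simp only [Pi.smul_apply, smul_eq_mul]
    field_simp
    linear_combination γ * h.y3
  y4 := by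
    simp only [Pi.smul_apply, smul_eq_mul]
    field_simp
    linear_combination γ * h.y4
  y5 := by
    simp only [Pi.smul_apply, smul_eq_mul]
    field_simp
    linear_combination γ * h.y5

theorem coeff_eq_zero (h : Frame v w z μ ν) (hμ : μ ≠ 0) {α β γ : ℂ}
    (h0 : α • v + β • w + γ • z = 0) : α = 0 ∧ β = 0 ∧ γ = 0 := by
  have e (i) : α * v i + β * w i + γ * z i = 0 := congrFun h0 i
  have e0 := e 0
  have e1 := e 1
  have e2 := e 2
  rw [h.v0] at e0
  rw [h.v1] at e1
  rw [h.v2] at e2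
  have hγ : γ = 0 := by
    rcases h.v_cases with h3 | h3 | h3
    · refine (mul_eq_zero.mp (?_ : γ * (μ * v 3) = 0)).resolve_right (mul_ne_zero hμ h3)
      rw [← h.x2]
      linear_combination w 1 * e0 - w 0 * e1
    · refine (mul_eq_zero.mp (?_ : γ * (μ * (-2 * v 4)) = 0)).resolve_right
        (mul_ne_zero hμ (mul_ne_zero (by norm_num) h3))
      rw [← h.x1]
      linear_combination w 0 * e2 - w 2 * e0
    · refine (mul_eq_zero.mp (?_ : γ * (μ * (10 * v 5)) = 0)).resolve_right
        (mul_ne_zero hμ (mul_ne_zero (by norm_num) h3))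
      rw [← h.x0]
      linear_combination w 2 * e1 - w 1 * e2
  subst hγ
  have hβ : β = 0 := by
    simp at e0 e1 e2
    rcases h.w_cases with h3 | h3 | h3 <;> simp_all
  subst hβ
  simp only [zero_smul, add_zero] at h0
  exact ⟨(smul_eq_zero.mp h0).resolve_right h.v_ne_zero, rfl, rfl⟩

theorem linearIndependent (h : Frame v w z μ ν) (hμ : μ ≠ 0) :
    LinearIndependent ℂ ![v, w, z] := by
  rw [Fintype.linearIndependent_iff]
  intro g hg
  simp only [Fin.sum_univ_three, Matrix.cons_val] at hg
  obtain ⟨h0, h1, h2⟩ := h.coeff_eq_zero hμ hg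
  intro i
  fin_cases i <;> assumption

/-- The Wronskian of the three quintics of a frame. -/
theorem wronskian_eq (h : Frame v w z μ ν) (t : ℂ) :
    (Matrix.of ![jet v t, jet w t, jet z t]).det = -24 * t *
      (μ * (v 3 ^ 2 / 4 + v 3 * v 4 * t + (5 * v 3 * v 5 + 4 * v 4 ^ 2) / 3 * t ^ 2 +
          5 * v 4 * v 5 * t ^ 3 + 5 * v 5 ^ 2 * t ^ 4) -
        ν * t ^ 3 * (5 * w 0 ^ 2 + 5 * w 0 * w 1 * t + (5 * w 0 * w 2 + 4 * w 1 ^ 2) / 3 * t ^ 2 +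
          w 1 * w 2 * t ^ 3 + w 2 ^ 2 / 4 * t ^ 4)) := by
  obtain ⟨⟨v0, v1, v2, w3, w4, w5, -, -, -⟩, x0, x1, x2, y3, y4, y5⟩ := h
  simp [Matrix.det_fin_three, jet, v0, v1, v2, w3, w4, w5]
  linear_combination
    -(2 * v 3 * t ^ 3 + 6 * v 4 * t ^ 4 + 12 * v 5 * t ^ 5) * x0 +
    (6 * v 3 * t ^ 2 + 16 * v 4 * t ^ 3 + 30 * v 5 * t ^ 4) * x1 -
    (6 * v 3 * t + 12 * v 4 * t ^ 2 + 20 * v 5 * t ^ 3) * x2 +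
    (20 * w 0 * t ^ 6 + 12 * w 1 * t ^ 7 + 6 * w 2 * t ^ 8) * y3 -
    (30 * w 0 * t ^ 5 + 16 * w 1 * t ^ 6 + 6 * w 2 * t ^ 7) * y4 +
    (12 * w 0 * t ^ 4 + 6 * w 1 * t ^ 5 + 2 * w 2 * t ^ 6) * y5

end Frame

end Geometry

namespace Geometry

open Submodule

/-- The Lagrangian subspaces meeting the osculating spaces at `0`, at `∞` and at four further
points `t j`, in terms of quintic polynomials. -/
def problem (t : Fin 4 → ℂ) : Set (Submodule ℂ (Fin 6 → ℂ)) :=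
  {H | Module.finrank ℂ H = 3 ∧ (∀ x ∈ H, ∀ y ∈ H, omega x y = 0) ∧
    (∃ w ∈ H, w ≠ 0 ∧ w 3 = 0 ∧ w 4 = 0 ∧ w 5 = 0) ∧
    (∃ v ∈ H, v ≠ 0 ∧ v 0 = 0 ∧ v 1 = 0 ∧ v 2 = 0) ∧ ∀ j, ∃ x ∈ H, x ≠ 0 ∧ jet x (t j) = 0}

theorem mem_span_range_three {v w z x : Fin 6 → ℂ} :
    x ∈ span ℂ (Set.range ![v, w, z]) ↔ ∃ α β γ : ℂ, α • v + β • w + γ • z = x := by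
  rw [mem_span_range_iff_exists_fun]
  simp only [Fin.sum_univ_three, Matrix.cons_val]
  constructor
  · rintro ⟨c, hc⟩
    exact ⟨_, _, _, hc⟩
  · rintro ⟨α, β, γ, h⟩
    exact ⟨![α, β, γ], h⟩

theorem eq_span_of_linearIndependent {H : Submodule ℂ (Fin 6 → ℂ)} (hH : Module.finrank ℂ H = 3)
    {v w z : Fin 6 → ℂ} (hl : LinearIndependent ℂ ![v, w, z]) (hv : v ∈ H) (hw : w ∈ H)
    (hz : z ∈ H) : H = span ℂ (Set.range ![v, w, z]) := by
  refine (eq_of_le_of_finrank_eq ?_ ?_).symm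
  · rw [span_le]
    rintro - ⟨i, rfl⟩
    fin_cases i <;> assumption
  · rw [finrank_span_eq_card hl, hH]
    rfl

/-- The span of three linearly independent quintics contains one with a triple root at `t` if and
only if their Wronskian vanishes there. -/
theorem exists_jet_eq_zero_iff {v w z : Fin 6 → ℂ} (hl : LinearIndependent ℂ ![v, w, z]) (t : ℂ) :
    (∃ x ∈ span ℂ (Set.range ![v, w, z]), x ≠ 0 ∧ jet x t = 0) ↔
      (Matrix.of ![jet v t, jet w t, jet z t]).det = 0 := by
  rw [← Matrix.exists_vecMul_eq_zero_iff]
  have key (g : Fin 3 → ℂ) : Matrix.vecMul g (Matrix.of ![jet v t, jet w t, jet z t]) =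
      jet (g 0 • v + g 1 • w + g 2 • z) t := by
    rw [jet_combination, Matrix.vecMul_eq_sum]
    simp only [Fin.sum_univ_three]
    rfl
  constructor
  · rintro ⟨x, hx, hx0, hj⟩
    obtain ⟨α, β, γ, rfl⟩ := mem_span_range_three.mp hx
    refine ⟨![α, β, γ], fun h => hx0 ?_, (key _).trans hj⟩
    have h0 : α = 0 := congrFun h 0
    have h1 : β = 0 := congrFun h 1
    have h2 : γ = 0 := congrFun h 2
    simp [h0, h1, h2]
  · rintro ⟨g, hg, hj⟩
    refine ⟨g 0 • v + g 1 • w + g 2 • z, mem_span_range_three.mpr ⟨_, _, _, rfl⟩, fun h => hg ?_,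
      (key g).symm.trans hj⟩
    rw [Fintype.linearIndependent_iff] at hl
    exact funext (hl g (by simpa [Fin.sum_univ_three] using h))

theorem Frame.mem_problem {v w z : Fin 6 → ℂ} {t : Fin 4 → ℂ} (h : Frame v w z 1 1)
    (ht : ∀ j, (Matrix.of ![jet v (t j), jet w (t j), jet z (t j)]).det = 0) :
    span ℂ (Set.range ![v, w, z]) ∈ problem t := by
  have hl := h.linearIndependent one_ne_zero
  refine ⟨finrank_span_eq_card hl, ?_, ⟨w, subset_span ⟨1, rfl⟩, h.w_ne_zero, h.w3, h.w4, h.w5⟩,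
    ⟨v, subset_span ⟨0, rfl⟩, h.v_ne_zero, h.v0, h.v1, h.v2⟩, fun j =>
      (exists_jet_eq_zero_iff hl _).mpr (ht j)⟩
  intro x hx y hy
  obtain ⟨α, β, γ, rfl⟩ := mem_span_range_three.mp hx
  obtain ⟨α', β', γ', rfl⟩ := mem_span_range_three.mp hy
  have h1 := h.orth
  have h2 := h.omega_left one_ne_zero
  have h3 := h.omega_right one_ne_zero
  simp only [omega, Pi.add_apply, Pi.smul_apply, smul_eq_mul] at h1 h2 h3 ⊢
  linear_combination (α * β' - β * α') * h1 + (γ * α' - α * γ') * h2 + (γ * β' - β * γ') * h3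

/-- A solution of the incidence problem has a frame. -/
theorem exists_frame_of_mem_problem {t : Fin 4 → ℂ} {H : Submodule ℂ (Fin 6 → ℂ)}
    (hH : H ∈ problem t) : ∃ v w z μ ν, v ∈ H ∧ w ∈ H ∧ z ∈ H ∧ Frame v w z μ ν ∧
      (μ ≠ 0 ∨ ν ≠ 0) ∧ ∀ j, (Matrix.of ![jet v (t j), jet w (t j), jet z (t j)]).det = 0 := by
  obtain ⟨hf, ho, ⟨w, hw, hw0, w3, w4, w5⟩, ⟨v, hv, hv0, v0, v1, v2⟩, ht⟩ := hH
  have hp : PreFrame v w := ⟨v0, v1, v2, w3, w4, w5, hv0, hw0, ho v hv w hw⟩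
  obtain ⟨z, hz, hz'⟩ : ∃ z ∈ H, z ∉ span ℂ {v, w} := by
    by_contra! hc
    have h1 := finrank_mono (show H ≤ span ℂ {v, w} from hc)
    have h2 : Module.finrank ℂ (span ℂ ({v, w} : Set (Fin 6 → ℂ))) ≤ 2 := by
      classical
      have := finrank_span_finset_le_card (R := ℂ) ({v, w} : Finset (Fin 6 → ℂ))
      rw [Finset.coe_pair] at this
      exact this.trans Finset.card_le_two
    omega
  obtain ⟨μ, ν, h⟩ := hp.exists_frame_of_omega (ho z hz v hv) (ho z hz w hw)
  have hl : LinearIndependent ℂ ![v, w, z] := by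
    have hvw : LinearIndependent ℂ ![v, w] := by
      refine LinearIndependent.pair_iff.mpr fun α β hαβ => ?_
      have e (i) : α * v i + β * w i = 0 := congrFun hαβ i
      have hα : α • v = 0 := by
        funext i
        have := e i
        fin_cases i <;> simp_all
      rw [hα, zero_add] at hαβ
      exact ⟨(smul_eq_zero.mp hα).resolve_right hv0, (smul_eq_zero.mp hαβ).resolve_right hw0⟩
    have := linearIndependent_finSnoc.mpr
      ⟨hvw, (by rwa [Matrix.range_cons_cons_empty] : z ∉ span ℂ (Set.range ![v, w]))⟩
    rwa [show Fin.snoc ![v, w] z = ![v, w, z] by funext i; fin_cases i <;> rfl] at this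
  refine ⟨v, w, z, μ, ν, hv, hw, hz, h, ?_, fun j => (exists_jet_eq_zero_iff hl _).mp ?_⟩
  · by_contra! hc
    rw [hc.1, hc.2] at h
    exact hz' h.mem_span_of_sub
  · rw [← eq_span_of_linearIndependent hf hl hv hw hz]
    exact ht j

end Geometry

namespace Geometry

open Submodule

theorem Frame.eq_span {H : Submodule ℂ (Fin 6 → ℂ)} {v w z : Fin 6 → ℂ} {μ ν : ℂ}
    (h : Frame v w z μ ν) (hμ : μ ≠ 0) (hH : Module.finrank ℂ H = 3) (hv : v ∈ H) (hw : w ∈ H)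
    (hz : z ∈ H) : H = span ℂ (Set.range ![v, w, z]) :=
  eq_span_of_linearIndependent hH (h.linearIndependent hμ) hv hw hz

section Sol

variable {f0 f1 f2 f3 a b : ℂ} {t : Fin 4 → ℂ} {v w z : Fin 6 → ℂ} {μ ν : ℂ}

theorem Frame.wronskian_eq_params (h : Frame v w z μ ν) (hv3 : v 3 = 2 * f0 ^ 2 * a)
    (hv4 : v 4 = 3 * f0 * b) (s : ℂ) : (Matrix.of ![jet v s, jet w s, jet z s]).det = -24 * s *
      (μ * (⟨f0, f1, f2, f3, a, b, -1⟩ : Params ℂ).wronskianInfty (v 5 / 3) s -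
        ν * s ^ 3 * Params.wronskianZero (w 2 / 2) (w 1 / 3) (w 0 / 3) s) := by
  rw [h.wronskian_eq, hv3, hv4, Params.wronskianInfty, Params.wronskianZero]
  ring

theorem Frame.sol (h : Frame v w z 1 1) (ht : t.Injective) (ht0 : ∀ j, t j ≠ 0)
    (hq : ∀ j, t j ^ 4 + f3 * t j ^ 3 + f2 * t j ^ 2 + f1 * t j + f0 = 0)
    (hd : ∀ j, (Matrix.of ![jet v (t j), jet w (t j), jet z (t j)]).det = 0)
    (hv3 : v 3 = 2 * f0 ^ 2 * a) (hv4 : v 4 = 3 * f0 * b) :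
    (⟨f0, f1, f2, f3, a, b, -1⟩ : Params ℂ).Sol (v 5 / 3) (w 2 / 2) (w 1 / 3) (w 0 / 3) := by
  refine Params.Sol.of_wronskian rfl ht ht0 hq (fun j => ?_) ?_
  · have := hd j
    rw [h.wronskian_eq_params (f1 := f1) (f2 := f2) (f3 := f3) hv3 hv4] at this
    refine (mul_eq_zero.mp ?_).resolve_left (mul_ne_zero (by norm_num : (-24 : ℂ) ≠ 0) (ht0 j))
    linear_combination this
  · have := h.orth_eq
    rw [hv3, hv4] at this
    linear_combination -this / 2

theorem PreFrame.wronskianInfty_ne_zero (hr : Params.Regular f0 f1 f2 f3) (h : PreFrame v w)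
    (ht : t.Injective) (hq : ∀ j, t j ^ 4 + f3 * t j ^ 3 + f2 * t j ^ 2 + f1 * t j + f0 = 0)
    (hv3 : v 3 = 2 * f0 ^ 2 * a) (hv4 : v 4 = 3 * f0 * b) :
    ¬ ∀ j, (⟨f0, f1, f2, f3, a, b, -1⟩ : Params ℂ).wronskianInfty (v 5 / 3) (t j) = 0 := by
  intro hw
  obtain ⟨ha, hb, hc⟩ :=
    Params.eq_zero_of_wronskianInfty (p := ⟨f0, f1, f2, f3, a, b, -1⟩)
      hr.left_ne_zero hr.f0_ne_zero ht hq hw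
  dsimp only at ha hb
  rcases h.v_cases with h' | h' | h' <;> refine h' ?_
  · simp [hv3, ha]
  · simp [hv4, hb]
  · linear_combination 3 * hc

theorem PreFrame.wronskianZero_ne_zero (hr : Params.Regular f0 f1 f2 f3) (h : PreFrame v w)
    (ht : t.Injective) (hq : ∀ j, t j ^ 4 + f3 * t j ^ 3 + f2 * t j ^ 2 + f1 * t j + f0 = 0) :
    ¬ ∀ j, Params.wronskianZero (w 2 / 2) (w 1 / 3) (w 0 / 3) (t j) = 0 := by
  intro hw
  obtain ⟨ha, hb, hc⟩ := Params.eq_zero_of_wronskianZero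
    (p := (⟨f0, f1, f2, f3, 0, 0, -1⟩ : Params ℂ)) hr.right_ne_zero ht hq hw
  rcases h.w_cases with h' | h' | h' <;> refine h' ?_
  · linear_combination 3 * hc
  · linear_combination 3 * hb
  · linear_combination 2 * ha

end Sol

/-- The subspace `H` is spanned by a frame whose first vector has the parameters `1` and `b`. -/
def Linked (f0 b : ℂ) (H : Submodule ℂ (Fin 6 → ℂ)) : Prop :=
  ∃ v w z, v ∈ H ∧ w ∈ H ∧ z ∈ H ∧ Frame v w z 1 1 ∧ v 3 = 2 * f0 ^ 2 ∧ v 4 = 3 * f0 * b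

section Count

variable {f0 f1 f2 f3 : ℂ} {t : Fin 4 → ℂ}

theorem exists_linked (hr : Params.Regular f0 f1 f2 f3) (ht : t.Injective)
    (hq : ∀ j, t j ^ 4 + f3 * t j ^ 3 + f2 * t j ^ 2 + f1 * t j + f0 = 0) {b : ℂ}
    (hb : (⟨f0, f1, f2, f3, 1, b, -1⟩ : Params ℂ).kdet = 0) :
    ∃ H ∈ problem t, Linked f0 b H := by
  obtain ⟨c, A, B, C, hs⟩ := hr.exists_sol hb
  set v : Fin 6 → ℂ := ![0, 0, 0, 2 * f0 ^ 2, 3 * f0 * b, 3 * c] with hv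
  set w : Fin 6 → ℂ := ![3 * C, 3 * B, 2 * A, 0, 0, 0] with hw
  have hv3 : v 3 = 2 * f0 ^ 2 := rfl
  have hv4 : v 4 = 3 * f0 * b := rfl
  have hv5 : v 5 / 3 = c := by simp [hv]
  have hw0 : w 0 / 3 = C := by simp [hw]
  have hw1 : w 1 / 3 = B := by simp [hw]
  have hw2 : w 2 / 2 = A := by simp [hw]
  have hd (j) := hs.wronskian_eq_zero rfl (hq j)
  have hp : PreFrame v w := by
    refine ⟨rfl, rfl, rfl, rfl, rfl, rfl, fun h => ?_, fun h => ?_, ?_⟩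
    · rw [h] at hv3
      exact mul_ne_zero two_ne_zero (pow_ne_zero 2 hr.f0_ne_zero) hv3.symm
    · simp only [h, Pi.zero_apply, zero_div] at hw0 hw1 hw2
      have := (Params.eq_zero_of_wronskianInfty (p := (⟨f0, f1, f2, f3, 1, b, -1⟩ : Params ℂ))
        hr.left_ne_zero hr.f0_ne_zero ht hq (c := c) fun j => by
          simpa [← hw0, ← hw1, ← hw2, Params.wronskianZero] using hd j).1
      exact one_ne_zero this
    · have := hs.orth
      simp [omega, hv, hw]
      linear_combination -2 * this
  obtain ⟨z, hz⟩ := hp.exists_frame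
  refine ⟨_, hz.mem_problem fun j => ?_, v, w, z, subset_span ⟨0, rfl⟩, subset_span ⟨1, rfl⟩,
    subset_span ⟨2, rfl⟩, hz, hv3, hv4⟩
  rw [hz.wronskian_eq_params (f1 := f1) (f2 := f2) (f3 := f3) (a := 1) (by rw [hv3, mul_one]) hv4,
    hv5, hw0, hw1, hw2, one_mul, one_mul, hd, mul_zero]

theorem Linked.mem_problem_det {H : Submodule ℂ (Fin 6 → ℂ)} (hH : H ∈ problem t)
    {v w z : Fin 6 → ℂ} {μ ν : ℂ} (h : Frame v w z μ ν) (hμ : μ ≠ 0) (hv : v ∈ H) (hw : w ∈ H)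
    (hz : z ∈ H) (j : Fin 4) : (Matrix.of ![jet v (t j), jet w (t j), jet z (t j)]).det = 0 := by
  rw [← exists_jet_eq_zero_iff (h.linearIndependent hμ), ← h.eq_span hμ hH.1 hv hw hz]
  exact hH.2.2.2.2 j

theorem Linked.eq (hr : Params.Regular f0 f1 f2 f3) (ht : t.Injective) (ht0 : ∀ j, t j ≠ 0)
    (hq : ∀ j, t j ^ 4 + f3 * t j ^ 3 + f2 * t j ^ 2 + f1 * t j + f0 = 0) {b : ℂ}
    {H H' : Submodule ℂ (Fin 6 → ℂ)} (hH : H ∈ problem t) (hH' : H' ∈ problem t)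
    (h : Linked f0 b H) (h' : Linked f0 b H') : H = H' := by
  obtain ⟨v, w, z, hv, hw, hz, hF, hv3, hv4⟩ := h
  obtain ⟨v', w', z', hv', hw', hz', hF', hv3', hv4'⟩ := h'
  have hs := hF.sol (a := 1) (b := b) ht ht0 hq
    (Linked.mem_problem_det hH hF one_ne_zero hv hw hz) (by rw [hv3, mul_one]) hv4
  have hs' := hF'.sol (a := 1) (b := b) ht ht0 hq
    (Linked.mem_problem_det hH' hF' one_ne_zero hv' hw' hz') (by rw [hv3', mul_one]) hv4'
  obtain ⟨hc, hw12⟩ := hr.eq_or_eq_neg hs hs'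
  have hvv : v = v' := by
    funext i
    fin_cases i <;> simp only [Fin.reduceFinMk, Fin.zero_eta, Fin.mk_one]
    · rw [hF.v0, hF'.v0]
    · rw [hF.v1, hF'.v1]
    · rw [hF.v2, hF'.v2]
    · rw [hv3, hv3']
    · rw [hv4, hv4']
    · linear_combination 3 * hc
  subst hvv
  wlog hpos : w = w' generalizing w' z'
  · have hneg : w = -w' := by
      rcases hw12 with ⟨h2, h1, h0⟩ | ⟨h2, h1, h0⟩
      · refine absurd (funext fun i => ?_) hpos
        fin_cases i <;> simp only [Fin.reduceFinMk, Fin.zero_eta, Fin.mk_one]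
        · linear_combination 3 * h0
        · linear_combination 3 * h1
        · linear_combination 2 * h2
        · rw [hF.w3, hF'.w3]
        · rw [hF.w4, hF'.w4]
        · rw [hF.w5, hF'.w5]
      · funext i
        fin_cases i <;> simp only [Fin.reduceFinMk, Fin.zero_eta, Fin.mk_one, Pi.neg_apply]
        · linear_combination 3 * h0
        · linear_combination 3 * h1
        · linear_combination 2 * h2
        · rw [hF.w3, hF'.w3, neg_zero]
        · rw [hF.w4, hF'.w4, neg_zero]
        · rw [hF.w5, hF'.w5, neg_zero]
    subst hneg
    simpa using this (-w') (-z') (neg_mem hw') (neg_mem hz') (by simp) hF'.neg hs rfl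
  subst hpos
  have hz'' : z ∈ H' := by
    have := (span_le.mpr (Set.insert_subset hv' (Set.singleton_subset_iff.mpr hw')))
      (hF.sub hF').mem_span_of_sub
    simpa using add_mem this hz'
  rw [hF.eq_span one_ne_zero hH.1 hv hw hz, hF.eq_span one_ne_zero hH'.1 hv' hw' hz'']

theorem Linked.parameter_eq (h0 : f0 ≠ 0) {b b' : ℂ} {H : Submodule ℂ (Fin 6 → ℂ)}
    (hH : Module.finrank ℂ H = 3) (h : Linked f0 b H) (h' : Linked f0 b' H) : b = b' := by
  obtain ⟨v, w, z, hv, hw, hz, hF, hv3, hv4⟩ := h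
  obtain ⟨v', w', z', hv', hw', hz', hF', hv3', hv4'⟩ := h'
  rw [hF.eq_span one_ne_zero hH hv hw hz] at hv'
  obtain ⟨α, β, γ, he⟩ := mem_span_range_three.mp hv'
  have e (i) : α * v i + β * w i + γ * z i = v' i := congrFun he i
  have e0 := e 0
  have e1 := e 1
  have e2 := e 2
  rw [hF.v0, hF'.v0] at e0
  rw [hF.v1, hF'.v1] at e1
  rw [hF.v2, hF'.v2] at e2
  have h3 : v 3 ≠ 0 := hv3 ▸ mul_ne_zero two_ne_zero (pow_ne_zero 2 h0)
  have hγ : γ = 0 := by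
    refine (mul_eq_zero.mp (?_ : γ * (1 * v 3) = 0)).resolve_right (by simpa using h3)
    rw [← hF.x2]
    linear_combination w 1 * e0 - w 0 * e1
  subst hγ
  have e3 := e 3
  have e4 := e 4
  rw [hF.w3, hv3, hv3'] at e3
  rw [hF.w4, hv4, hv4'] at e4
  have hα : α = 1 := mul_right_cancel₀ (hv3 ▸ h3) (by linear_combination e3)
  subst hα
  exact mul_left_cancel₀ (mul_ne_zero three_ne_zero h0) (by linear_combination e4)

theorem exists_root_of_mem_problem (hr : Params.Regular f0 f1 f2 f3) (ht : t.Injective)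
    (ht0 : ∀ j, t j ≠ 0)
    (hq : ∀ j, t j ^ 4 + f3 * t j ^ 3 + f2 * t j ^ 2 + f1 * t j + f0 = 0)
    {H : Submodule ℂ (Fin 6 → ℂ)} (hH : H ∈ problem t) :
    ∃ b, (⟨f0, f1, f2, f3, 1, b, -1⟩ : Params ℂ).kdet = 0 ∧ Linked f0 b H := by
  have h0 := hr.f0_ne_zero
  obtain ⟨v, w, z, μ, ν, hv, hw, hz, hF, hμν, hd⟩ := exists_frame_of_mem_problem hH
  have hd' (j) := (hF.wronskian_eq_params (f0 := f0) (f1 := f1) (f2 := f2) (f3 := f3)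
    (a := v 3 / (2 * f0 ^ 2)) (b := v 4 / (3 * f0)) (by field_simp) (by field_simp) (t j)).symm
      |>.trans (hd j)
  have hμ : μ ≠ 0 := by
    rintro rfl
    have hν : ν ≠ 0 := hμν.resolve_left (by simp)
    refine hF.wronskianZero_ne_zero hr ht hq fun j => ?_
    simpa [hν, ht0] using hd' j
  have hν : ν ≠ 0 := by
    rintro rfl
    refine hF.wronskianInfty_ne_zero hr ht hq (a := v 3 / (2 * f0 ^ 2)) (b := v 4 / (3 * f0))
      (by field_simp) (by field_simp) fun j => ?_
    simpa [hμ, ht0] using hd' j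
  have key (α : ℂ) (hα : α ≠ 0) : ∃ β γ : ℂ, Frame (α • v) (β • w) (γ • z) 1 1 := by
    obtain ⟨β, hβ⟩ := IsAlgClosed.exists_pow_nat_eq (α ^ 2 * ν / μ) two_pos
    have hβ0 : β ≠ 0 := by
      rintro rfl
      exact div_ne_zero (mul_ne_zero (pow_ne_zero 2 hα) hν) hμ (by simpa using hβ.symm)
    refine ⟨β, α / (μ * β), ?_⟩
    convert hF.smul hα hβ0 (α / (μ * β)) using 1
    · field_simp
    · field_simp at hβ ⊢
      linear_combination hβ
  have sol {α a b : ℂ} (hα : α ≠ 0) (h3 : α * v 3 = 2 * f0 ^ 2 * a) (h4 : α * v 4 = 3 * f0 * b) :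
      ∃ β γ : ℂ, Frame (α • v) (β • w) (γ • z) 1 1 ∧
        (⟨f0, f1, f2, f3, a, b, -1⟩ : Params ℂ).Sol ((α • v) 5 / 3) ((β • w) 2 / 2)
          ((β • w) 1 / 3) ((β • w) 0 / 3) := by
    obtain ⟨β, γ, h⟩ := key α hα
    exact ⟨β, γ, h, h.sol ht ht0 hq (Linked.mem_problem_det hH h one_ne_zero
      (H.smul_mem _ hv) (H.smul_mem _ hw) (H.smul_mem _ hz)) h3 h4⟩
  by_cases h3 : v 3 = 0
  · exfalso
    by_cases h4 : v 4 = 0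
    · obtain ⟨β, γ, h, hs⟩ := sol (α := 1) (a := 0) (b := 0) one_ne_zero (by simp [h3])
        (by simp [h4])
      have h5 : ((1 : ℂ) • v) 5 ≠ 0 := by
        have := h.v_cases
        simpa [h3, h4] using this
      have hC : (β • w) 0 / 3 = 0 := by
        have := hs.orth
        simp only [mul_zero, zero_mul, sub_zero, zero_add] at this
        refine (mul_eq_zero.mp this).resolve_left ?_
        simpa using h5
      rw [hC] at hs
      obtain ⟨hs, -⟩ := (Params.sol_iff_defect rfl).mp hs
      have hA := congrFun hs 0
      have hc := congrFun hs 1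
      simp [Params.defect, Params.g0, Params.g1, Params.g2, h0] at hA hc
      have hA' : β * w 2 / 2 = 0 := by rw [mul_eq_zero.mpr hA, zero_div]
      rw [hA'] at hc
      simp at hc h5
      exact h5 hc
    · obtain ⟨β, γ, h, hs⟩ := sol (α := 3 * f0 / v 4) (a := 0) (b := 1)
        (div_ne_zero (mul_ne_zero three_ne_zero h0) h4) (by simp [h3]) (by field_simp)
      exact hr.kdet_ne_zero (hs.kdet_eq_zero rfl h0)
  · obtain ⟨β, γ, h, hs⟩ := sol (α := 2 * f0 ^ 2 / v 3) (a := 1) (b := 2 * f0 * v 4 / (3 * v 3))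
      (div_ne_zero (mul_ne_zero two_ne_zero (pow_ne_zero 2 h0)) h3) (by field_simp)
      (by field_simp)
    refine ⟨_, hs.kdet_eq_zero rfl h0, _, _, _, H.smul_mem _ hv, H.smul_mem _ hw, H.smul_mem _ hz,
      h, ?_, ?_⟩ <;> simp <;> field_simp

/-- For regular parameters there are sixteen solutions. -/
theorem ncard_problem (hr : Params.Regular f0 f1 f2 f3) (ht : t.Injective)
    (ht0 : ∀ j, t j ≠ 0)
    (hq : ∀ j, t j ^ 4 + f3 * t j ^ 3 + f2 * t j ^ 2 + f1 * t j + f0 = 0) :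
    (problem t).ncard = 16 := by
  rw [← hr.card_roots]
  have key (b : ℂ) (hb : b ∈ {b | (⟨f0, f1, f2, f3, 1, b, -1⟩ : Params ℂ).kdet = 0}) :=
    exists_linked hr ht hq hb
  choose! Φ hΦ hL using key
  refine (Set.ncard_congr (fun b _ => Φ b) hΦ (fun b b' hb hb' he => ?_) fun H hH => ?_).symm
  · exact (hL b hb).parameter_eq hr.f0_ne_zero (hΦ b hb).1 (he ▸ hL b' hb')
  · obtain ⟨b, hb, hl⟩ := exists_root_of_mem_problem hr ht ht0 hq hH
    exact ⟨b, hb, Linked.eq hr ht ht0 hq (hΦ b hb) hH (hL b hb) hl⟩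

end Count

end Geometry

namespace Geometry

open Submodule

/-- The quintic with coefficients `u` in the forms `l * (y - r)` and `y - q`, as a vector which is
paired with the rational normal curve. -/
def transform (l r q : ℂ) : (Fin 6 → ℂ) →ₗ[ℂ] (Fin (2 * 3) → ℂ) where
  toFun u := ![
    120 * (u 0 + l * u 1 + l ^ 2 * u 2 + l ^ 3 * u 3 + l ^ 4 * u 4 + l ^ 5 * u 5),
    24 * (5 * q * u 0 + (r + 4 * q) * l * u 1 + (2 * r + 3 * q) * l ^ 2 * u 2 +
      (3 * r + 2 * q) * l ^ 3 * u 3 + (4 * r + q) * l ^ 4 * u 4 + 5 * r * l ^ 5 * u 5),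
    6 * (10 * q ^ 2 * u 0 + (4 * r * q + 6 * q ^ 2) * l * u 1 +
      (r ^ 2 + 6 * r * q + 3 * q ^ 2) * l ^ 2 * u 2 +
      (3 * r ^ 2 + 6 * r * q + q ^ 2) * l ^ 3 * u 3 + (6 * r ^ 2 + 4 * r * q) * l ^ 4 * u 4 +
      10 * r ^ 2 * l ^ 5 * u 5),
    2 * (10 * q ^ 3 * u 0 + (6 * r * q ^ 2 + 4 * q ^ 3) * l * u 1 +
      (3 * r ^ 2 * q + 6 * r * q ^ 2 + q ^ 3) * l ^ 2 * u 2 +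
      (r ^ 3 + 6 * r ^ 2 * q + 3 * r * q ^ 2) * l ^ 3 * u 3 +
      (4 * r ^ 3 + 6 * r ^ 2 * q) * l ^ 4 * u 4 + 10 * r ^ 3 * l ^ 5 * u 5),
    -(5 * q ^ 4 * u 0 + (4 * r * q ^ 3 + q ^ 4) * l * u 1 +
      (3 * r ^ 2 * q ^ 2 + 2 * r * q ^ 3) * l ^ 2 * u 2 +
      (2 * r ^ 3 * q + 3 * r ^ 2 * q ^ 2) * l ^ 3 * u 3 +
      (r ^ 4 + 4 * r ^ 3 * q) * l ^ 4 * u 4 + 5 * r ^ 4 * l ^ 5 * u 5),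
    q ^ 5 * u 0 + r * q ^ 4 * l * u 1 + r ^ 2 * q ^ 3 * l ^ 2 * u 2 + r ^ 3 * q ^ 2 * l ^ 3 * u 3 +
      r ^ 4 * q * l ^ 4 * u 4 + r ^ 5 * l ^ 5 * u 5]
  map_add' u w := by
    funext i
    fin_cases i <;> simp <;> ring
  map_smul' c u := by
    funext i
    fin_cases i <;> simp <;> ring

section Transform

variable {l r q : ℂ}

theorem pair0_transform (l r q : ℂ) (u : Fin 6 → ℂ) (s : ℂ) :
    pair0 (transform l r q u) s =
      u 0 * (s - q) ^ 5 + u 1 * (l * (s - r)) * (s - q) ^ 4 +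
        u 2 * (l * (s - r)) ^ 2 * (s - q) ^ 3 + u 3 * (l * (s - r)) ^ 3 * (s - q) ^ 2 +
        u 4 * (l * (s - r)) ^ 4 * (s - q) + u 5 * (l * (s - r)) ^ 5 := by
  simp [pair0, transform]
  ring

theorem pair1_transform (l r q : ℂ) (u : Fin 6 → ℂ) (s : ℂ) :
    pair1 (transform l r q u) s =
      5 * u 0 * (s - q) ^ 4 + u 1 * (4 * (l * (s - r)) * (s - q) ^ 3 + l * (s - q) ^ 4) +
        u 2 * (3 * (l * (s - r)) ^ 2 * (s - q) ^ 2 + 2 * l * (l * (s - r)) * (s - q) ^ 3) +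
        u 3 * (2 * (l * (s - r)) ^ 3 * (s - q) + 3 * l * (l * (s - r)) ^ 2 * (s - q) ^ 2) +
        u 4 * ((l * (s - r)) ^ 4 + 4 * l * (l * (s - r)) ^ 3 * (s - q)) +
        u 5 * (5 * l * (l * (s - r)) ^ 4) := by
  simp [pair1, transform]
  ring

theorem pair2_transform (l r q : ℂ) (u : Fin 6 → ℂ) (s : ℂ) :
    pair2 (transform l r q u) s =
      20 * u 0 * (s - q) ^ 3 + u 1 * (12 * (l * (s - r)) * (s - q) ^ 2 + 8 * l * (s - q) ^ 3) +
        u 2 * (6 * (l * (s - r)) ^ 2 * (s - q) + 12 * l * (l * (s - r)) * (s - q) ^ 2 +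
          2 * l ^ 2 * (s - q) ^ 3) +
        u 3 * (2 * (l * (s - r)) ^ 3 + 12 * l * (l * (s - r)) ^ 2 * (s - q) +
          6 * l ^ 2 * (l * (s - r)) * (s - q) ^ 2) +
        u 4 * (8 * l * (l * (s - r)) ^ 3 + 12 * l ^ 2 * (l * (s - r)) ^ 2 * (s - q)) +
        u 5 * (20 * l ^ 2 * (l * (s - r)) ^ 3) := by
  simp [pair2, transform]
  ring

theorem formLC_transform (l r q : ℂ) (u w : Fin 6 → ℂ) :
    formLC 3 (transform l r q u) (transform l r q w) = 12 * (l * (r - q)) ^ 5 * omega u w := by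
  rw [formLC_three]
  simp [transform, omega]
  ring

theorem formLC_transform_eq_zero (hl : l ≠ 0) (hrq : r ≠ q) {u w : Fin 6 → ℂ} :
    formLC 3 (transform l r q u) (transform l r q w) = 0 ↔ omega u w = 0 := by
  rw [formLC_transform]
  simp [hl, sub_eq_zero, hrq]

theorem transform_injective (hl : l ≠ 0) (hrq : r ≠ q) :
    Function.Injective (transform l r q) := by
  refine (injective_iff_map_eq_zero _).mpr fun u hu => ?_
  have key (w : Fin 6 → ℂ) : omega u w = 0 := by
    rw [← formLC_transform_eq_zero hl hrq, hu]
    simp [formLC]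
  funext i
  fin_cases i
  · simpa [omega] using key (Pi.single 5 1)
  · simpa [omega] using key (Pi.single 4 1)
  · simpa [omega] using key (Pi.single 3 1)
  · simpa [omega] using key (Pi.single 2 1)
  · simpa [omega] using key (Pi.single 1 1)
  · simpa [omega] using key (Pi.single 0 1)

theorem transform_mem_oscLC_iff (hl : l ≠ 0) (hrq : r ≠ q) {s t : ℂ} (hs : s ≠ q)
    (ht : t * (s - q) = l * (s - r)) (u : Fin 6 → ℂ) :
    transform l r q u ∈ oscLC 3 3 s ↔ jet u t = 0 := by
  have hs' := sub_ne_zero.mpr hs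
  have hlt : l - t ≠ 0 := by
    intro h
    refine mul_ne_zero hl (sub_ne_zero.mpr hrq) ?_
    linear_combination ht + (s - q) * h
  have h0 : pair0 (transform l r q u) s = (s - q) ^ 5 * jet u t 0 := by
    rw [pair0_transform, ← ht]
    simp [jet]
    ring
  have h1 : pair1 (transform l r q u) s =
      (s - q) ^ 4 * (5 * jet u t 0 + (l - t) * jet u t 1) := by
    rw [pair1_transform, ← ht]
    simp [jet]
    ring
  have h2 : pair2 (transform l r q u) s =
      (s - q) ^ 3 * (20 * jet u t 0 + 8 * (l - t) * jet u t 1 + (l - t) ^ 2 * jet u t 2) := by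
    rw [pair2_transform, ← ht]
    simp [jet]
    ring
  rw [mem_oscLC_iff, h0, h1, h2]
  constructor
  · rintro ⟨h0, h1, h2⟩
    have e0 : jet u t 0 = 0 := by simpa [hs'] using h0
    have e1 : jet u t 1 = 0 := by simpa [hs', e0, hlt] using h1
    have e2 : jet u t 2 = 0 := by simpa [hs', e0, e1, hlt] using h2
    funext i
    fin_cases i <;> assumption
  · intro h
    simp [h]

theorem transform_mem_oscLC_left_iff (hl : l ≠ 0) (hrq : r ≠ q) (u : Fin 6 → ℂ) :
    transform l r q u ∈ oscLC 3 3 r ↔ u 0 = 0 ∧ u 1 = 0 ∧ u 2 = 0 := by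
  rw [transform_mem_oscLC_iff (t := 0) hl hrq hrq (by simp)]
  simp [jet]

theorem transform_mem_oscLC_right_iff (hl : l ≠ 0) (hrq : r ≠ q) (u : Fin 6 → ℂ) :
    transform l r q u ∈ oscLC 3 3 q ↔ u 3 = 0 ∧ u 4 = 0 ∧ u 5 = 0 := by
  have hqr := sub_ne_zero.mpr hrq.symm
  rw [mem_oscLC_iff, pair0_transform, pair1_transform, pair2_transform]
  constructor
  · rintro ⟨h0, h1, h2⟩
    have e5 : u 5 = 0 := by simpa [hl, hqr] using h0
    have e4 : u 4 = 0 := by simpa [hl, hqr, e5] using h1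
    have e3 : u 3 = 0 := by simpa [hl, hqr, e4, e5] using h2
    exact ⟨e3, e4, e5⟩
  · rintro ⟨e3, e4, e5⟩
    simp [e3, e4, e5]

theorem map_transform_inf_ne_bot (hl : l ≠ 0) (hrq : r ≠ q) (H : Submodule ℂ (Fin 6 → ℂ)) (s : ℂ) :
    H.map (transform l r q) ⊓ oscLC 3 3 s ≠ ⊥ ↔
      ∃ u ∈ H, u ≠ 0 ∧ transform l r q u ∈ oscLC 3 3 s := by
  rw [Submodule.ne_bot_iff]
  constructor
  · rintro ⟨x, ⟨⟨u, hu, rfl⟩, hx⟩, hx0⟩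
    exact ⟨u, hu, fun h => hx0 (by rw [h, map_zero]), hx⟩
  · rintro ⟨u, hu, hu0, hx⟩
    exact ⟨_, ⟨mem_map_of_mem hu, hx⟩,
      (map_ne_zero_iff _ (transform_injective hl hrq)).mpr hu0⟩

theorem map_transform_isotropic_iff (hl : l ≠ 0) (hrq : r ≠ q) (H : Submodule ℂ (Fin 6 → ℂ)) :
    (∀ x ∈ H.map (transform l r q), ∀ y ∈ H.map (transform l r q), formLC 3 x y = 0) ↔
      ∀ x ∈ H, ∀ y ∈ H, omega x y = 0 := by
  simp [formLC_transform_eq_zero hl hrq]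

/-- The number of Lagrangian subspaces meeting six osculating spaces. -/
theorem ncard_lagrangian (hl : l ≠ 0) (hrq : r ≠ q) {s t : Fin 4 → ℂ} (hs : ∀ j, s j ≠ q)
    (ht : ∀ j, t j * (s j - q) = l * (s j - r)) :
    {H : Submodule ℂ (Fin (2 * 3) → ℂ) | Module.finrank ℂ H = 3 ∧
      (∀ x ∈ H, ∀ y ∈ H, formLC 3 x y = 0) ∧ H ⊓ oscLC 3 3 r ≠ ⊥ ∧ H ⊓ oscLC 3 3 q ≠ ⊥ ∧
        ∀ j, H ⊓ oscLC 3 3 (s j) ≠ ⊥}.ncard = (problem t).ncard := by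
  have hi := transform_injective hl hrq
  rw [← Set.ncard_image_of_injective (problem t) (Submodule.map_injective_of_injective hi)]
  congr 1
  ext H
  obtain ⟨H, rfl⟩ : ∃ H' : Submodule ℂ (Fin 6 → ℂ), H'.map (transform l r q) = H :=
    Submodule.map_surjective_of_surjective (LinearMap.injective_iff_surjective_of_finrank_eq_finrank
      (by simp) |>.mp hi) H
  rw [(Submodule.map_injective_of_injective hi).mem_set_image]
  have hf := (Submodule.equivMapOfInjective _ hi H).finrank_eq
  have ho := map_transform_isotropic_iff hl hrq H
  have hR : H.map (transform l r q) ⊓ oscLC 3 3 r ≠ ⊥ ↔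
      ∃ u ∈ H, u ≠ 0 ∧ u 0 = 0 ∧ u 1 = 0 ∧ u 2 = 0 :=
    (map_transform_inf_ne_bot hl hrq H r).trans (exists_congr fun u => and_congr_right fun _ =>
      and_congr_right fun _ => transform_mem_oscLC_left_iff hl hrq u)
  have hQ : H.map (transform l r q) ⊓ oscLC 3 3 q ≠ ⊥ ↔
      ∃ u ∈ H, u ≠ 0 ∧ u 3 = 0 ∧ u 4 = 0 ∧ u 5 = 0 :=
    (map_transform_inf_ne_bot hl hrq H q).trans (exists_congr fun u => and_congr_right fun _ =>
      and_congr_right fun _ => transform_mem_oscLC_right_iff hl hrq u)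
  have hS (j) : H.map (transform l r q) ⊓ oscLC 3 3 (s j) ≠ ⊥ ↔
      ∃ u ∈ H, u ≠ 0 ∧ jet u (t j) = 0 :=
    (map_transform_inf_ne_bot hl hrq H _).trans (exists_congr fun u => and_congr_right fun _ =>
      and_congr_right fun _ => transform_mem_oscLC_iff hl hrq (hs j) (ht j) u)
  constructor
  · rintro ⟨h1, h2, h3, h4, h5⟩
    exact ⟨hf.trans h1, ho.mp h2, hQ.mp h4, hR.mp h3, fun j => (hS j).mp (h5 j)⟩
  · rintro ⟨h1, h2, h3, h4, h5⟩
    exact ⟨hf.symm.trans h1, ho.mpr h2, hR.mpr h4, hQ.mpr h3, fun j => (hS j).mpr (h5 j)⟩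

end Transform

end Geometry

namespace Geometry

theorem injective_of_mul_sub_eq {ι K : Type*} [Field K] {l r q : K} (hl : l ≠ 0) (hrq : r ≠ q)
    {s t : ι → K} (hs : s.Injective) (ht : ∀ j, t j * (s j - q) = l * (s j - r)) :
    t.Injective := by
  intro i j hij
  by_contra hne
  have hti : t i = l := by
    refine mul_right_cancel₀ (sub_ne_zero.mpr (hs.ne hne)) ?_
    linear_combination ht i - ht j + (q - s j) * hij
  have h := ht i
  rw [hti] at h
  exact hrq (by linear_combination mul_left_cancel₀ hl h)

theorem ncard_eq_sixteen {T : Finset ℕ}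
    (hT : T ⊆ ({1, 2, 3, 4, 5, 6, 11, 12, 13, 17, 19, 23} : Finset ℕ)) (hcard : T.card = 6) :
    {H : Submodule ℂ (Fin (2 * 3) → ℂ) | Module.finrank ℂ H = 3 ∧
      (∀ x ∈ H, ∀ y ∈ H, formLC 3 x y = 0) ∧
        ∀ t ∈ T, H ⊓ oscLC 3 3 (t : ℂ) ≠ ⊥}.ncard = 16 := by
  obtain ⟨l, r, q, x, y, z, w, hnodup, rfl, hreg⟩ := Cover.exists_regularRoots hT hcard
  set t : Fin 4 → ℂ := ![Cover.coord (l : ℂ) r q x y z w, Cover.coord (l : ℂ) r q y x z w,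
    Cover.coord (l : ℂ) r q z x y w, Cover.coord (l : ℂ) r q w x y z] with ht_def
  set s : Fin 4 → ℂ := ![(x : ℂ), (y : ℂ), (z : ℂ), (w : ℂ)] with hs_def
  set L : ℂ := l * ((x - q) * (y - q) * (z - q) * (w - q)) with hL_def
  simp only [List.nodup_cons, List.mem_cons, List.not_mem_nil, or_false, not_or] at hnodup
  obtain ⟨⟨hrq, -⟩, ⟨hqx, hqy, hqz, hqw⟩, ⟨hxy, hxz, hxw⟩, ⟨hyz, hyw⟩, hzw, -⟩ := hnodup
  have hreg' : Params.Regular (t 0 * t 1 * t 2 * t 3)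
    (-(t 0 * t 1 * t 2 + t 0 * t 1 * t 3 + t 0 * t 2 * t 3 + t 1 * t 2 * t 3))
    (t 0 * t 1 + t 0 * t 2 + t 0 * t 3 + t 1 * t 2 + t 1 * t 3 + t 2 * t 3)
    (-(t 0 + t 1 + t 2 + t 3)) := hreg
  have ht0 (j) : t j ≠ 0 := by
    have := hreg'.f0_ne_zero
    simp only [mul_ne_zero_iff] at this
    fin_cases j
    exacts [this.1.1.1, this.1.1.2, this.1.2, this.2]
  have hl : (l : ℂ) ≠ 0 := by
    intro h
    exact ht0 0 (by simp [ht_def, Cover.coord, h])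
  have hL : L ≠ 0 := by
    simp [hL_def, sub_eq_zero, Nat.cast_inj, Ne.symm hqx, Ne.symm hqy, Ne.symm hqz, Ne.symm hqw]
    exact_mod_cast hl
  have hrq' : (r : ℂ) ≠ q := by exact_mod_cast hrq
  have hs (j) : s j ≠ q := by
    fin_cases j <;> simp [hs_def, Ne.symm hqx, Ne.symm hqy, Ne.symm hqz, Ne.symm hqw]
  have ht (j) : t j * (s j - q) = L * (s j - r) := by
    fin_cases j <;> simp [ht_def, hs_def, hL_def, Cover.coord] <;> ring
  have hsi : s.Injective := by
    intro i j h
    fin_cases i <;> fin_cases j <;> simp_all [eq_comm]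
  have hq (j) : t j ^ 4 + -(t 0 + t 1 + t 2 + t 3) * t j ^ 3 +
      (t 0 * t 1 + t 0 * t 2 + t 0 * t 3 + t 1 * t 2 + t 1 * t 3 + t 2 * t 3) * t j ^ 2 +
      -(t 0 * t 1 * t 2 + t 0 * t 1 * t 3 + t 0 * t 2 * t 3 + t 1 * t 2 * t 3) * t j +
      t 0 * t 1 * t 2 * t 3 = 0 := by
    fin_cases j <;> simp only [Fin.reduceFinMk, Fin.zero_eta, Fin.mk_one] <;> ring
  rw [← ncard_problem hreg' (injective_of_mul_sub_eq hL hrq' hsi ht) ht0 hq,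
    ← ncard_lagrangian hL hrq' hs ht]
  simp [Fin.forall_fin_succ, hs_def]

theorem not_conjStableLC_of_card {T : Finset ℕ} (hcard : T.card = 6)
    {H : Submodule ℂ (Fin (2 * 3) → ℂ)} (hH : Module.finrank ℂ H = 3)
    (hi : ∀ x ∈ H, ∀ y ∈ H, formLC 3 x y = 0) (hm : ∀ t ∈ T, H ⊓ oscLC 3 3 (t : ℂ) ≠ ⊥) :
    ¬ conjStableLC 3 H := by
  refine not_conjStableLC hH hi
    (s := fun j => ((T.orderEmbOfFin hcard (Fin.castLE (by norm_num) j) : ℕ) : ℝ)) ?_ fun j => ?_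
  · exact Nat.strictMono_cast.comp ((T.orderEmbOfFin hcard).strictMono.comp
      (Fin.strictMono_castLE (by norm_num)))
  · rw [Complex.ofReal_natCast]
    exact hm _ (T.orderEmbOfFin_mem hcard _)

end Geometry

end Wronski

/-- For `n = 3` and every 6-element subset `T` of `{1,2,3,4,5,6,11,12,13,17,19,23}`, the
set of Lagrangian subspaces `H ⊆ ℂ⁶` with `H ∩ F₃(t) ≠ 0` for all `t ∈ T` has exactly
sixteen elements, and none of them is real. -/
theorem stmt_14 (T : Finset ℕ)
    (hT : T ⊆ ({1, 2, 3, 4, 5, 6, 11, 12, 13, 17, 19, 23} : Finset ℕ))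
    (hcard : T.card = 6) :
    {H : Submodule ℂ (Fin (2 * 3) → ℂ) |
        Module.finrank ℂ H = 3 ∧
        (∀ x ∈ H, ∀ y ∈ H, formLC 3 x y = 0) ∧
        ∀ t ∈ T, H ⊓ oscLC 3 3 (t : ℂ) ≠ ⊥}.Finite ∧
      {H : Submodule ℂ (Fin (2 * 3) → ℂ) |
        Module.finrank ℂ H = 3 ∧
        (∀ x ∈ H, ∀ y ∈ H, formLC 3 x y = 0) ∧
        ∀ t ∈ T, H ⊓ oscLC 3 3 (t : ℂ) ≠ ⊥}.ncard = 16 ∧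
      ∀ H ∈ {H : Submodule ℂ (Fin (2 * 3) → ℂ) |
        Module.finrank ℂ H = 3 ∧
        (∀ x ∈ H, ∀ y ∈ H, formLC 3 x y = 0) ∧
        ∀ t ∈ T, H ⊓ oscLC 3 3 (t : ℂ) ≠ ⊥}, ¬ conjStableLC 3 H := by
  have h := Wronski.Geometry.ncard_eq_sixteen hT hcard
  exact ⟨Set.finite_of_ncard_ne_zero (by rw [h]; norm_num), h, fun _ hH =>
    Wronski.Geometry.not_conjStableLC_of_card hcard hH.1 hH.2.1 hH.2.2⟩
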